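/- There exists a finite set Ω' of twenty-two L-sentences, each an instance of the Replacement scheme, and a function F mapping L-formulas to L-formulas, such that: for every set Φ of L-formulas and every countable transitive set M with (M,∈) ⊨ ZC ∪ {Replacement(F(φ)) : φ ∈ Φ} ∪ Ω', there exists a countable transitive set N with M ⊆ N, containing exactly the same ordinals as M, such that (N,∈) ⊨ ZC ∪ {Replacement(φ) : φ ∈ Φ} ∪ {CH}. -/

import Mathlib

namespace CtmForcing

open FirstOrder FirstOrder.Language

/-! ### The first-order language of set theory -/

/-- The relation symbols of the language of set theory: a single binary relation `∈`. -/
inductive memRel : ℕ → Type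
  | mem : memRel 2

/-- The first-order language `L` of set theory, with a single binary relation symbol `∈`. -/
def SetLang : Language := ⟨fun _ => Empty, memRel⟩

/-- The membership relation symbol. -/
abbrev memSymb : SetLang.Relations 2 := .mem

/-- `L`-formulas (with no free "unbounded" variables) whose free variables are among
`v₀, …, v_{n-1}`. -/
abbrev BF (n : ℕ) := SetLang.BoundedFormula Empty n

/-- The atomic formula `vᵢ ∈ vⱼ`. -/
def memf {n : ℕ} (i j : Fin n) : BF n :=
  memSymb.boundedFormula₂ (Term.var (Sum.inr i)) (Term.var (Sum.inr j))

/-- The atomic formula `vᵢ = vⱼ`. -/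
def eqf {n : ℕ} (i j : Fin n) : BF n :=
  Term.bdEqual (Term.var (Sum.inr i)) (Term.var (Sum.inr j))

/-- Rename the free variables of a formula along `f`. -/
def reindex {m k : ℕ} (f : Fin m → Fin k) (φ : BF m) : BF k :=
  (BoundedFormula.relabel (Sum.map id f) φ.toFormula : SetLang.BoundedFormula Empty (k + 0))

/-- Conjunction. -/
def andF {n : ℕ} (φ ψ : BF n) : BF n := (φ.imp ψ.not).not

/-- Disjunction. -/
def orF {n : ℕ} (φ ψ : BF n) : BF n := (φ.not).imp ψ

/-- Biimplication. -/
def iffF {n : ℕ} (φ ψ : BF n) : BF n := andF (φ.imp ψ) (ψ.imp φ)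

/-! ### Basic set-theoretic formulas -/

/-- `v₀ ⊆ v₁`. -/
def subF : BF 2 := ((memf 2 0).imp (memf 2 1)).all

/-- `v₀ = ∅`. -/
def emptyF : BF 1 := ((memf 1 0).not).all

/-- `v₂ = {v₀, v₁}`. -/
def pairSetF : BF 3 := (iffF (memf 3 2) (orF (eqf 3 0) (eqf 3 1))).all

/-- `v₁ = {v₀}`. -/
def singF : BF 2 := reindex ![0, 0, 1] pairSetF

/-- `v₂ = ⟨v₀, v₁⟩` (Kuratowski ordered pair). -/
def opF : BF 3 :=
  (iffF (memf 3 2) (orF (reindex ![0, 3] singF) (reindex ![0, 1, 3] pairSetF))).all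

/-- `v₁ = v₀ ∪ {v₀}`. -/
def succF : BF 2 := (iffF (memf 2 1) (orF (memf 2 0) (eqf 2 0))).all

/-- `v₀` is transitive. -/
def transF : BF 1 := ((memf 1 0).imp (reindex ![1, 0] subF)).all

/-- `v₀` is an ordinal (a transitive set of transitive sets). -/
def ordF : BF 1 := andF transF (((memf 1 0).imp (reindex ![1] transF)).all)

/-- `⟨v₀, v₁⟩ ∈ v₂`. -/
def relMemF : BF 3 := (andF (reindex ![0, 1, 3] opF) (memf 3 2)).ex

/-- `v₂` is a function with domain `v₀` mapping onto `v₁` (a surjection from `v₀` onto `v₁`). -/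
def isFuncF : BF 3 :=
  andF
    (andF
      -- v₂ ⊆ v₀ × v₁
      (((memf 3 2).imp
        (((andF (andF (memf 4 0) (memf 5 1)) (reindex ![4, 5, 3] opF)).ex).ex)).all)
      -- total on v₀
      (((memf 3 0).imp ((andF (memf 4 1) (reindex ![3, 4, 2] relMemF)).ex)).all))
    (andF
      -- functional
      ((((andF (reindex ![3, 4, 2] relMemF) (reindex ![3, 5, 2] relMemF)).imp
          (eqf 4 5)).all).all.all)
      -- onto v₁
      (((memf 3 1).imp ((andF (memf 4 0) (reindex ![4, 3, 2] relMemF)).ex)).all))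

/-- `v₂` is injective (as a set of ordered pairs). -/
def injF : BF 3 :=
  ((((andF (reindex ![3, 5, 2] relMemF) (reindex ![4, 5, 2] relMemF)).imp
      (eqf 3 4)).all).all).all

/-- `v₂` is a bijection from `v₀` onto `v₁`. -/
def bijF : BF 3 := andF isFuncF injF

/-! ### The axioms of set theory as `L`-sentences -/

/-- Extensionality. -/
def extAx : SetLang.Sentence :=
  ((((andF subF (reindex ![1, 0] subF)).imp (eqf 0 1)).all).all : BF 0)

/-- Foundation. -/
def foundAx : SetLang.Sentence :=
  (((((memf 1 0).ex).imp
    ((andF (memf 1 0) (((memf 2 0).imp ((memf 2 1).not)).all)).ex)).all) : BF 0)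

/-- Pairing. -/
def pairAx : SetLang.Sentence := (((pairSetF.ex).all).all : BF 0)

/-- Union. -/
def unionAx : SetLang.Sentence :=
  (((((iffF (memf 2 1) ((andF (memf 3 0) (memf 2 3)).ex)).all).ex).all : BF 0))

/-- Powerset. -/
def powF : BF 2 := (iffF (memf 2 1) (reindex ![2, 0] subF)).all

/-- Powerset axiom. -/
def powAx : SetLang.Sentence := (((powF.ex).all) : BF 0)

/-- Infinity. -/
def infAx : SetLang.Sentence :=
  (((andF ((andF (memf 1 0) (reindex ![1] emptyF)).ex)
    (((memf 1 0).imp ((andF (memf 2 0) (reindex ![1, 2] succF)).ex)).all)).ex) : BF 0)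

/-- The instance of the Separation scheme given by `φ`, whose free variables are among
`v₀, …, vₙ`: the parameters are `v₀, …, v_{n-1}` and the tested element is `vₙ`.  It is the
universal closure of `∀A ∃B ∀x (x ∈ B ↔ x ∈ A ∧ φ(params, x))`. -/
def sepAx {n : ℕ} (φ : BF (n + 1)) : SetLang.Sentence :=
  -- context `n+3`: parameters `0,…,n-1`, `A = n`, `B = n+1`, `x = n+2`
  let A : Fin (n + 3) := ⟨n, by omega⟩
  let B : Fin (n + 3) := ⟨n + 1, by omega⟩
  let x : Fin (n + 3) := ⟨n + 2, by omega⟩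
  let φ' : BF (n + 3) := reindex (fun i => if h : (i : ℕ) < n then ⟨i, by omega⟩ else x) φ
  ((((iffF (memf x B) (andF (memf x A) φ')).all).ex).all).alls

/-- The instance of the Replacement scheme given by `φ`, whose free variables are among
`v₀, …, v_{n+1}`: the parameters are `v₀, …, v_{n-1}`, the argument is `x = vₙ`, and the
value is `y = v_{n+1}`.  It is the universal closure of
`∀A [(∀x∈A ∀y ∀y' (φ(x,y) ∧ φ(x,y') → y = y')) → ∃B ∀y (y ∈ B ↔ ∃x∈A φ(x,y))]`. -/
def replAx {n : ℕ} (φ : BF (n + 2)) : SetLang.Sentence :=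
  -- functionality context `n+4`: parameters, `A = n`, `x = n+1`, `y = n+2`, `y' = n+3`
  let A : Fin (n + 4) := ⟨n, by omega⟩
  let x : Fin (n + 4) := ⟨n + 1, by omega⟩
  let y : Fin (n + 4) := ⟨n + 2, by omega⟩
  let y' : Fin (n + 4) := ⟨n + 3, by omega⟩
  let φ₁ : BF (n + 4) :=
    reindex (fun i => if h : (i : ℕ) < n then ⟨i, by omega⟩ else if (i : ℕ) = n then x else y) φ
  let φ₂ : BF (n + 4) :=
    reindex (fun i => if h : (i : ℕ) < n then ⟨i, by omega⟩ else if (i : ℕ) = n then x else y') φ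
  let funcl : BF (n + 1) :=
    ((((andF (memf x A) (andF φ₁ φ₂)).imp (eqf y y')).all).all).all
  -- image context `n+4`: parameters, `A = n`, `B = n+1`, `y = n+2`, `x = n+3`
  let xi : Fin (n + 4) := ⟨n + 3, by omega⟩
  let yi : Fin (n + 4) := ⟨n + 2, by omega⟩
  let B3 : Fin (n + 3) := ⟨n + 1, by omega⟩
  let y3 : Fin (n + 3) := ⟨n + 2, by omega⟩
  let φ₃ : BF (n + 4) :=
    reindex (fun i => if h : (i : ℕ) < n then ⟨i, by omega⟩ else if (i : ℕ) = n then xi else yi) φ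
  let image : BF (n + 1) :=
    (((iffF (memf y3 B3) ((andF (memf xi A) φ₃).ex)).all).ex)
  ((funcl.imp image).all).alls

/-- The Axiom of Choice: every set is the surjective image of an ordinal. -/
def acAx : SetLang.Sentence :=
  ((((andF (reindex ![1] ordF) (reindex ![1, 0, 2] isFuncF)).ex).ex).all : BF 0)

/-- `v₀ = ω`: `v₀` is an ordinal containing `∅`, closed under successors, each of whose
elements is `∅` or a successor. -/
def omegaF : BF 1 :=
  andF (andF ordF ((andF (memf 1 0) (reindex ![1] emptyF)).ex))
    (andF (((memf 1 0).imp ((andF (memf 2 0) (reindex ![1, 2] succF)).ex)).all)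
      (((memf 1 0).imp
        (orF (reindex ![1] emptyF) ((andF (memf 2 1) (reindex ![2, 1] succF)).ex))).all))

/-- Given `v₀ = ω`, `v₁ = ℵ₁`: `v₁` is an ordinal, there is no surjection from `ω` onto `v₁`,
and every element of `v₁` is empty or a surjective image of `ω`. -/
def alephOneF : BF 2 :=
  andF (andF (reindex ![1] ordF) (((reindex ![0, 1, 2] isFuncF).ex).not))
    (((memf 2 1).imp (orF (reindex ![2] emptyF) ((reindex ![0, 2, 3] isFuncF).ex))).all)

/-- The Continuum Hypothesis `ℵ₁ = 2^ℵ₀`: there is a bijection between `𝒫(ω)` and `ℵ₁`. -/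
def chSent : SetLang.Sentence :=
  (((((andF (andF (reindex ![0] omegaF) (reindex ![0, 1] powF))
      (andF (reindex ![0, 2] alephOneF) (reindex ![1, 2, 3] bijF))).ex).ex).ex).ex : BF 0)

/-! ### The theories `Z`, `ZF`, `ZC`, `ZFC` -/

/-- The finitely many non-scheme axioms of `ZF`. -/
def zfFin : SetLang.Theory := {extAx, foundAx, pairAx, unionAx, powAx, infAx}

/-- All instances of the Separation scheme. -/
def sepScheme : SetLang.Theory := Set.range fun p : Σ n, BF (n + 1) => sepAx p.2

/-- All instances of the Replacement scheme. -/
def replScheme : SetLang.Theory := Set.range fun p : Σ n, BF (n + 2) => replAx p.2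

/-- Zermelo set theory. -/
def Z : SetLang.Theory := zfFin ∪ sepScheme

/-- Zermelo–Fraenkel set theory. -/
def ZF : SetLang.Theory := Z ∪ replScheme

/-- Zermelo set theory with Choice. -/
def ZC : SetLang.Theory := Z ∪ {acAx}

/-- Zermelo–Fraenkel set theory with Choice. -/
def ZFC : SetLang.Theory := ZF ∪ {acAx}

/-! ### Satisfaction in a set with the true membership relation -/

/-- The `L`-structure on (the elements of) a `ZFSet` `M`, with `∈` interpreted as true
membership. -/
def zfStruct (M : ZFSet) : SetLang.Structure {x : ZFSet // x ∈ M} where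
  funMap := fun f _ => f.elim
  RelMap | .mem => fun v => ((v 0 : {x : ZFSet // x ∈ M}) : ZFSet) ∈ ((v 1 : {x : ZFSet // x ∈ M}) : ZFSet)

/-- `(M, ∈) ⊨ T`: the structure on `M` with true membership satisfies every sentence of `T`. -/
def ZModels (M : ZFSet) (T : SetLang.Theory) : Prop :=
  ∀ φ ∈ T, letI := zfStruct M; Sentence.Realize (M := {x : ZFSet // x ∈ M}) φ

/-- `(M, ∈) ⊨ φ[v₀, …, v_{k-1}]`: satisfaction of the formula `φ` in `M`, with the
(membership-checked) valuation `v` of its free variables. -/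
def ZRealize (M : ZFSet) {k : ℕ} (φ : BF k) (v : Fin k → ZFSet) : Prop :=
  ∀ h : ∀ i, v i ∈ M,
    letI := zfStruct M
    BoundedFormula.Realize (M := {x : ZFSet // x ∈ M}) φ (fun e => e.elim) (fun i => ⟨v i, h i⟩)

/-- `x` is a (von Neumann) ordinal: a transitive set of transitive sets. -/
def IsOrd (x : ZFSet) : Prop := x.IsTransitive ∧ ∀ y ∈ x, ZFSet.IsTransitive y


universe u

section
/-! ### Satisfaction on raw environments -/

abbrev Env (n : ℕ) := Fin n → ZFSet.{u}

abbrev snc {n : ℕ} (v : Env.{u} n) (x : ZFSet.{u}) : Env.{u} (n + 1) :=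
  Fin.snoc (α := fun _ => ZFSet.{u}) v x

def tv {n : ℕ} (v : Env.{u} n) : SetLang.Term (Empty ⊕ Fin n) → ZFSet.{u}
  | .var (.inr i) => v i
  | .var (.inl e) => e.elim
  | .func f _ => Empty.elim f

def relv (M : ZFSet.{u}) : ∀ {l : ℕ}, memRel l → (Fin l → ZFSet.{u}) → Prop
  | _, .mem, ts => ts 0 ∈ ts 1

def Sat (M : ZFSet.{u}) : ∀ {n : ℕ}, BF n → Env.{u} n → Prop
  | _, .falsum, _ => False
  | _, .equal t s, v => tv v t = tv v s
  | _, .rel R ts, v => relv M R (fun i => tv v (ts i))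
  | _, .imp φ ψ, v => Sat M φ v → Sat M ψ v
  | _, .all φ, v => ∀ x ∈ M, Sat M φ (snc v x)

theorem snc_val {M : ZFSet.{u}} {n : ℕ} (v : Fin n → {x // x ∈ M}) (x : {x // x ∈ M}) :
    (fun i => ((Fin.snoc (α := fun _ => {x // x ∈ M}) v x i : {x // x ∈ M}) : ZFSet)) =
      snc (fun i => (v i).1) x.1 := by
  funext i
  refine Fin.lastCases ?_ (fun j => ?_) i <;> simp [snc]

theorem tv_eq {M : ZFSet.{u}} {n : ℕ} (v : Fin n → {x // x ∈ M})
    (t : SetLang.Term (Empty ⊕ Fin n)) :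
    letI := zfStruct M
    ((t.realize (Sum.elim (default : Empty → {x // x ∈ M}) v) : {x // x ∈ M}) : ZFSet) =
      tv (fun i => (v i).1) t := by
  rcases t with x | ⟨f, ts⟩
  · rcases x with e | i
    · exact e.elim
    · rfl
  · exact Empty.elim f

theorem Sat_iff {M : ZFSet.{u}} : ∀ {n : ℕ} (φ : BF n) (v : Fin n → {x // x ∈ M}),
    letI := zfStruct M
    φ.Realize (default : Empty → {x // x ∈ M}) v ↔ Sat M φ (fun i => (v i).1)
  | _, .falsum, _ => Iff.rfl
  | _, .equal t s, v => by
      simp only [Sat, BoundedFormula.Realize, Subtype.ext_iff, tv_eq]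
  | _, .rel R ts, v => by
      simp only [Sat, BoundedFormula.Realize]
      simp only [← tv_eq]
      cases R
      rfl
  | _, .imp φ ψ, v => by
      simp only [Sat, BoundedFormula.Realize]
      exact imp_congr (Sat_iff φ v) (Sat_iff ψ v)
  | _, .all φ, v => by
      simp only [Sat, BoundedFormula.Realize]
      constructor
      · intro h x hx
        have := (Sat_iff φ _).1 (h ⟨x, hx⟩)
        rwa [snc_val] at this
      · intro h x
        refine (Sat_iff φ _).2 ?_
        rw [snc_val]
        exact h x.1 x.2

theorem ZModels_iff {M : ZFSet.{u}} {T : SetLang.Theory} :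
    ZModels M T ↔ ∀ φ ∈ T, Sat M (φ : BF 0) (default : Env.{u} 0) := by
  unfold ZModels
  refine forall₂_congr fun φ _ => ?_
  have := Sat_iff (M := M) (φ : BF 0) default
  have e : (fun i : Fin 0 => ((default : Fin 0 → {x // x ∈ M}) i).1) = default :=
    Subsingleton.elim _ _
  rw [e] at this
  exact this

section
variable {M : ZFSet.{u}} {n : ℕ} (v : Env.{u} n)

@[simp] theorem Sat_memf (i j : Fin n) : Sat M (memf i j) v ↔ v i ∈ v j := Iff.rfl
@[simp] theorem Sat_eqf (i j : Fin n) : Sat M (eqf i j) v ↔ v i = v j := Iff.rfl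
@[simp] theorem Sat_imp (φ ψ : BF n) : Sat M (φ.imp ψ) v ↔ (Sat M φ v → Sat M ψ v) := Iff.rfl
@[simp] theorem Sat_not (φ : BF n) : Sat M φ.not v ↔ ¬ Sat M φ v := Iff.rfl
@[simp] theorem Sat_all (φ : BF (n + 1)) :
    Sat M φ.all v ↔ ∀ x ∈ M, Sat M φ (snc v x) := Iff.rfl
@[simp] theorem Sat_ex (φ : BF (n + 1)) :
    Sat M φ.ex v ↔ ∃ x ∈ M, Sat M φ (snc v x) := by
  simp [BoundedFormula.ex]
@[simp] theorem Sat_and (φ ψ : BF n) : Sat M (andF φ ψ) v ↔ (Sat M φ v ∧ Sat M ψ v) := by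
  simp [andF]
@[simp] theorem Sat_or (φ ψ : BF n) : Sat M (orF φ ψ) v ↔ (Sat M φ v ∨ Sat M ψ v) := by
  simp [orF, or_iff_not_imp_left]
@[simp] theorem Sat_iffF (φ ψ : BF n) : Sat M (iffF φ ψ) v ↔ (Sat M φ v ↔ Sat M ψ v) := by
  simp [iffF, iff_iff_implies_and_implies]

theorem Sat_reindex {m : ℕ} (f : Fin m → Fin n) (φ : BF m) (hv : ∀ i, v i ∈ M) :
    Sat M (reindex f φ) v ↔ Sat M φ (fun i => v (f i)) := by
  letI := zfStruct M
  have h1 := Sat_iff (M := M) (reindex f φ) (fun i => ⟨v i, hv i⟩)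
  have h2 := Sat_iff (M := M) φ (fun i => ⟨v (f i), hv (f i)⟩)
  rw [← h1, ← h2]
  unfold reindex
  erw [BoundedFormula.realize_relabel]
  have := BoundedFormula.realize_toFormula φ (Sum.elim (default : Empty → {x // x ∈ M})
    (fun i : Fin m => (⟨v (f i), hv (f i)⟩ : {x // x ∈ M})))
  refine Iff.trans ?_ this
  unfold Formula.Realize
  have e : ∀ (a b : Empty ⊕ Fin m → {x // x ∈ M}) (c d : Fin 0 → {x // x ∈ M}), a = b →
    (BoundedFormula.Realize φ.toFormula a c ↔ BoundedFormula.Realize φ.toFormula b d) := by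
    intro a b c d h
    rw [h, Subsingleton.elim c d]
  apply e
  funext x
  rcases x with x | x
  · exact x.elim
  · rfl

theorem snc_mem {v : Env.{u} n} (hv : ∀ i, v i ∈ M) {x : ZFSet.{u}} (hx : x ∈ M) :
    ∀ i, snc v x i ∈ M := by
  intro i
  refine Fin.lastCases ?_ (fun j => ?_) i <;> simp [snc, hx, hv]

theorem Sat_alls : ∀ {n : ℕ} (φ : BF n),
    Sat M (φ.alls : BF 0) default ↔ ∀ v : Env.{u} n, (∀ i, v i ∈ M) → Sat M φ v
  | 0, φ => by
    constructor
    · intro h v _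
      rw [Subsingleton.elim v default]; exact h
    · intro h
      exact h _ (fun i => i.elim0)
  | n + 1, φ => by
    refine (Sat_alls φ.all).trans ?_
    constructor
    · intro h v hv
      have := h (Fin.init v) (fun i => hv _) (v (Fin.last n)) (hv _)
      rwa [snc, Fin.snoc_init_self] at this
    · intro h v hv x hx
      exact h _ (snc_mem hv hx)

end

end

section
/-! ### Transitive models of Z, and uniform definability -/

structure Base (M : ZFSet.{u}) : Prop where
  trans : ∀ x ∈ M, ∀ y ∈ x, y ∈ M
  empty : ∅ ∈ M
  pr : ∀ x ∈ M, ∀ y ∈ M, ({x, y} : ZFSet) ∈ M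
  sUnion : ∀ x ∈ M, (ZFSet.sUnion x : ZFSet) ∈ M
  pow : ∀ x ∈ M, ZFSet.sep (fun y => y ∈ M) (ZFSet.powerset x) ∈ M
  inf : ∃ I ∈ M, ∅ ∈ I ∧ ∀ x ∈ I, insert x x ∈ I
  sep : ∀ (n : ℕ) (φ : BF (n + 1)) (v : Env.{u} n), (∀ i, v i ∈ M) → ∀ A ∈ M,
    ZFSet.sep (fun x => Sat M φ (snc v x)) A ∈ M

class Def {n : ℕ} (R : ZFSet.{u} → Env.{u} n → Prop) : Prop where
  out : ∃ φ : BF n, ∀ M, Base M → ∀ v : Env.{u} n, (∀ i, v i ∈ M) → (Sat M φ v ↔ R M v)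

class DefT {n : ℕ} (f : ZFSet.{u} → Env.{u} n → ZFSet.{u}) : Prop where
  mem : ∀ M, Base M → ∀ v : Env.{u} n, (∀ i, v i ∈ M) → f M v ∈ M
  graph : Def (fun M (w : Env.{u} (n + 1)) => w (Fin.last n) = f M (fun i => w i.castSucc))

theorem Def.congr {n : ℕ} {R S : ZFSet.{u} → Env.{u} n → Prop} (h : Def R)
    (e : ∀ M, Base M → ∀ v : Env.{u} n, (∀ i, v i ∈ M) → (R M v ↔ S M v)) : Def S := by
  obtain ⟨φ, hφ⟩ := h.out
  exact ⟨φ, fun M hM v hv => (hφ M hM v hv).trans (e M hM v hv)⟩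

section conn
variable {n : ℕ} (R S : ZFSet.{u} → Env.{u} n → Prop)

instance Def.and [hR : Def R] [hS : Def S] : Def (fun M v => R M v ∧ S M v) := by
  obtain ⟨φ, hφ⟩ := hR.out
  obtain ⟨ψ, hψ⟩ := hS.out
  exact ⟨andF φ ψ, fun M hM v hv => by simp [hφ M hM v hv, hψ M hM v hv]⟩

instance Def.or [hR : Def R] [hS : Def S] : Def (fun M v => R M v ∨ S M v) := by
  obtain ⟨φ, hφ⟩ := hR.out
  obtain ⟨ψ, hψ⟩ := hS.out
  exact ⟨orF φ ψ, fun M hM v hv => by simp [hφ M hM v hv, hψ M hM v hv]⟩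

instance Def.imp [hR : Def R] [hS : Def S] : Def (fun M v => R M v → S M v) := by
  obtain ⟨φ, hφ⟩ := hR.out
  obtain ⟨ψ, hψ⟩ := hS.out
  exact ⟨φ.imp ψ, fun M hM v hv => by simp [hφ M hM v hv, hψ M hM v hv]⟩

instance Def.iff [hR : Def R] [hS : Def S] : Def (fun M v => R M v ↔ S M v) := by
  obtain ⟨φ, hφ⟩ := hR.out
  obtain ⟨ψ, hψ⟩ := hS.out
  exact ⟨iffF φ ψ, fun M hM v hv => by simp [hφ M hM v hv, hψ M hM v hv]⟩

instance Def.not [hR : Def R] : Def (fun M v => ¬ R M v) := by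
  obtain ⟨φ, hφ⟩ := hR.out
  exact ⟨φ.not, fun M hM v hv => by simp [hφ M hM v hv]⟩

end conn

theorem snc_last {n : ℕ} (v : Env.{u} n) (x : ZFSet.{u}) : snc v x (Fin.last n) = x := by
  simp [snc]
theorem snc_cs {n : ℕ} (v : Env.{u} n) (x : ZFSet.{u}) (i : Fin n) : snc v x i.castSucc = v i := by
  simp [snc]
theorem snc_cs' {n : ℕ} (v : Env.{u} n) (x : ZFSet.{u}) : (fun i : Fin n => snc v x i.castSucc) = v := by
  simp [snc]

instance Def.all {n : ℕ} (R : ZFSet.{u} → Env.{u} n → ZFSet.{u} → Prop)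
    [hR : Def (fun M (w : Env.{u} (n + 1)) => R M (fun i => w i.castSucc) (w (Fin.last n)))] :
    Def (fun M v => ∀ x ∈ M, R M v x) := by
  obtain ⟨φ, hφ⟩ := hR.out
  refine ⟨φ.all, fun M hM v hv => ?_⟩
  simp only [Sat_all]
  refine forall₂_congr fun x hx => ?_
  rw [hφ M hM _ (snc_mem hv hx), snc_last, snc_cs']

instance Def.ex {n : ℕ} (R : ZFSet.{u} → Env.{u} n → ZFSet.{u} → Prop)
    [hR : Def (fun M (w : Env.{u} (n + 1)) => R M (fun i => w i.castSucc) (w (Fin.last n)))] :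
    Def (fun M v => ∃ x ∈ M, R M v x) := by
  obtain ⟨φ, hφ⟩ := hR.out
  refine ⟨φ.ex, fun M hM v hv => ?_⟩
  simp only [Sat_ex]
  refine exists_congr fun x => and_congr_right fun hx => ?_
  rw [hφ M hM _ (snc_mem hv hx), snc_last, snc_cs']

instance (priority := 500) Def.ren {n m : ℕ} (R : ZFSet.{u} → Env.{u} n → Prop) (ρ : Fin n → Fin m) [hR : Def R] :
    Def (fun M (w : Env.{u} m) => R M (fun i => w (ρ i))) := by
  obtain ⟨φ, hφ⟩ := hR.out
  refine ⟨reindex ρ φ, fun M hM v hv => ?_⟩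
  rw [Sat_reindex _ _ _ hv, hφ M hM _ (fun i => hv _)]

theorem Def.subst1 {n : ℕ} {Q : ZFSet.{u} → Env.{u} (n + 1) → Prop} (hQ : Def Q)
    {f : ZFSet.{u} → Env.{u} n → ZFSet.{u}} (hf : DefT f) : Def (fun M v => Q M (snc v (f M v))) := by
  have := hf.graph
  have h : Def (fun M (v : Env.{u} n) => ∃ x ∈ M, (x = f M v ∧ Q M (snc v x))) := by
    refine @Def.ex n (fun M v x => (x = f M v ∧ Q M (snc v x))) (@Def.and _ _ _ this ?_)
    refine hQ.congr fun M hM w hw => ?_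
    rw [show snc (fun i => w i.castSucc) (w (Fin.last n)) = w from Fin.snoc_init_self w]
  refine h.congr fun M hM v hv => ?_
  constructor
  · rintro ⟨x, _, rfl, h⟩; exact h
  · intro h; exact ⟨_, hf.mem M hM v hv, rfl, h⟩

instance DefT.var {n : ℕ} (i : Fin n) : DefT (fun _ (v : Env.{u} n) => v i) where
  mem _ _ _ hv := hv i
  graph := ⟨eqf (Fin.last n) i.castSucc, fun _ _ _ _ => by simp⟩

instance (priority := 500) DefT.ren {n m : ℕ} (f : ZFSet.{u} → Env.{u} n → ZFSet.{u}) (ρ : Fin n → Fin m)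
    [hf : DefT f] : DefT (fun M (w : Env.{u} m) => f M (fun i => w (ρ i))) where
  mem M hM v hv := hf.mem M hM _ (fun i => hv _)
  graph := by
    refine (@Def.ren (n+1) (m+1) _ (Fin.snoc (α := fun _ => Fin (m+1)) (fun i => (ρ i).castSucc) (Fin.last m)) hf.graph).congr ?_
    intro M hM w hw
    simp

theorem Def.substA {n : ℕ} : ∀ (m : ℕ) (Q : ZFSet.{u} → Env.{u} (n + m) → Prop) (_ : Def Q)
    (t : Fin m → ZFSet.{u} → Env.{u} n → ZFSet.{u}) (_ : ∀ j, DefT (t j)),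
    Def (fun M v => Q M (Fin.append v (fun j => t j M v)))
  | 0, Q, hQ, t, _ => by
    refine hQ.congr fun M _ v _ => ?_
    congr! 1
    funext i
    exact (Fin.append_left (m := n) (n := 0) v (fun j => t j M v) i).symm
  | m + 1, Q, hQ, t, ht => by
    have h1 := Def.subst1 (n := n + m) (Q := Q) hQ
      (f := fun M w => t (Fin.last m) M (fun i => w (Fin.castAdd m i)))
      (@DefT.ren _ _ _ _ (ht _))
    refine (Def.substA m _ h1 (fun j => t j.castSucc) (fun j => ht _)).congr fun M _ v _ => ?_
    congr! 1
    have : (fun i => Fin.append v (fun j => t j.castSucc M v) (Fin.castAdd m i)) = v := by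
      funext i; simp
    rw [this]
    funext i
    refine Fin.lastCases ?_ (fun i => ?_) i
    · rw [snc_last]
      exact (Fin.append_right v (fun j => t j M v) (Fin.last m)).symm
    · rw [snc_cs]
      refine Fin.addCases (fun i => ?_) (fun i => ?_) i
      · rw [Fin.append_left]
        exact (Fin.append_left v (fun j => t j M v) i).symm
      · rw [Fin.append_right]
        exact (Fin.append_right v (fun j => t j M v) i.castSucc).symm

theorem Def.subst {n m : ℕ} {Q : ZFSet.{u} → Env.{u} m → Prop} (hQ : Def Q)
    (t : Fin m → ZFSet.{u} → Env.{u} n → ZFSet.{u}) (ht : ∀ j, DefT (t j)) :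
    Def (fun M v => Q M (fun j => t j M v)) := by
  refine (Def.substA m _ (@Def.ren m (n + m) Q (Fin.natAdd n) hQ) t ht).congr fun M _ v _ => ?_
  simp

theorem DefT.subst {n m : ℕ} {F : ZFSet.{u} → Env.{u} m → ZFSet.{u}} (hF : DefT F)
    (t : Fin m → ZFSet.{u} → Env.{u} n → ZFSet.{u}) (ht : ∀ j, DefT (t j)) :
    DefT (fun M v => F M (fun j => t j M v)) where
  mem M hM v hv := hF.mem M hM _ (fun j => (ht j).mem M hM v hv)
  graph := by
    have := Def.subst hF.graph (n := n + 1)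
      (fun j => Fin.lastCases (motive := fun _ => ZFSet.{u} → Env.{u} (n+1) → ZFSet.{u})
        (fun M w => w (Fin.last n)) (fun j M w => t j M (fun i => w i.castSucc)) j)
      (fun j => by
        refine Fin.lastCases ?_ (fun j => ?_) j
        · simp only [Fin.lastCases_last]; infer_instance
        · simp only [Fin.lastCases_castSucc]; exact @DefT.ren _ _ _ _ (ht j))
    refine this.congr fun M _ w _ => ?_
    simp

instance Def.mem {n : ℕ} (f g : ZFSet.{u} → Env.{u} n → ZFSet.{u}) [hf : DefT f] [hg : DefT g] :
    Def (fun M v => f M v ∈ g M v) := by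
  have h : Def (fun _ (v : Env.{u} 2) => v 0 ∈ v 1) := ⟨memf 0 1, fun _ _ _ _ => Iff.rfl⟩
  exact Def.subst h ![f, g] (by simp [Fin.forall_fin_two, hf, hg])

instance Def.eq {n : ℕ} (f g : ZFSet.{u} → Env.{u} n → ZFSet.{u}) [hf : DefT f] [hg : DefT g] :
    Def (fun M v => f M v = g M v) := by
  have h : Def (fun _ (v : Env.{u} 2) => v 0 = v 1) := ⟨eqf 0 1, fun _ _ _ _ => Iff.rfl⟩
  exact Def.subst h ![f, g] (by simp [Fin.forall_fin_two, hf, hg])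

instance Def.ball {n : ℕ} (f : ZFSet.{u} → Env.{u} n → ZFSet.{u}) [hf : DefT f]
    (R : ZFSet.{u} → Env.{u} n → ZFSet.{u} → Prop)
    [hR : Def (fun M (w : Env.{u} (n + 1)) => R M (fun i => w i.castSucc) (w (Fin.last n)))] :
    Def (fun M v => ∀ x ∈ f M v, R M v x) := by
  have h : Def (fun M v => ∀ x ∈ M, (x ∈ f M v → R M v x)) := inferInstance
  refine h.congr fun M hM v hv => ?_
  exact ⟨fun h x hx => h x (hM.trans _ (hf.mem M hM v hv) _ hx) hx, fun h x _ hx => h x hx⟩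

instance Def.bex {n : ℕ} (f : ZFSet.{u} → Env.{u} n → ZFSet.{u}) [hf : DefT f]
    (R : ZFSet.{u} → Env.{u} n → ZFSet.{u} → Prop)
    [hR : Def (fun M (w : Env.{u} (n + 1)) => R M (fun i => w i.castSucc) (w (Fin.last n)))] :
    Def (fun M v => ∃ x ∈ f M v, R M v x) := by
  have h : Def (fun M v => ∃ x ∈ M, (x ∈ f M v ∧ R M v x)) := inferInstance
  refine h.congr fun M hM v hv => ?_
  exact ⟨fun ⟨x, _, hx⟩ => ⟨x, hx⟩, fun ⟨x, hx, h⟩ => ⟨x, hM.trans _ (hf.mem M hM v hv) _ hx, hx, h⟩⟩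

instance Def.subset {n : ℕ} (f g : ZFSet.{u} → Env.{u} n → ZFSet.{u}) [hf : DefT f] [hg : DefT g] :
    Def (fun M v => f M v ⊆ g M v) := by
  have h : Def (fun M v => ∀ x ∈ f M v, x ∈ g M v) := inferInstance
  exact h

instance Def.const {n : ℕ} (p : Prop) : Def (fun _ (_ : Env.{u} n) => p) := by
  by_cases h : p
  · exact ⟨BoundedFormula.falsum.not, fun _ _ _ _ => by simp [h, Sat]⟩
  · exact ⟨BoundedFormula.falsum, fun _ _ _ _ => by simp [h, Sat]⟩

theorem DefT.ofMem {n : ℕ} {f : ZFSet.{u} → Env.{u} n → ZFSet.{u}}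
    (R : ZFSet.{u} → Env.{u} n → ZFSet.{u} → Prop)
    (hR : Def (fun M (w : Env.{u} (n + 1)) => R M (fun i => w i.castSucc) (w (Fin.last n))))
    (hm : ∀ M, Base M → ∀ v : Env.{u} n, (∀ i, v i ∈ M) → f M v ∈ M)
    (e : ∀ M, Base M → ∀ v : Env.{u} n, (∀ i, v i ∈ M) → ∀ x ∈ M, (R M v x ↔ x ∈ f M v)) :
    DefT f := by
  refine ⟨hm, ?_⟩
  have := @Def.ren _ (n + 1 + 1) _ (Fin.snoc (α := fun _ => Fin (n + 1 + 1)) (fun i : Fin n => i.castSucc.castSucc) (Fin.last _)) hR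
  simp only [Fin.snoc_castSucc, Fin.snoc_last] at this
  have h : Def (fun M (w : Env.{u} (n+1)) => ∀ x ∈ M,
      (R M (fun i => w i.castSucc) x ↔ x ∈ w (Fin.last n))) := inferInstance
  refine h.congr fun M hM w hw => ?_
  have hf := hm M hM _ (fun i : Fin n => hw i.castSucc)
  constructor
  · intro h
    ext z
    constructor
    · intro hz
      have hzM := hM.trans _ (hw _) z hz
      exact (e M hM _ (fun i => hw _) z hzM).1 ((h z hzM).2 hz)
    · intro hz
      have hzM := hM.trans _ hf z hz
      exact (h z hzM).1 ((e M hM _ (fun i => hw _) z hzM).2 hz)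
  · intro h x hx
    rw [h, e M hM _ (fun i => hw _) x hx]

section terms
variable {n : ℕ} (f g h : ZFSet.{u} → Env.{u} n → ZFSet.{u}) [hf : DefT f] [hg : DefT g] [hh : DefT h]

instance DefT.empty : DefT (fun _ (_ : Env.{u} n) => (∅ : ZFSet.{u})) :=
  DefT.ofMem (fun _ _ _ => False) inferInstance (fun _ hM _ _ => hM.empty) (by simp)

instance DefT.upair : DefT (fun M v => ({f M v, g M v} : ZFSet.{u})) :=
  DefT.ofMem (fun M v x => x = f M v ∨ x = g M v) inferInstance
    (fun M hM v hv => hM.pr _ (hf.mem M hM v hv) _ (hg.mem M hM v hv)) (by simp)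

instance DefT.sing : DefT (fun M v => ({f M v} : ZFSet.{u})) :=
  DefT.ofMem (fun M v x => x = f M v) inferInstance
    (fun M hM v hv => by
      have := hM.pr _ (hf.mem M hM v hv) _ (hf.mem M hM v hv)
      rwa [show ({f M v, f M v} : ZFSet) = {f M v} by ext; simp] at this) (by simp)

instance DefT.sUnion : DefT (fun M v => (ZFSet.sUnion (f M v) : ZFSet.{u})) :=
  DefT.ofMem (fun M v x => ∃ y ∈ f M v, x ∈ y) inferInstance
    (fun M hM v hv => hM.sUnion _ (hf.mem M hM v hv)) (by simp)

instance DefT.union : DefT (fun M v => (f M v ∪ g M v : ZFSet.{u})) :=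
  DefT.ofMem (fun M v x => x ∈ f M v ∨ x ∈ g M v) inferInstance
    (fun M hM v hv => by
      have := hM.sUnion _ (hM.pr _ (hf.mem M hM v hv) _ (hg.mem M hM v hv))
      rwa [ZFSet.sUnion_pair] at this) (by simp)

instance DefT.ins : DefT (fun M v => (insert (f M v) (g M v) : ZFSet.{u})) := by
  have := DefT.union (fun M v => ({f M v} : ZFSet)) g
  have e : (fun M v => (insert (f M v) (g M v) : ZFSet.{u})) =
    (fun M v => ({f M v} ∪ g M v : ZFSet)) := by
    funext M v; ext; simp
  rwa [e]

instance DefT.pair : DefT (fun M v => (ZFSet.pair (f M v) (g M v) : ZFSet.{u})) := by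
  unfold ZFSet.pair; infer_instance

instance DefT.sep (R : ZFSet.{u} → Env.{u} n → ZFSet.{u} → Prop)
    [hR : Def (fun M (w : Env.{u} (n + 1)) => R M (fun i => w i.castSucc) (w (Fin.last n)))] :
    DefT (fun M v => ZFSet.sep (fun x => R M v x) (f M v)) :=
  DefT.ofMem (fun M v x => x ∈ f M v ∧ R M v x) inferInstance
    (fun M hM v hv => by
      obtain ⟨φ, hφ⟩ := hR.out
      have := hM.sep n φ v hv _ (hf.mem M hM v hv)
      convert this using 1
      ext x
      simp only [ZFSet.mem_sep]
      refine and_congr_right fun hx => ?_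
      rw [hφ M hM _ (snc_mem hv (hM.trans _ (hf.mem M hM v hv) _ hx)), snc_last, snc_cs']) (by simp)

instance DefT.diff : DefT (fun M v => (f M v \ g M v : ZFSet.{u})) := by
  have : DefT (fun M v => ZFSet.sep (fun x => ¬ x ∈ g M v) (f M v)) := inferInstance
  convert this using 3
  ext; simp

end terms

/-- power set of `x` in `M` -/
noncomputable def Pw (M x : ZFSet.{u}) : ZFSet.{u} := ZFSet.sep (fun y => y ∈ M) (ZFSet.powerset x)

theorem mem_Pw {M x y : ZFSet.{u}} : y ∈ Pw M x ↔ y ∈ M ∧ y ⊆ x := by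
  simp [Pw, and_comm]

section terms2
variable {n : ℕ} (f g h : ZFSet.{u} → Env.{u} n → ZFSet.{u}) [hf : DefT f] [hg : DefT g] [hh : DefT h]

instance DefT.pw : DefT (fun M v => (Pw M (f M v) : ZFSet.{u})) :=
  DefT.ofMem (fun M v x => x ⊆ f M v) inferInstance
    (fun M hM v hv => hM.pow _ (hf.mem M hM v hv)) (by
      intro M hM v hv x hx; simp [mem_Pw, hx])

end terms2

theorem Base.pair {M : ZFSet.{u}} (hM : Base M) {x y : ZFSet.{u}} (hx : x ∈ M) (hy : y ∈ M) :
    ZFSet.pair x y ∈ M :=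
  hM.pr _ (by simpa using hM.pr _ hx _ hx) _ (hM.pr _ hx _ hy)

theorem Base.sing {M : ZFSet.{u}} (hM : Base M) {x : ZFSet.{u}} (hx : x ∈ M) :
    ({x} : ZFSet) ∈ M := by simpa using hM.pr _ hx _ hx

theorem Base.of_pair {M : ZFSet.{u}} (hM : Base M) {x y : ZFSet.{u}} (h : ZFSet.pair x y ∈ M) :
    x ∈ M ∧ y ∈ M := by
  have h1 : ({x, y} : ZFSet) ∈ M := hM.trans _ h _ (by simp [ZFSet.pair])
  exact ⟨hM.trans _ h1 _ (by simp), hM.trans _ h1 _ (by simp)⟩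

section terms3
variable {n : ℕ} (f g h : ZFSet.{u} → Env.{u} n → ZFSet.{u}) [hf : DefT f] [hg : DefT g] [hh : DefT h]

instance DefT.prod : DefT (fun M v => (ZFSet.prod (f M v) (g M v) : ZFSet.{u})) := by
  have : DefT (fun M v => ZFSet.sep (fun z => ∃ a ∈ f M v, ∃ b ∈ g M v, z = ZFSet.pair a b)
    (Pw M (Pw M (f M v ∪ g M v)))) := inferInstance
  refine DefT.ofMem (fun M v z => ∃ a ∈ f M v, ∃ b ∈ g M v, z = ZFSet.pair a b) inferInstance ?_ (by simp)
  intro M hM v hv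
  have h1 := this.mem M hM v hv
  convert h1 using 1
  ext z
  simp only [ZFSet.mem_prod, ZFSet.mem_sep, iff_and_self]
  rintro ⟨a, ha, b, hb, rfl⟩
  have haM := hM.trans _ (hf.mem M hM v hv) a ha
  have hbM := hM.trans _ (hg.mem M hM v hv) b hb
  have hp := hM.pair haM hbM
  rw [mem_Pw]
  refine ⟨hp, fun w hw => ?_⟩
  rw [mem_Pw]
  refine ⟨hM.trans _ hp _ hw, fun t ht => ?_⟩
  simp only [ZFSet.pair, ZFSet.mem_pair] at hw
  rcases hw with rfl | rfl
  · simp at ht; subst ht; simp [ha]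
  · simp at ht; rcases ht with rfl | rfl <;> simp [ha, hb]

end terms3

theorem DefT.app {n : ℕ} (f : ZFSet.{u} → Env.{u} n → ZFSet.{u}) [hf : DefT f] {M : ZFSet.{u}}
    (hM : Base M) (v : Env.{u} n) (hv : ∀ i, v i ∈ M) : f M v ∈ M := hf.mem M hM v hv

instance Def.memM {n : ℕ} (f : ZFSet.{u} → Env.{u} n → ZFSet.{u}) [hf : DefT f] :
    Def (fun M v => f M v ∈ M) :=
  (Def.const True).congr fun M hM v hv => by simpa using hf.mem M hM v hv

end

section
/-! ### Decoding the axioms -/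

set_option linter.unusedSimpArgs false

section decode
variable {M : ZFSet.{u}}

def Tr (M : ZFSet.{u}) : Prop := ∀ x ∈ M, ∀ y ∈ x, y ∈ M

theorem sat_subF (T : Tr M) (v : Env.{u} 2) (hv : ∀ i, v i ∈ M) : Sat M subF v ↔ v 0 ⊆ v 1 :=
  (show Sat M subF v ↔ ∀ x ∈ M, x ∈ v 0 → x ∈ v 1 from Iff.rfl).trans
    ⟨fun h x hx => h x (T _ (hv 0) _ hx) hx, fun h _ _ hx => h hx⟩

theorem sat_emptyF (T : Tr M) (v : Env.{u} 1) (hv : ∀ i, v i ∈ M) : Sat M emptyF v ↔ v 0 = ∅ :=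
  (show Sat M emptyF v ↔ ∀ x ∈ M, ¬ x ∈ v 0 from Iff.rfl).trans (by
    rw [ZFSet.eq_empty]
    exact ⟨fun h x hx => h x (T _ (hv 0) _ hx) hx, fun h x _ => h x⟩)

theorem sat_pairSetF' (v : Env.{u} 3) :
    Sat M pairSetF v ↔ ∀ x ∈ M, (x ∈ v 2 ↔ x = v 0 ∨ x = v 1) := by
  unfold pairSetF
  simp only [Sat_all, Sat_iffF, Sat_or, Sat_memf, Sat_eqf]
  rfl

theorem ext_iffM (T : Tr M) {a : ZFSet.{u}} (ha : a ∈ M) {b : ZFSet.{u}} (hb : ∀ x ∈ b, x ∈ M) :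
    (∀ x ∈ M, (x ∈ a ↔ x ∈ b)) ↔ a = b := by
  constructor
  · intro h
    ext x
    exact ⟨fun hx => (h x (T _ ha _ hx)).1 hx, fun hx => (h x (hb x hx)).2 hx⟩
  · rintro rfl; simp

theorem sat_pairSetF (T : Tr M) (v : Env.{u} 3) (hv : ∀ i, v i ∈ M) :
    Sat M pairSetF v ↔ v 2 = {v 0, v 1} := by
  rw [sat_pairSetF', ← ext_iffM T (hv 2)]
  · simp
  · simp only [ZFSet.mem_pair]
    rintro x (rfl | rfl) <;> exact hv _

theorem sat_succF (T : Tr M) (v : Env.{u} 2) (hv : ∀ i, v i ∈ M) :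
    Sat M succF v ↔ v 1 = insert (v 0) (v 0) := by
  rw [← ext_iffM T (hv 1)]
  · unfold succF
    simp only [Sat_all, Sat_iffF, Sat_or, Sat_memf, Sat_eqf, ZFSet.mem_insert_iff]
    refine forall₂_congr fun x hx => iff_congr Iff.rfl or_comm
  · simp only [ZFSet.mem_insert_iff]
    rintro x (rfl | h)
    · exact hv _
    · exact T _ (hv 0) _ h

theorem sat_powF (T : Tr M) (v : Env.{u} 2) (hv : ∀ i, v i ∈ M) :
    Sat M powF v ↔ v 1 = Pw M (v 0) := by
  rw [← ext_iffM T (hv 1)]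
  · unfold powF
    simp only [Sat_all, Sat_iffF, Sat_memf]
    refine forall₂_congr fun x hx => iff_congr Iff.rfl ?_
    rw [Sat_reindex _ _ _ (snc_mem hv hx), sat_subF T _ (fun i => snc_mem hv hx _), mem_Pw]
    simp only [hx, true_and]
    rfl
  · intro x hx; exact (mem_Pw.1 hx).1

theorem sat_singF (T : Tr M) (v : Env.{u} 2) (hv : ∀ i, v i ∈ M) :
    Sat M singF v ↔ v 1 = {v 0} := by
  unfold singF
  rw [Sat_reindex _ _ _ hv, sat_pairSetF T _ (fun i => hv _)]
  show v 1 = {v 0, v 0} ↔ _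
  rw [show ({v 0, v 0} : ZFSet) = {v 0} by ext; simp]

theorem sat_opF (hM : Base M) (v : Env.{u} 3) (hv : ∀ i, v i ∈ M) :
    Sat M opF v ↔ v 2 = ZFSet.pair (v 0) (v 1) := by
  rw [← ext_iffM hM.trans (hv 2) (hM.trans _ (hM.pair (hv 0) (hv 1)))]
  unfold opF
  simp only [Sat_all, Sat_iffF, Sat_memf, Sat_or]
  refine forall₂_congr fun x hx => iff_congr Iff.rfl ?_
  rw [Sat_reindex _ _ _ (snc_mem hv hx), sat_singF hM.trans _ (fun i => snc_mem hv hx _),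
    Sat_reindex _ _ _ (snc_mem hv hx), sat_pairSetF hM.trans _ (fun i => snc_mem hv hx _)]
  simp only [ZFSet.pair, ZFSet.mem_pair]
  rfl

theorem sat_transF (T : Tr M) (v : Env.{u} 1) (hv : ∀ i, v i ∈ M) :
    Sat M transF v ↔ (v 0).IsTransitive := by
  unfold transF
  simp only [Sat_all, Sat_imp, Sat_memf]
  have : (v 0).IsTransitive ↔ ∀ x ∈ M, (x ∈ v 0 → x ⊆ v 0) :=
    ⟨fun h x _ hx => h x hx, fun h x hx => h x (T _ (hv 0) _ hx) hx⟩
  rw [this]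
  refine forall₂_congr fun x hx => imp_congr Iff.rfl ?_
  rw [Sat_reindex _ _ _ (snc_mem hv hx), sat_subF T _ (fun i => snc_mem hv hx _)]
  rfl

theorem sat_ordF (T : Tr M) (v : Env.{u} 1) (hv : ∀ i, v i ∈ M) :
    Sat M ordF v ↔ IsOrd (v 0) := by
  unfold ordF IsOrd
  simp only [Sat_and, Sat_all, Sat_imp, Sat_memf, sat_transF T v hv]
  refine and_congr Iff.rfl ?_
  have : (∀ y ∈ v 0, ZFSet.IsTransitive y) ↔ ∀ y ∈ M, (y ∈ v 0 → ZFSet.IsTransitive y) :=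
    ⟨fun h x _ hx => h x hx, fun h x hx => h x (T _ (hv 0) _ hx) hx⟩
  rw [this]
  refine forall₂_congr fun x hx => imp_congr Iff.rfl ?_
  rw [Sat_reindex _ _ _ (snc_mem hv hx), sat_transF T _ (fun i => snc_mem hv hx _)]
  rfl

theorem sat_relMemF (hM : Base M) (v : Env.{u} 3) (hv : ∀ i, v i ∈ M) :
    Sat M relMemF v ↔ ZFSet.pair (v 0) (v 1) ∈ v 2 := by
  unfold relMemF
  simp only [Sat_ex, Sat_and, Sat_memf]
  have : ZFSet.pair (v 0) (v 1) ∈ v 2 ↔ ∃ x ∈ M, (x = ZFSet.pair (v 0) (v 1) ∧ x ∈ v 2) := by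
    constructor
    · intro h; exact ⟨_, hM.trans _ (hv 2) _ h, rfl, h⟩
    · rintro ⟨x, _, rfl, h⟩; exact h
  rw [this]
  refine exists_congr fun x => and_congr_right fun hx => and_congr ?_ Iff.rfl
  rw [Sat_reindex _ _ _ (snc_mem hv hx), sat_opF hM _ (fun i => snc_mem hv hx _)]
  rfl

/-- `f` is a surjection from `a` onto `b`. -/
def Surj (M a b f : ZFSet.{u}) : Prop :=
  ((∀ z ∈ f, ∃ x ∈ a, ∃ y ∈ b, z = ZFSet.pair x y) ∧ (∀ x ∈ a, ∃ y ∈ b, ZFSet.pair x y ∈ f)) ∧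
  (∀ x ∈ M, ∀ y ∈ M, ∀ y' ∈ M, ZFSet.pair x y ∈ f ∧ ZFSet.pair x y' ∈ f → y = y') ∧
  (∀ y ∈ b, ∃ x ∈ a, ZFSet.pair x y ∈ f)

theorem ball_iffM (T : Tr M) {a : ZFSet.{u}} (ha : a ∈ M) {p : ZFSet.{u} → Prop} :
    (∀ x ∈ a, p x) ↔ ∀ x ∈ M, (x ∈ a → p x) :=
  ⟨fun h x _ hx => h x hx, fun h x hx => h x (T _ ha _ hx) hx⟩

theorem bex_iffM (T : Tr M) {a : ZFSet.{u}} (ha : a ∈ M) {p : ZFSet.{u} → Prop} :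
    (∃ x ∈ a, p x) ↔ ∃ x ∈ M, (x ∈ a ∧ p x) :=
  ⟨fun ⟨x, h, h'⟩ => ⟨x, T _ ha _ h, h, h'⟩, fun ⟨x, _, h, h'⟩ => ⟨x, h, h'⟩⟩

theorem sat_isFuncF (hM : Base M) (v : Env.{u} 3) (hv : ∀ i, v i ∈ M) :
    Sat M isFuncF v ↔ Surj M (v 0) (v 1) (v 2) := by
  unfold isFuncF Surj
  have T : Tr M := hM.trans
  simp only [Sat_ex, Sat_and, Sat_memf, Sat_all, Sat_imp, Sat_eqf]
  refine and_congr (and_congr ?_ ?_) (and_congr ?_ ?_)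
  · rw [ball_iffM T (hv 2)]
    refine forall₂_congr fun z hz => imp_congr Iff.rfl ?_
    rw [bex_iffM T (hv 0)]
    refine exists_congr fun x => and_congr_right fun hx => ?_
    rw [bex_iffM T (hv 1), ← exists_and_left]
    refine exists_congr fun y => ?_
    rw [and_left_comm (a := x ∈ v 0)]
    refine and_congr_right fun hy => ?_
    have h := snc_mem (snc_mem (snc_mem hv hz) hx) hy
    rw [Sat_reindex _ _ _ h, sat_opF hM _ (fun i => h _), and_assoc]
    rfl
  · rw [ball_iffM T (hv 0)]
    refine forall₂_congr fun x hx => imp_congr Iff.rfl ?_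
    rw [bex_iffM T (hv 1)]
    refine exists_congr fun y => and_congr_right fun hy => and_congr Iff.rfl ?_
    have h := (snc_mem (snc_mem hv hx) hy)
    rw [Sat_reindex _ _ _ h, sat_relMemF hM _ (fun i => h _)]
    rfl
  · refine forall₂_congr fun x hx => forall₂_congr fun y hy => forall₂_congr fun z hz => ?_
    have h := (snc_mem (snc_mem (snc_mem hv hx) hy) hz)
    rw [Sat_reindex _ _ _ h, sat_relMemF hM _ (fun i => h _), Sat_reindex _ _ _ h, sat_relMemF hM _ (fun i => h _)]
    rfl
  · rw [ball_iffM T (hv 1)]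
    refine forall₂_congr fun x hx => imp_congr Iff.rfl ?_
    rw [bex_iffM T (hv 0)]
    refine exists_congr fun y => and_congr_right fun hy => and_congr Iff.rfl ?_
    have h := (snc_mem (snc_mem hv hx) hy)
    rw [Sat_reindex _ _ _ h, sat_relMemF hM _ (fun i => h _)]
    rfl

theorem sat_injF (hM : Base M) (v : Env.{u} 3) (hv : ∀ i, v i ∈ M) :
    Sat M injF v ↔ ∀ x ∈ M, ∀ y ∈ M, ∀ z ∈ M,
      ZFSet.pair x z ∈ v 2 ∧ ZFSet.pair y z ∈ v 2 → x = y := by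
  unfold injF
  simp only [Sat_and, Sat_all, Sat_imp, Sat_eqf]
  refine forall₂_congr fun x hx => forall₂_congr fun y hy => forall₂_congr fun z hz => ?_
  have h := (snc_mem (snc_mem (snc_mem hv hx) hy) hz)
  rw [Sat_reindex _ _ _ h, sat_relMemF hM _ (fun i => h _), Sat_reindex _ _ _ h, sat_relMemF hM _ (fun i => h _)]
  rfl

theorem env0 (v : Env.{u} 0) : ∀ i, v i ∈ M := fun i => i.elim0

theorem sat_acAx (hM : Base M) : Sat M (acAx : BF 0) default ↔
    ∀ a ∈ M, ∃ k ∈ M, ∃ f ∈ M, IsOrd k ∧ Surj M k a f := by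
  unfold acAx
  simp only [Sat_and, Sat_all, Sat_ex]
  refine forall₂_congr fun a ha => exists_congr fun k => and_congr_right fun hk =>
    exists_congr fun f => and_congr_right fun hf => ?_
  have h := (snc_mem (snc_mem (snc_mem (env0 default) ha) hk) hf)
  rw [Sat_reindex _ _ _ h, sat_ordF hM.trans _ (fun i => h _), Sat_reindex _ _ _ h, sat_isFuncF hM _ (fun i => h _)]
  rfl

theorem sat_alephOneF (hM : Base M) (v : Env.{u} 2) (hv : ∀ i, v i ∈ M) :
    Sat M alephOneF v ↔ (IsOrd (v 1) ∧ ¬ ∃ f ∈ M, Surj M (v 0) (v 1) f) ∧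
      ∀ x ∈ M, x ∈ v 1 → (x = ∅ ∨ ∃ f ∈ M, Surj M (v 0) x f) := by
  unfold alephOneF
  simp only [Sat_and, Sat_all, Sat_ex, Sat_not, Sat_imp, Sat_or, Sat_memf]
  refine and_congr (and_congr ?_ (not_congr ?_)) ?_
  · rw [Sat_reindex _ _ _ hv, sat_ordF hM.trans _ (fun i => hv _)]; rfl
  · refine exists_congr fun f => and_congr_right fun hf => ?_
    have h := snc_mem hv hf
    rw [Sat_reindex _ _ _ h, sat_isFuncF hM _ (fun i => h _)]; rfl
  · refine forall₂_congr fun x hx => imp_congr Iff.rfl (or_congr ?_ ?_)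
    · have h := snc_mem hv hx
      rw [Sat_reindex _ _ _ h, sat_emptyF hM.trans _ (fun i => h _)]; rfl
    refine exists_congr fun f => and_congr_right fun hf => ?_
    have h := snc_mem (snc_mem hv hx) hf
    rw [Sat_reindex _ _ _ h, sat_isFuncF hM _ (fun i => h _)]; rfl

theorem sat_omegaF (T : Tr M) (v : Env.{u} 1) (hv : ∀ i, v i ∈ M)
    (h1 : IsOrd (v 0)) (h2 : ∅ ∈ v 0) (h3 : ∀ x ∈ v 0, insert x x ∈ v 0)
    (h4 : ∀ x ∈ v 0, x = ∅ ∨ ∃ y ∈ x, x = insert y y) :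
    Sat M omegaF v := by
  unfold omegaF
  simp only [Sat_and, Sat_all, Sat_ex, Sat_imp, Sat_or, Sat_memf, sat_ordF T v hv]
  refine ⟨⟨h1, ?_⟩, ?_, ?_⟩
  · have h0 := T _ (hv 0) _ h2
    refine ⟨∅, h0, h2, ?_⟩
    have h := snc_mem hv h0
    rw [Sat_reindex _ _ _ h, sat_emptyF T _ (fun i => h _)]; rfl
  · intro x hx hxv
    have h0 := T _ (hv 0) _ (h3 x hxv)
    refine ⟨_, h0, h3 x hxv, ?_⟩
    have h := snc_mem (snc_mem hv hx) h0
    rw [Sat_reindex _ _ _ h, sat_succF T _ (fun i => h _)]; rfl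
  · intro x hx hxv
    refine (h4 x hxv).imp ?_ ?_
    · intro hh
      have h := snc_mem hv hx
      rw [Sat_reindex _ _ _ h, sat_emptyF T _ (fun i => h _)]; exact hh
    · rintro ⟨y, hy, hh⟩
      have h0 := T _ hx _ hy
      refine ⟨y, h0, hy, ?_⟩
      have h := snc_mem (snc_mem hv hx) h0
      rw [Sat_reindex _ _ _ h, sat_succF T _ (fun i => h _)]; exact hh

theorem sat_chSent (hM : Base M) {w r k b : ZFSet.{u}} (hw : w ∈ M) (hr : r ∈ M) (hk : k ∈ M) (hb : b ∈ M)
    (h1 : IsOrd w) (h2 : ∅ ∈ w) (h3 : ∀ x ∈ w, insert x x ∈ w)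
    (h4 : ∀ x ∈ w, x = ∅ ∨ ∃ y ∈ x, x = insert y y)
    (h5 : r = Pw M w) (h6 : IsOrd k) (h7 : ¬ ∃ f ∈ M, Surj M w k f)
    (h8 : ∀ x ∈ k, (x = ∅ ∨ ∃ f ∈ M, Surj M w x f))
    (h9 : Surj M r k b)
    (h10 : ∀ x ∈ M, ∀ y ∈ M, ∀ z ∈ M,
      ZFSet.pair x z ∈ b ∧ ZFSet.pair y z ∈ b → x = y) : Sat M (chSent : BF 0) default := by
  unfold chSent
  simp only [Sat_and, Sat_ex]
  have h := snc_mem (snc_mem (snc_mem (snc_mem (env0 default) hw) hr) hk) hb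
  refine ⟨w, hw, r, hr, k, hk, b, hb, ⟨?_, ?_⟩, ?_, ?_⟩
  · rw [Sat_reindex _ _ _ h]
    exact sat_omegaF hM.trans _ (fun i => h _) h1 h2 h3 h4
  · rw [Sat_reindex _ _ _ h, sat_powF hM.trans _ (fun i => h _)]
    exact h5
  · rw [Sat_reindex _ _ _ h, sat_alephOneF hM _ (fun i => h _)]
    exact ⟨⟨h6, h7⟩, fun x _ hx => h8 x hx⟩
  · rw [Sat_reindex _ _ _ h]
    unfold bijF
    rw [Sat_and, sat_isFuncF hM _ (fun i => h _), sat_injF hM _ (fun i => h _)]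
    exact ⟨h9, h10⟩

theorem sat_sepAx {n : ℕ} (φ : BF (n + 1)) : Sat M (sepAx φ : BF 0) default ↔
    ∀ v : Env.{u} n, (∀ i, v i ∈ M) → ∀ A ∈ M, ∃ B ∈ M, ∀ x ∈ M,
      (x ∈ B ↔ x ∈ A ∧ Sat M φ (snc v x)) := by
  unfold sepAx
  rw [Sat_alls]
  simp only [Sat_and, Sat_all, Sat_ex, Sat_iffF, Sat_memf]
  refine forall₂_congr fun v hv => forall₂_congr fun A hA => exists_congr fun B =>
    and_congr_right fun hB => forall₂_congr fun x hx => ?_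
  have h := snc_mem (snc_mem (snc_mem hv hA) hB) hx
  rw [Sat_reindex _ _ _ h]
  have e1 : snc (snc (snc v A) B) x ⟨n + 2, by omega⟩ = x := snc_last _ _
  have e2 : snc (snc (snc v A) B) x ⟨n + 1, by omega⟩ = B := by
    have := snc_cs (snc (snc v A) B) x (Fin.last _)
    rwa [snc_last] at this
  have e3 : snc (snc (snc v A) B) x ⟨n, by omega⟩ = A := by
    exact (snc_cs (snc (snc v A) B) x (Fin.last _).castSucc).trans ((snc_cs _ _ _).trans (snc_last _ _))
  rw [e1, e2, e3]
  have : (fun i : Fin (n+1) => snc (snc (snc v A) B) x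
      (if h : (i : ℕ) < n then ⟨i, by omega⟩ else ⟨n + 2, by omega⟩)) = snc v x := by
    funext i
    refine Fin.lastCases ?_ (fun j => ?_) i
    · simp [snc_last, e1]
    · rw [snc_cs]
      simp only [Fin.val_castSucc, Fin.is_lt, dite_true]
      exact (snc_cs (snc (snc v A) B) x j.castSucc.castSucc).trans ((snc_cs _ _ _).trans (snc_cs _ _ _))
  rw [this]

theorem sat_replAx {n : ℕ} (φ : BF (n + 2)) : Sat M (replAx φ : BF 0) default ↔
    ∀ v : Env.{u} n, (∀ i, v i ∈ M) → ∀ A ∈ M,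
      (∀ x ∈ M, ∀ y ∈ M, ∀ y' ∈ M, x ∈ A ∧ Sat M φ (snc (snc v x) y) ∧ Sat M φ (snc (snc v x) y') →
        y = y') → ∃ B ∈ M, ∀ y ∈ M, (y ∈ B ↔ ∃ x ∈ M, x ∈ A ∧ Sat M φ (snc (snc v x) y)) := by
  unfold replAx
  rw [Sat_alls]
  simp only [Sat_and, Sat_all, Sat_ex, Sat_iffF, Sat_memf, Sat_eqf, Sat_imp]
  have c0 : ∀ (v : Env.{u} n) (a b c d : ZFSet.{u}) (i : ℕ) (hi : i < n), snc (snc (snc (snc v a) b) c) d ⟨i, by omega⟩ = v ⟨i, hi⟩ := by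
    intro v a b c d i hi
    exact (snc_cs (snc (snc (snc v a) b) c) d (⟨i, hi⟩ : Fin n).castSucc.castSucc.castSucc).trans
      ((snc_cs _ _ _).trans ((snc_cs _ _ _).trans (snc_cs _ _ _)))
  have c1 : ∀ (v : Env.{u} n) (a b c d : ZFSet.{u}), snc (snc (snc (snc v a) b) c) d ⟨n, by omega⟩ = a := by
    intro v a b c d
    exact (snc_cs (snc (snc (snc v a) b) c) d (Fin.last _).castSucc.castSucc).trans
      ((snc_cs _ _ _).trans ((snc_cs _ _ _).trans (snc_last _ _)))
  have c2 : ∀ (v : Env.{u} n) (a b c d : ZFSet.{u}), snc (snc (snc (snc v a) b) c) d ⟨n+1, by omega⟩ = b := by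
    intro v a b c d
    exact (snc_cs (snc (snc (snc v a) b) c) d (Fin.last _).castSucc).trans
      ((snc_cs _ _ _).trans (snc_last _ _))
  have c3 : ∀ (v : Env.{u} n) (a b c d : ZFSet.{u}), snc (snc (snc (snc v a) b) c) d ⟨n+2, by omega⟩ = c := by
    intro v a b c d
    have := snc_cs (snc (snc (snc v a) b) c) d (Fin.last _)
    rwa [snc_last] at this
  have c4 : ∀ (v : Env.{u} n) (a b c d : ZFSet.{u}), snc (snc (snc (snc v a) b) c) d ⟨n+3, by omega⟩ = d := by
    intro v a b c d
    exact snc_last _ _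
  have d1 : ∀ (v : Env.{u} n) (a b c : ZFSet.{u}), snc (snc (snc v a) b) c ⟨n+1, by omega⟩ = b := by
    intro v a b c
    have := snc_cs (snc (snc v a) b) c (Fin.last _)
    rwa [snc_last] at this
  have d2 : ∀ (v : Env.{u} n) (a b c : ZFSet.{u}), snc (snc (snc v a) b) c ⟨n+2, by omega⟩ = c := by
    intro v a b c
    exact snc_last _ _
  have key : ∀ (v : Env.{u} n) (w : Env.{u} (n+4)) (x y : Fin (n+4)) (a b : ZFSet.{u}),
      (∀ (i : ℕ) (hi : i < n), w ⟨i, by omega⟩ = v ⟨i, hi⟩) → w x = a → w y = b →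
      (fun i : Fin (n+2) => w (if h : (i : ℕ) < n then ⟨i, by omega⟩ else if (i : ℕ) = n then x else y))
        = snc (snc v a) b := by
    intro v w x y a b h1 h2 h3
    funext i
    refine Fin.lastCases ?_ (fun i => Fin.lastCases ?_ (fun i => ?_) i) i
    · simp [snc_last, h3]
    · simp [snc_last, snc_cs, h2]
    · simp [snc_cs, h1]
  refine forall₂_congr fun v hv => forall₂_congr fun A hA => imp_congr ?_ ?_
  · refine forall₂_congr fun x hx => forall₂_congr fun y hy => forall₂_congr fun y' hy' => ?_
    have h := snc_mem (snc_mem (snc_mem (snc_mem hv hA) hx) hy) hy'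
    rw [Sat_reindex _ _ _ h, Sat_reindex _ _ _ h, key v _ _ _ _ _ (c0 v _ _ _ _) (c2 _ _ _ _ _) (c3 _ _ _ _ _),
      key v _ _ _ _ _ (c0 v _ _ _ _) (c2 _ _ _ _ _) (c4 _ _ _ _ _), c1, c2, c3, c4]
  · refine exists_congr fun B => and_congr_right fun hB => forall₂_congr fun y hy => ?_
    rw [d1, d2]
    refine iff_congr Iff.rfl ?_
    refine exists_congr fun x => and_congr_right fun hx => ?_
    have h := snc_mem (snc_mem (snc_mem (snc_mem hv hA) hB) hy) hx
    rw [Sat_reindex _ _ _ h, key v _ _ _ _ _ (c0 v _ _ _ _) (c4 _ _ _ _ _) (c3 _ _ _ _ _), c1, c4]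

end decode

end

section
set_option linter.unusedSimpArgs false

/-! ### `Z` and `Base` -/

theorem base_of_Z {M : ZFSet.{u}} (T : Tr M) (h : ∀ φ ∈ Z, Sat M (φ : BF 0) (default : Env.{u} 0)) : Base M := by
  have hpr : ∀ x ∈ M, ∀ y ∈ M, ({x, y} : ZFSet) ∈ M := by
    intro x hx y hy
    have := h pairAx (by simp [Z, zfFin])
    unfold pairAx at this
    simp only [Sat_all, Sat_ex] at this
    obtain ⟨z, hz, hh⟩ := this x hx y hy
    rw [sat_pairSetF T _ (snc_mem (snc_mem (snc_mem (env0 _) hx) hy) hz)] at hh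
    have : z = {x, y} := hh
    rwa [← this]
  have hsep : ∀ (n : ℕ) (φ : BF (n + 1)) (v : Env.{u} n), (∀ i, v i ∈ M) → ∀ A ∈ M,
      ZFSet.sep (fun x => Sat M φ (snc v x)) A ∈ M := by
    intro n φ v hv A hA
    have := h (sepAx φ) (Or.inr ⟨⟨n, φ⟩, rfl⟩)
    rw [sat_sepAx] at this
    obtain ⟨B, hB, hh⟩ := this v hv A hA
    convert hB
    symm
    rw [← ext_iffM T hB]
    · simpa using hh
    · intro x hx; exact T _ hA _ (ZFSet.mem_sep.1 hx).1
  have hinf : ∃ I ∈ M, ∅ ∈ I ∧ ∀ x ∈ I, insert x x ∈ I := by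
    have := h infAx (by simp [Z, zfFin])
    unfold infAx at this
    simp only [Sat_all, Sat_ex, Sat_and, Sat_imp, Sat_memf] at this
    obtain ⟨I, hI, ⟨e, he, heI, h1⟩, h2⟩ := this
    have hh := (snc_mem (snc_mem (env0 default) hI) he)
    rw [Sat_reindex _ _ _ hh, sat_emptyF T _ (fun i => hh _)] at h1
    have h1' : e = ∅ := h1
    have heI' : e ∈ I := heI
    refine ⟨I, hI, h1' ▸ heI', fun x hx => ?_⟩
    obtain ⟨y, hy, hyI, h3⟩ := h2 x (T _ hI _ hx) hx
    have hh := (snc_mem (snc_mem (snc_mem (env0 default) hI) (T _ hI _ hx)) hy)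
    rw [Sat_reindex _ _ _ hh, sat_succF T _ (fun i => hh _)] at h3
    have h3' : y = insert x x := h3
    exact h3' ▸ hyI
  refine ⟨T, ?_, hpr, ?_, ?_, hinf, hsep⟩
  · obtain ⟨I, hI, h0, _⟩ := hinf
    exact T _ hI _ h0
  · intro x hx
    have := h unionAx (by simp [Z, zfFin])
    unfold unionAx at this
    simp only [Sat_all, Sat_ex, Sat_and, Sat_iffF, Sat_memf] at this
    obtain ⟨y, hy, hh⟩ := this x hx
    convert hy
    symm
    rw [← ext_iffM T hy]
    · intro z hz
      refine (hh z hz).trans ?_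
      rw [ZFSet.mem_sUnion]
      exact ⟨fun ⟨w, _, h1, h2⟩ => ⟨w, h1, h2⟩, fun ⟨w, h1, h2⟩ => ⟨w, T _ hx _ h1, h1, h2⟩⟩
    · intro z hz
      obtain ⟨w, h1, h2⟩ := ZFSet.mem_sUnion.1 hz
      exact T _ (T _ hx _ h1) _ h2
  · intro x hx
    have := h powAx (by simp [Z, zfFin])
    unfold powAx at this
    simp only [Sat_all, Sat_ex] at this
    obtain ⟨y, hy, hh⟩ := this x hx
    have h1 := snc_mem (snc_mem (env0 default) hx) hy
    rw [sat_powF T _ h1] at hh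
    have : y = Pw M x := hh
    show Pw M x ∈ M
    exact this ▸ hy

theorem Z_of_base {M : ZFSet.{u}} (hM : Base M) : ∀ φ ∈ Z, Sat M (φ : BF 0) (default : Env.{u} 0) := by
  have T : Tr M := hM.trans
  rintro φ (h | ⟨⟨n, φ⟩, rfl⟩)
  · simp only [zfFin, Set.mem_insert_iff, Set.mem_singleton_iff] at h
    rcases h with rfl | rfl | rfl | rfl | rfl | rfl
    · unfold extAx
      simp only [Sat_all, Sat_and, Sat_imp, Sat_eqf]
      intro x hx y hy ⟨h1, h2⟩
      have h := snc_mem (snc_mem (env0 default) hx) hy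
      rw [sat_subF T _ h] at h1
      rw [Sat_reindex _ _ _ h, sat_subF T _ (fun i => h _)] at h2
      have h1' : x ⊆ y := h1
      have h2' : y ⊆ x := h2
      show x = y
      ext z; exact ⟨fun h => h1' h, fun h => h2' h⟩
    · unfold foundAx
      simp only [Sat_all, Sat_and, Sat_imp, Sat_eqf, Sat_ex, Sat_memf, Sat_not]
      rintro x hx ⟨y, hy, hyx⟩
      have hyx' : y ∈ x := hyx
      obtain ⟨z, hz, hh⟩ := ZFSet.regularity x (by rintro rfl; simp at hyx')
      refine ⟨z, T _ hx _ hz, hz, ?_⟩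
      intro w hw h1 h2
      have : w ∈ x ∩ z := ZFSet.mem_inter.2 ⟨h1, h2⟩
      rw [hh] at this
      simp at this
    · unfold pairAx
      simp only [Sat_all, Sat_ex]
      intro x hx y hy
      refine ⟨_, hM.pr x hx y hy, ?_⟩
      rw [sat_pairSetF T _ (snc_mem (snc_mem (snc_mem (env0 _) hx) hy) (hM.pr x hx y hy))]
      rfl
    · unfold unionAx
      simp only [Sat_all, Sat_ex, Sat_and, Sat_iffF, Sat_memf]
      intro x hx
      refine ⟨_, hM.sUnion x hx, fun z hz => ?_⟩
      refine Iff.trans (b := z ∈ (ZFSet.sUnion x : ZFSet)) Iff.rfl ?_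
      rw [ZFSet.mem_sUnion]
      exact ⟨fun ⟨w, h1, h2⟩ => ⟨w, T _ hx _ h1, h1, h2⟩, fun ⟨w, _, h1, h2⟩ => ⟨w, h1, h2⟩⟩
    · unfold powAx
      simp only [Sat_all, Sat_ex]
      intro x hx
      refine ⟨_, hM.pow x hx, ?_⟩
      rw [sat_powF T _ (snc_mem (snc_mem (env0 default) hx) (hM.pow x hx))]
      rfl
    · unfold infAx
      simp only [Sat_all, Sat_ex, Sat_and, Sat_imp, Sat_memf]
      obtain ⟨I, hI, h0, h1⟩ := hM.inf
      refine ⟨I, hI, ⟨∅, hM.empty, h0, ?_⟩, ?_⟩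
      · have hh := (snc_mem (snc_mem (env0 default) hI) hM.empty)
        rw [Sat_reindex _ _ _ hh, sat_emptyF T _ (fun i => hh _)]
        rfl
      · intro x hx hxI
        have h2 := h1 x hxI
        have h3 := T _ hI _ h2
        refine ⟨_, h3, h2, ?_⟩
        have hh := (snc_mem (snc_mem (snc_mem (env0 default) hI) hx) h3)
        rw [Sat_reindex _ _ _ hh, sat_succF T _ (fun i => hh _)]
        rfl
  · rw [sat_sepAx]
    intro v hv A hA
    exact ⟨_, hM.sep n φ v hv A hA, fun x _ => by simp⟩

/-! ### natural numbers -/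

noncomputable def num : ℕ → ZFSet.{u}
  | 0 => ∅
  | n + 1 => insert (num n) (num n)

noncomputable def om : ZFSet.{u} := ZFSet.range num.{u}

theorem mem_om {x : ZFSet.{u}} : x ∈ om ↔ ∃ n, num n = x := by simp [om]

theorem num_mem_om (n : ℕ) : num.{u} n ∈ om := mem_om.2 ⟨n, rfl⟩

theorem mem_num {n : ℕ} {x : ZFSet.{u}} : x ∈ num n ↔ ∃ m < n, x = num m := by
  induction n with
  | zero => simp [num]
  | succ n ih =>
    simp only [num, ZFSet.mem_insert_iff, ih]
    constructor
    · rintro (h | ⟨m, h, h'⟩)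
      · exact ⟨n, by omega, h⟩
      · exact ⟨m, by omega, h'⟩
    · rintro ⟨m, h, h'⟩
      rcases Nat.lt_succ_iff_lt_or_eq.1 h with h | rfl
      · exact Or.inr ⟨m, h, h'⟩
      · exact Or.inl h'

theorem num_inj {m n : ℕ} (h : num.{u} m = num n) : m = n := by
  rcases lt_trichotomy m n with h' | h' | h'
  · have : num m ∈ num.{u} n := mem_num.2 ⟨m, h', rfl⟩
    rw [h] at this; exact absurd this (ZFSet.mem_irrefl _)
  · exact h'
  · have : num n ∈ num.{u} m := mem_num.2 ⟨n, h', rfl⟩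
    rw [h] at this; exact absurd this (ZFSet.mem_irrefl _)

theorem num_sub {n : ℕ} {x : ZFSet.{u}} (hx : x ∈ num n) : x ⊆ num n := by
  intro y hy
  obtain ⟨m, hm, rfl⟩ := mem_num.1 hx
  obtain ⟨k, hk, rfl⟩ := mem_num.1 hy
  exact mem_num.2 ⟨k, by omega, rfl⟩

def IsNat (x : ZFSet.{u}) : Prop := (∀ y ∈ x, y ⊆ x) ∧ ∀ m ∈ insert x x, (m = ∅ ∨ ∃ k ∈ m, m = insert k k)

theorem isNat_iff {x : ZFSet.{u}} : IsNat x ↔ x ∈ om := by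
  constructor
  · induction x using ZFSet.inductionOn with
    | _ x ih =>
    rintro ⟨h1, h2⟩
    rcases h2 x (by simp) with rfl | ⟨k, hk, hxk⟩
    · exact num_mem_om 0
    · have : IsNat k := by
        refine ⟨fun y hy z hz => ?_, fun m hm => h2 m ?_⟩
        · have hyx : y ∈ x := h1 k hk hy
          have hzx := h1 y hyx hz
          rw [hxk, ZFSet.mem_insert_iff] at hzx
          rcases hzx with rfl | h
          · exact absurd hy (ZFSet.mem_asymm hz)
          · exact h
        · rw [← hxk] at hm
          simp [hm]
      obtain ⟨n, rfl⟩ := mem_om.1 (ih k hk this)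
      exact mem_om.2 ⟨n + 1, hxk.symm⟩
  · intro h
    obtain ⟨n, rfl⟩ := mem_om.1 h
    refine ⟨fun y hy => num_sub hy, fun m hm => ?_⟩
    have : m ∈ num (n + 1) := hm
    obtain ⟨k, hk, rfl⟩ := mem_num.1 this
    cases k with
    | zero => left; rfl
    | succ k => right; exact ⟨num k, mem_num.2 ⟨k, by omega, rfl⟩, rfl⟩

instance {n : ℕ} (f : ZFSet.{u} → Env.{u} n → ZFSet.{u}) [hf : DefT f] : Def (fun M v => IsNat (f M v)) := by
  unfold IsNat; infer_instance

theorem om_mem {M : ZFSet.{u}} (hM : Base M) : om ∈ M := by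
  obtain ⟨I, hI, h0, h1⟩ := hM.inf
  have : ∀ n, num n ∈ I := by
    intro n
    induction n with
    | zero => exact h0
    | succ n ih => exact h1 _ ih
  have h := DefT.app (fun _ (v : Env.{u} 1) => ZFSet.sep (fun x => IsNat x) (v 0)) hM ![I] (by simpa using hI)
  convert h using 1
  ext x
  simp only [ZFSet.mem_sep, isNat_iff]
  refine ⟨fun h => ⟨?_, h⟩, fun h => h.2⟩
  obtain ⟨n, rfl⟩ := mem_om.1 h
  exact this n

instance DefT.om {n : ℕ} : DefT (fun _ (_ : Env.{u} n) => (om : ZFSet.{u})) :=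
  DefT.ofMem (fun _ _ x => IsNat x) inferInstance (fun _ hM _ _ => om_mem hM) (fun _ _ _ _ x _ => isNat_iff)

theorem num_mem {M : ZFSet.{u}} (hM : Base M) (n : ℕ) : num n ∈ M := hM.trans _ (om_mem hM) _ (num_mem_om n)

theorem om_ord : IsOrd om.{u} := by
  refine ⟨fun x hx y hy => ?_, fun x hx y hy => ?_⟩
  · obtain ⟨n, rfl⟩ := mem_om.1 hx
    obtain ⟨m, _, rfl⟩ := mem_num.1 hy
    exact num_mem_om _
  · obtain ⟨n, rfl⟩ := mem_om.1 hx
    exact num_sub hy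

instance Def.isOrd {n : ℕ} (f : ZFSet.{u} → Env.{u} n → ZFSet.{u}) [hf : DefT f] : Def (fun M v => IsOrd (f M v)) := by
  unfold IsOrd ZFSet.IsTransitive; infer_instance

instance Def.surj {n : ℕ} (f g h : ZFSet.{u} → Env.{u} n → ZFSet.{u}) [hf : DefT f] [DefT g] [DefT h] :
    Def (fun M v => Surj M (f M v) (g M v) (h M v)) := by
  unfold Surj; infer_instance

/-! ### Replacement for definable relations -/

theorem Def.repl {n : ℕ} (R : ZFSet.{u} → Env.{u} n → ZFSet.{u} → ZFSet.{u} → Prop)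
    [hR : Def (fun M (w : Env.{u} (n + 2)) => R M (fun i => w i.castSucc.castSucc)
      (w (Fin.last n).castSucc) (w (Fin.last (n + 1))))] :
    ∃ φ : BF (n + 2), ∀ M, Base M → (Sat M (replAx φ : BF 0) default ↔
    ∀ v : Env.{u} n, (∀ i, v i ∈ M) → ∀ A ∈ M,
      (∀ x ∈ A, ∀ y ∈ M, ∀ y' ∈ M, R M v x y → R M v x y' → y = y') →
      ∃ B ∈ M, ∀ y ∈ M, (y ∈ B ↔ ∃ x ∈ A, R M v x y)) := by
  obtain ⟨φ, hφ⟩ := hR.out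
  refine ⟨φ, fun M hM => ?_⟩
  rw [sat_replAx]
  have key : ∀ v : Env.{u} n, (∀ i, v i ∈ M) → ∀ x ∈ M, ∀ y ∈ M,
      (Sat M φ (snc (snc v x) y) ↔ R M v x y) := by
    intro v hv x hx y hy
    rw [hφ M hM _ (snc_mem (snc_mem hv hx) hy)]
    simp only [snc_last, snc_cs]
  refine forall₂_congr fun v hv => forall₂_congr fun A hA => imp_congr ?_ ?_
  · rw [ball_iffM hM.trans hA]
    refine forall₂_congr fun x hx => ?_
    constructor
    · intro h hxA y hy y' hy' h1 h2
      exact h y hy y' hy' ⟨hxA, (key v hv x hx y hy).2 h1, (key v hv x hx y' hy').2 h2⟩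
    · rintro h y hy y' hy' ⟨hxA, h1, h2⟩
      exact h hxA y hy y' hy' ((key v hv x hx y hy).1 h1) ((key v hv x hx y' hy').1 h2)
  · refine exists_congr fun B => and_congr_right fun hB => forall₂_congr fun y hy => ?_
    rw [bex_iffM hM.trans hA]
    refine iff_congr Iff.rfl (exists_congr fun x => and_congr_right fun hx => ?_)
    rw [key v hv x hx y hy]

end

section
section alls
variable {M a b c d e : ZFSet.{u}}
theorem all1 (ha : a ∈ M) : ∀ i, (![a] : Env.{u} 1) i ∈ M := by
  intro i; fin_cases i; exact ha
theorem all2 (ha : a ∈ M) (hb : b ∈ M) : ∀ i, (![a, b] : Env.{u} 2) i ∈ M := by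
  intro i; fin_cases i; exacts [ha, hb]
theorem all3 (ha : a ∈ M) (hb : b ∈ M) (hc : c ∈ M) : ∀ i, (![a, b, c] : Env.{u} 3) i ∈ M := by
  intro i; fin_cases i; exacts [ha, hb, hc]
theorem all4 (ha : a ∈ M) (hb : b ∈ M) (hc : c ∈ M) (hd : d ∈ M) :
    ∀ i, (![a, b, c, d] : Env.{u} 4) i ∈ M := by
  intro i; fin_cases i; exacts [ha, hb, hc, hd]
theorem all5 (ha : a ∈ M) (hb : b ∈ M) (hc : c ∈ M) (hd : d ∈ M) (he : e ∈ M) :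
    ∀ i, (![a, b, c, d, e] : Env.{u} 5) i ∈ M := by
  intro i; fin_cases i; exacts [ha, hb, hc, hd, he]
end alls

/-! ### The cumulative hierarchy inside `M` -/

open ZFSet in
noncomputable def Vr (M x : ZFSet.{u}) : ZFSet.{u} := ZFSet.sep (fun y => y ∈ M) (V_ (rank x))

theorem mem_Vr {M x y : ZFSet.{u}} : y ∈ Vr M x ↔ y ∈ M ∧ ZFSet.rank y < ZFSet.rank x := by
  rw [Vr, ZFSet.mem_sep, ZFSet.mem_vonNeumann, and_comm]

theorem sub_Vr {M u s : ZFSet.{u}} (hs : ∀ z ∈ s, z ∈ M) :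
    s ⊆ Vr M u ↔ ZFSet.rank s ≤ ZFSet.rank u := by
  rw [ZFSet.rank_le_iff]
  constructor
  · intro h y hy; exact (mem_Vr.1 (h hy)).2
  · intro h y hy; exact mem_Vr.2 ⟨hs y hy, h hy⟩

theorem mem_Vr' {M x s : ZFSet.{u}} (T : Tr M) (hs : s ∈ M) : s ∈ Vr M x ↔ ∃ u ∈ x, s ⊆ Vr M u := by
  simp only [mem_Vr, hs, true_and, sub_Vr (T s hs), ZFSet.lt_rank_iff]

def Wit (M t : ZFSet.{u}) : Prop :=
  ∀ z ∈ t, ∃ x ∈ M, ∃ y ∈ M, z = ZFSet.pair x y ∧ (∀ a ∈ x, ∃ w ∈ M, ZFSet.pair a w ∈ t) ∧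
    ∀ s ∈ M, (s ∈ y ↔ ∃ a ∈ x, ∃ w ∈ M, ZFSet.pair a w ∈ t ∧ s ⊆ w)

instance Def.wit {n : ℕ} (f : ZFSet.{u} → Env.{u} n → ZFSet.{u}) [DefT f] : Def (fun M v => Wit M (f M v)) := by
  unfold Wit; infer_instance

def VRel (M x v : ZFSet.{u}) : Prop := ∃ t ∈ M, Wit M t ∧ ZFSet.pair x v ∈ t

instance Def.vrel {n : ℕ} (f g : ZFSet.{u} → Env.{u} n → ZFSet.{u}) [DefT f] [DefT g] :
    Def (fun M v => VRel M (f M v) (g M v)) := by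
  unfold VRel; infer_instance

theorem Wit.val {M t : ZFSet.{u}} (hM : Base M) (ht : t ∈ M) (h : Wit M t) {x : ZFSet.{u}} :
    ∀ y, ZFSet.pair x y ∈ t → y = Vr M x := by
  induction x using ZFSet.inductionOn with
  | _ x ih =>
  intro y hxy
  obtain ⟨x', hx, y', hy, e, h1, h2⟩ := h _ hxy
  obtain ⟨rfl, rfl⟩ := ZFSet.pair_inj.1 e
  have T : Tr M := hM.trans
  rw [← ext_iffM T hy]
  · intro s hs
    rw [h2 s hs, mem_Vr' T hs]
    constructor
    · rintro ⟨a, ha, w, hw, haw, hsw⟩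
      exact ⟨a, ha, ih a ha w haw ▸ hsw⟩
    · rintro ⟨a, ha, hsa⟩
      obtain ⟨w, hw, haw⟩ := h1 a ha
      exact ⟨a, ha, w, hw, haw, ih a ha w haw ▸ hsa⟩
  · intro s hs; exact (mem_Vr.1 hs).1

/-- semantic form of `Wit` -/
theorem wit_iff {M t : ZFSet.{u}} (hM : Base M) (ht : t ∈ M) : Wit M t ↔
    ∀ z ∈ t, ∃ x ∈ M, z = ZFSet.pair x (Vr M x) ∧ ∀ a ∈ x, ZFSet.pair a (Vr M a) ∈ t := by
  have T : Tr M := hM.trans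
  constructor
  · intro h z hz
    obtain ⟨x, hx, y, hy, rfl, h1, h2⟩ := h z hz
    refine ⟨x, hx, by rw [← h.val hM ht y hz], fun a ha => ?_⟩
    obtain ⟨w, hw, haw⟩ := h1 a ha
    rwa [← h.val hM ht w haw]
  · intro h z hz
    obtain ⟨x, hx, rfl, h1⟩ := h z hz
    have hv : ∀ a b, ZFSet.pair a b ∈ t → b = Vr M a ∧ b ∈ M := by
      intro a b hab
      obtain ⟨a', _, e, _⟩ := h _ hab
      obtain ⟨rfl, e2⟩ := ZFSet.pair_inj.1 e
      exact ⟨e2, (hM.of_pair (T _ ht _ hab)).2⟩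
    refine ⟨x, hx, _, (hv _ _ hz).2, rfl, fun a ha => ⟨_, (hv _ _ (h1 a ha)).2, h1 a ha⟩, ?_⟩
    intro s hs
    rw [mem_Vr' T hs]
    constructor
    · rintro ⟨a, ha, hsa⟩
      exact ⟨a, ha, _, (hv _ _ (h1 a ha)).2, h1 a ha, hsa⟩
    · rintro ⟨a, ha, w, hw, haw, hsw⟩
      exact ⟨a, ha, (hv _ _ haw).1 ▸ hsw⟩

def WitR (M x t : ZFSet.{u}) : Prop :=
  (Wit M t ∧ ∃ w ∈ M, ZFSet.pair x w ∈ t) ∧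
    ∀ t' ∈ M, (Wit M t' ∧ ∃ w ∈ M, ZFSet.pair x w ∈ t') → t ⊆ t'

instance Def.witR {n : ℕ} (f g : ZFSet.{u} → Env.{u} n → ZFSet.{u}) [DefT f] [DefT g] :
    Def (fun M v => WitR M (f M v) (g M v)) := by
  unfold WitR; infer_instance

/-- semantic replacement used to build the hierarchy -/
def VRepl (M : ZFSet.{u}) : Prop :=
  ∀ A ∈ M, ∃ B ∈ M, ∀ y ∈ M, (y ∈ B ↔ ∃ x ∈ A, WitR M x y)

theorem exists_vrepl : ∃ φ : BF 2, ∀ M : ZFSet.{u}, Base M → Sat M (replAx (n := 0) φ : BF 0) default → VRepl M := by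
  obtain ⟨φ, hφ⟩ := Def.repl (n := 0) (fun M _ x y => WitR M x y)
  refine ⟨φ, fun M hM h A hA => ?_⟩
  refine (hφ M hM).1 h default (fun i => i.elim0) A hA ?_
  rintro x hx y hy y' hy' ⟨h1, h2⟩ ⟨h3, h4⟩
  exact ZFSet.ext fun z => ⟨fun hz => h2 y' hy' h3 hz, fun hz => h4 y hy h1 hz⟩

def WitP (M x : ZFSet.{u}) : Prop := ∃ t ∈ M, Wit M t ∧ ZFSet.pair x (Vr M x) ∈ t

theorem witR_exists {M x : ZFSet.{u}} (hM : Base M) (h : WitP M x) : ∃ t ∈ M, WitR M x t ∧ ZFSet.pair x (Vr M x) ∈ t := by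
  have T : Tr M := hM.trans
  obtain ⟨t, ht, hw, hx⟩ := h
  have hxM := hM.of_pair (T _ ht _ hx)
  have h := DefT.app (fun M (v : Env.{u} 2) => ZFSet.sep
    (fun z => ∀ t ∈ M, (Wit M t ∧ v 1 ∈ t) → z ∈ t) (v 0)) hM ![t, ZFSet.pair x (Vr M x)]
    (all2 ht (T _ ht _ hx))
  simp only [Matrix.cons_val_zero, Matrix.cons_val_one] at h
  have hin : ZFSet.pair x (Vr M x) ∈ ZFSet.sep
    (fun z => ∀ t ∈ M, (Wit M t ∧ ZFSet.pair x (Vr M x) ∈ t) → z ∈ t) t := by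
    simp only [ZFSet.mem_sep]
    exact ⟨hx, fun t _ h => h.2⟩
  refine ⟨_, h, ⟨⟨?_, _, hxM.2, hin⟩, ?_⟩, hin⟩
  · rw [wit_iff hM h]
    intro z hz
    rw [ZFSet.mem_sep] at hz
    obtain ⟨x', hx', rfl, hh⟩ := (wit_iff hM ht).1 hw z hz.1
    refine ⟨x', hx', rfl, fun a ha => ?_⟩
    rw [ZFSet.mem_sep]
    refine ⟨hh a ha, fun t' ht' h' => ?_⟩
    obtain ⟨x'', _, e, h3⟩ := (wit_iff hM ht').1 h'.1 _ (hz.2 t' ht' h')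
    obtain ⟨rfl, _⟩ := ZFSet.pair_inj.1 e
    exact h3 a ha
  · rintro t' ht' ⟨h1, w, hw, h2⟩ z hz
    rw [ZFSet.mem_sep] at hz
    refine hz.2 t' ht' ⟨h1, ?_⟩
    rwa [← h1.val hM ht' w h2]

theorem witP_all {M : ZFSet.{u}} (hM : Base M) (hV : VRepl M) {x : ZFSet.{u}} : x ∈ M → WitP M x := by
  have T : Tr M := hM.trans
  induction x using ZFSet.inductionOn with
  | _ x ih =>
  intro hx
  obtain ⟨B, hB, hBx⟩ := hV x hx
  let S : ZFSet.{u} := ZFSet.sUnion B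
  have hS : S ∈ M := hM.sUnion B hB
  have hSa : ∀ a ∈ x, ZFSet.pair a (Vr M a) ∈ S := by
    intro a ha
    obtain ⟨t, ht, h1, h2⟩ := witR_exists hM (ih a ha (T _ hx _ ha))
    exact ZFSet.mem_sUnion.2 ⟨t, (hBx t ht).2 ⟨a, ha, h1⟩, h2⟩
  have hSw : ∀ z ∈ S, ∃ x ∈ M, z = ZFSet.pair x (Vr M x) ∧ ∀ a ∈ x, ZFSet.pair a (Vr M a) ∈ S := by
    intro z hz
    obtain ⟨t, ht, hzt⟩ := ZFSet.mem_sUnion.1 hz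
    have htM := T _ hB _ ht
    obtain ⟨a, ha, hh⟩ := (hBx t htM).1 ht
    obtain ⟨x', hx', rfl, h3⟩ := (wit_iff hM htM).1 hh.1.1 z hzt
    exact ⟨x', hx', rfl, fun b hb => ZFSet.mem_sUnion.2 ⟨t, ht, h3 b hb⟩⟩
  have hVx : Vr M x ∈ M := by
    have h := DefT.app (fun M (v : Env.{u} 2) => ZFSet.sep
      (fun s => ∃ a ∈ v 1, ∃ w ∈ M, ZFSet.pair a w ∈ v 0 ∧ s ⊆ w) (Pw M (ZFSet.sUnion (ZFSet.sUnion (ZFSet.sUnion (v 0)))))) hM ![S, x]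
      (all2 hS hx)
    simp only [Matrix.cons_val_zero, Matrix.cons_val_one] at h
    convert h using 1
    ext s
    rw [ZFSet.mem_sep, mem_Pw]
    constructor
    · intro hs
      have hsM := (mem_Vr.1 hs).1
      obtain ⟨a, ha, hsa⟩ := (mem_Vr' T hsM).1 hs
      have hp := hSa a ha
      refine ⟨⟨hsM, fun z hz => ?_⟩, a, ha, _, (hM.of_pair (T _ hS _ hp)).2, hp, hsa⟩
      simp only [ZFSet.mem_sUnion]
      exact ⟨Vr M a, ⟨{a, Vr M a}, ⟨_, hp, by simp [ZFSet.pair]⟩, by simp⟩, hsa hz⟩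
    · rintro ⟨⟨hsM, _⟩, a, ha, w, hw, haw, hsw⟩
      rw [mem_Vr' T hsM]
      refine ⟨a, ha, ?_⟩
      obtain ⟨a', _, e, _⟩ := hSw _ haw
      obtain ⟨rfl, rfl⟩ := ZFSet.pair_inj.1 e
      exact hsw
  have hp := hM.pair hx hVx
  have hi : insert (ZFSet.pair x (Vr M x)) S ∈ M := DefT.app (fun M (v : Env.{u} 2) => insert (v 0) (v 1)) hM ![ZFSet.pair x (Vr M x), S]
    (all2 hp hS)
  refine ⟨insert (ZFSet.pair x (Vr M x)) S, hi, ?_, by simp⟩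
  rw [wit_iff hM hi]
  intro z hz
  rcases ZFSet.mem_insert_iff.1 hz with rfl | hz
  · exact ⟨x, hx, rfl, fun a ha => ZFSet.mem_insert_iff.2 (Or.inr (hSa a ha))⟩
  · obtain ⟨x', hx', rfl, h3⟩ := hSw z hz
    exact ⟨x', hx', rfl, fun a ha => ZFSet.mem_insert_iff.2 (Or.inr (h3 a ha))⟩

/-- Base models in which the hierarchy is available. -/
structure BaseV (M : ZFSet.{u}) : Prop extends Base M where
  wit : ∀ x ∈ M, WitP M x

theorem BaseV.vr {M : ZFSet.{u}} (hM : BaseV M) {x : ZFSet.{u}} (hx : x ∈ M) : Vr M x ∈ M := by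
  obtain ⟨t, ht, _, h⟩ := hM.wit x hx
  exact (hM.of_pair (hM.trans _ ht _ h)).2

theorem BaseV.vrel {M : ZFSet.{u}} (hM : BaseV M) {x v : ZFSet.{u}} (hx : x ∈ M) :
    VRel M x v ↔ v = Vr M x := by
  constructor
  · rintro ⟨t, ht, h1, h2⟩
    exact h1.val hM.toBase ht v h2
  · rintro rfl
    exact hM.wit x hx

end

section
/-! ### Generic filters and definability over `(M, G)` -/

structure Ctx where
  M : ZFSet.{u}
  P : ZFSet.{u}
  G : ZFSet.{u}
  hM : BaseV M
  hP : P ∈ M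
  sub : ∀ p ∈ G, p ∈ P
  ne : ∃ p, p ∈ G
  down : ∀ q ∈ G, ∀ p ∈ P, p ⊆ q → p ∈ G
  dir : ∀ p ∈ G, ∀ q ∈ G, ∃ r ∈ G, p ⊆ r ∧ q ⊆ r
  gen : ∀ D ∈ M, D ⊆ P → (∀ p ∈ P, ∃ q ∈ D, p ⊆ q) → ∃ p ∈ D, p ∈ G

class Def2 {n : ℕ} (χ : ZFSet.{u} → Env.{u} n → ZFSet.{u} → ZFSet.{u} → Prop) : Prop where
  out : Def (fun M (w : Env.{u} (n + 2)) => χ M (fun i => w i.castSucc.castSucc)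
      (w (Fin.last n).castSucc) (w (Fin.last (n + 1))))

theorem Def2.app' {n m : ℕ} {χ : ZFSet.{u} → Env.{u} n → ZFSet.{u} → ZFSet.{u} → Prop} (h : Def2 χ)
    (t : Fin n → ZFSet.{u} → Env.{u} m → ZFSet.{u}) (ht : ∀ i, DefT (t i))
    (f g : ZFSet.{u} → Env.{u} m → ZFSet.{u}) (hf : DefT f) (hg : DefT g) :
    Def (fun M (v : Env.{u} m) => χ M (fun i => t i M v) (f M v) (g M v)) := by
  have := Def.subst h.out (Fin.snoc (α := fun _ => ZFSet.{u} → Env.{u} m → ZFSet.{u})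
    (Fin.snoc (α := fun _ => ZFSet.{u} → Env.{u} m → ZFSet.{u}) t f) g) (by
      intro j
      refine Fin.lastCases ?_ (fun j => Fin.lastCases ?_ (fun j => ?_) j) j
      · simpa using hg
      · simpa using hf
      · simpa using ht j)
  simpa using this

instance Def2.app {n m : ℕ} (χ : ZFSet.{u} → Env.{u} n → ZFSet.{u} → ZFSet.{u} → Prop) [h : Def2 χ]
    (ρ : Fin n → Fin m) (f g : ZFSet.{u} → Env.{u} m → ZFSet.{u}) [hf : DefT f] [hg : DefT g] :
    Def (fun M (v : Env.{u} m) => χ M (fun i => v (ρ i)) (f M v) (g M v)) :=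
  h.app' (fun i _ v => v (ρ i)) (fun _ => inferInstance) f g hf hg

instance Def2.appS {n m : ℕ} (χ : ZFSet.{u} → Env.{u} (n + 1) → ZFSet.{u} → ZFSet.{u} → Prop) [h : Def2 χ]
    (ρ : Fin n → Fin m) (e f g : ZFSet.{u} → Env.{u} m → ZFSet.{u}) [he : DefT e] [hf : DefT f] [hg : DefT g] :
    Def (fun M (v : Env.{u} m) => χ M (snc (fun i => v (ρ i)) (e M v)) (f M v) (g M v)) := by
  have := h.app' (Fin.snoc (α := fun _ => ZFSet.{u} → Env.{u} m → ZFSet.{u}) (fun i _ v => v (ρ i)) e) (by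
    intro j
    refine Fin.lastCases ?_ (fun j => ?_) j
    · simpa using he
    · simp only [Fin.snoc_castSucc]; infer_instance) f g hf hg
  refine this.congr fun M hM v hv => ?_
  congr! 1
  funext i
  refine Fin.lastCases ?_ (fun j => ?_) i <;> simp

instance Def2.appSS {n m : ℕ} (χ : ZFSet.{u} → Env.{u} (n + 1 + 1) → ZFSet.{u} → ZFSet.{u} → Prop) [h : Def2 χ]
    (ρ : Fin n → Fin m) (d e f g : ZFSet.{u} → Env.{u} m → ZFSet.{u}) [hd : DefT d] [he : DefT e] [hf : DefT f] [hg : DefT g] :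
    Def (fun M (v : Env.{u} m) => χ M (snc (snc (fun i => v (ρ i)) (d M v)) (e M v)) (f M v) (g M v)) := by
  have := h.app' (Fin.snoc (α := fun _ => ZFSet.{u} → Env.{u} m → ZFSet.{u})
    (Fin.snoc (α := fun _ => ZFSet.{u} → Env.{u} m → ZFSet.{u}) (fun i _ v => v (ρ i)) d) e) (by
    intro j
    refine Fin.lastCases ?_ (fun j => Fin.lastCases ?_ (fun j => ?_) j) j
    · simpa using he
    · simpa using hd
    · simp only [Fin.snoc_castSucc]; infer_instance) f g hf hg
  refine this.congr fun M hM v hv => ?_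
  congr! 1
  funext i
  refine Fin.lastCases ?_ (fun j => Fin.lastCases ?_ (fun j => ?_) j) i <;> simp

class FDef {n : ℕ} (R : Ctx.{u} → Env.{u} n → Prop) : Prop where
  out : ∃ χ : ZFSet.{u} → Env.{u} n → ZFSet.{u} → ZFSet.{u} → Prop, Def2 χ ∧
    ∀ C : Ctx.{u}, ∀ v : Env.{u} n, (∀ i, v i ∈ C.M) → (R C v ↔ ∃ p ∈ C.G, χ C.M v C.P p)

theorem FDef.mono {n : ℕ} {R : Ctx.{u} → Env.{u} n → Prop} (h : FDef R) :
    ∃ χ : ZFSet.{u} → Env.{u} n → ZFSet.{u} → ZFSet.{u} → Prop, Def2 χ ∧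
    (∀ M v P p p', p ⊆ p' → χ M v P p → χ M v P p') ∧
    ∀ C : Ctx.{u}, ∀ v : Env.{u} n, (∀ i, v i ∈ C.M) → (R C v ↔ ∃ p ∈ C.G, χ C.M v C.P p) := by
  obtain ⟨χ, h1, h2⟩ := h.out
  refine ⟨fun M v P p => ∃ q ∈ P, q ⊆ p ∧ χ M v P q, ⟨inferInstance⟩, ?_, ?_⟩
  · rintro M v P p p' h ⟨q, hq, h3, h4⟩
    exact ⟨q, hq, fun z hz => h (h3 hz), h4⟩
  · intro C v hv
    rw [h2 C v hv]
    constructor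
    · rintro ⟨p, hp, h⟩
      exact ⟨p, hp, p, C.sub p hp, fun _ h => h, h⟩
    · rintro ⟨p, hp, q, hq, hqp, h⟩
      exact ⟨q, C.down p hp q hq hqp, h⟩

theorem FDef.congr {n : ℕ} {R S : Ctx.{u} → Env.{u} n → Prop} (h : FDef R)
    (e : ∀ C : Ctx.{u}, ∀ v : Env.{u} n, (∀ i, v i ∈ C.M) → (R C v ↔ S C v)) : FDef S := by
  obtain ⟨χ, h1, h2⟩ := h.out
  exact ⟨χ, h1, fun C v hv => (e C v hv).symm.trans (h2 C v hv)⟩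

section fconn
variable {n : ℕ} (R S : Ctx.{u} → Env.{u} n → Prop)

instance FDef.and [hR : FDef R] [hS : FDef S] : FDef (fun C v => R C v ∧ S C v) := by
  obtain ⟨χ, h1, h2, h3⟩ := hR.mono
  obtain ⟨χ', h1', h2', h3'⟩ := hS.mono
  refine ⟨fun M v P p => χ M v P p ∧ χ' M v P p, ⟨inferInstance⟩, fun C v hv => ?_⟩
  rw [h3 C v hv, h3' C v hv]
  constructor
  · rintro ⟨⟨p, hp, h⟩, q, hq, h'⟩
    obtain ⟨r, hr, hpr, hqr⟩ := C.dir p hp q hq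
    exact ⟨r, hr, h2 _ _ _ _ _ hpr h, h2' _ _ _ _ _ hqr h'⟩
  · rintro ⟨p, hp, h, h'⟩
    exact ⟨⟨p, hp, h⟩, p, hp, h'⟩

instance FDef.not [hR : FDef R] : FDef (fun C v => ¬ R C v) := by
  obtain ⟨χ, h1, h2, h3⟩ := hR.mono
  refine ⟨fun M v P p => ∀ q ∈ P, p ⊆ q → ¬ χ M v P q, ⟨inferInstance⟩, fun C v hv => ?_⟩
  rw [h3 C v hv]
  constructor
  · intro h
    have hD := DefT.app (fun M (w : Env.{u} (n + 1)) => ZFSet.sep (fun p => χ M (fun i => w i.castSucc) (w (Fin.last n)) p ∨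
      ∀ q ∈ w (Fin.last n), p ⊆ q → ¬ χ M (fun i => w i.castSucc) (w (Fin.last n)) q) (w (Fin.last n))) C.hM.toBase (snc v C.P)
      (snc_mem hv C.hP)
    simp only [snc_last, snc_cs] at hD
    obtain ⟨p, hp, hpG⟩ := C.gen _ hD (fun z hz => (ZFSet.mem_sep.1 hz).1) (by
      intro p hp
      by_cases hh : ∃ q ∈ C.P, p ⊆ q ∧ χ C.M v C.P q
      · obtain ⟨q, hq, hpq, hh⟩ := hh
        exact ⟨q, ZFSet.mem_sep.2 ⟨hq, Or.inl hh⟩, hpq⟩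
      · push Not at hh
        exact ⟨p, ZFSet.mem_sep.2 ⟨hp, Or.inr hh⟩, fun _ h => h⟩)
    rcases (ZFSet.mem_sep.1 hp).2 with h4 | h4
    · exact absurd ⟨p, hpG, h4⟩ h
    · exact ⟨p, hpG, h4⟩
  · rintro ⟨p, hp, h⟩ ⟨q, hq, h'⟩
    obtain ⟨r, hr, hpr, hqr⟩ := C.dir p hp q hq
    exact h r (C.sub r hr) hpr (h2 _ _ _ _ _ hqr h')

instance FDef.or [hR : FDef R] [hS : FDef S] : FDef (fun C v => R C v ∨ S C v) := by
  have : FDef (fun C v => ¬ (¬ R C v ∧ ¬ S C v)) := inferInstance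
  exact this.congr fun C v _ => by tauto

instance FDef.imp [hR : FDef R] [hS : FDef S] : FDef (fun C v => R C v → S C v) := by
  have : FDef (fun C v => ¬ (R C v ∧ ¬ S C v)) := inferInstance
  exact this.congr fun C v _ => by tauto

instance FDef.iff [hR : FDef R] [hS : FDef S] : FDef (fun C v => R C v ↔ S C v) := by
  have : FDef (fun C v => (R C v → S C v) ∧ (S C v → R C v)) := inferInstance
  exact this.congr fun C v _ => by tauto

end fconn

instance FDef.ex {n : ℕ} (R : Ctx.{u} → Env.{u} n → ZFSet.{u} → Prop)
    [hR : FDef (fun C (w : Env.{u} (n + 1)) => R C (fun i => w i.castSucc) (w (Fin.last n)))] :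
    FDef (fun C v => ∃ x ∈ C.M, R C v x) := by
  obtain ⟨χ, h1, h2⟩ := hR.out
  refine ⟨fun M v P p => ∃ x ∈ M, χ M (snc v x) P p, ⟨inferInstance⟩, fun C v hv => ?_⟩
  have key : ∀ x ∈ C.M, (R C v x ↔ ∃ p ∈ C.G, χ C.M (snc v x) C.P p) := by
    intro x hx
    rw [← h2 C _ (snc_mem hv hx)]
    simp only [snc_last, snc_cs]
  constructor
  · rintro ⟨x, hx, h⟩
    obtain ⟨p, hp, h⟩ := (key x hx).1 h
    exact ⟨p, hp, x, hx, h⟩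
  · rintro ⟨p, hp, x, hx, h⟩
    exact ⟨x, hx, (key x hx).2 ⟨p, hp, h⟩⟩

instance FDef.all {n : ℕ} (R : Ctx.{u} → Env.{u} n → ZFSet.{u} → Prop)
    [hR : FDef (fun C (w : Env.{u} (n + 1)) => R C (fun i => w i.castSucc) (w (Fin.last n)))] :
    FDef (fun C v => ∀ x ∈ C.M, R C v x) := by
  have : FDef (fun C v => ¬ ∃ x ∈ C.M, ¬ R C v x) := inferInstance
  exact this.congr fun C v _ => by push Not; rfl

instance (priority := 500) FDef.ren {n m : ℕ} (R : Ctx.{u} → Env.{u} n → Prop) (ρ : Fin n → Fin m) [hR : FDef R] :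
    FDef (fun C (w : Env.{u} m) => R C (fun i => w (ρ i))) := by
  obtain ⟨χ, h1, h2⟩ := hR.out
  exact ⟨fun M v P p => χ M (fun i => v (ρ i)) P p, ⟨inferInstance⟩, fun C v hv => h2 C _ (fun i => hv _)⟩

theorem FDef.ofDef {n : ℕ} (Q : ZFSet.{u} → Env.{u} n → Prop) [hQ : Def Q] : FDef (fun C v => Q C.M v) := by
  refine ⟨fun M v _ _ => Q M v, ⟨inferInstance⟩, fun C v _ => ?_⟩
  exact ⟨fun h => ⟨_, C.ne.choose_spec, h⟩, fun ⟨_, _, h⟩ => h⟩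

instance FDef.abs {n : ℕ} (Q : Env.{u} n → Prop) [hQ : Def (fun _ v => Q v)] : FDef (fun _ v => Q v) :=
  FDef.ofDef (fun _ v => Q v)

/-- `z ∈ B^G` -/
def GM (C : Ctx.{u}) (z B : ZFSet.{u}) : Prop := ∃ p ∈ C.G, ZFSet.pair z p ∈ B

instance FDef.gm {n : ℕ} (f g : Env.{u} n → ZFSet.{u}) [DefT (fun _ v => f v)] [DefT (fun _ v => g v)] :
    FDef (fun C v => GM C (f v) (g v)) :=
  ⟨fun _ v _ p => ZFSet.pair (f v) p ∈ g v, ⟨inferInstance⟩, fun _ _ _ => Iff.rfl⟩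

theorem FDef.comp {n : ℕ} (R : Ctx.{u} → Env.{u} n → ZFSet.{u} → Prop)
    [hR : FDef (fun C (w : Env.{u} (n + 1)) => R C (fun i => w i.castSucc) (w (Fin.last n)))]
    (C : Ctx.{u}) (v : Env.{u} n) (hv : ∀ i, v i ∈ C.M) (D : ZFSet.{u}) (hD : D ∈ C.M) :
    ∃ d ∈ C.M, d ⊆ D.prod C.P ∧ ∀ x, GM C x d ↔ x ∈ D ∧ R C v x := by
  obtain ⟨χ, h1, h2⟩ := hR.out
  have h := DefT.app (fun M (w : Env.{u} (n + 2)) => ZFSet.sep (fun z => ∃ x ∈ M, ∃ p ∈ M, z = ZFSet.pair x p ∧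
    χ M (snc (fun i => w i.castSucc.castSucc) x) (w (Fin.last n).castSucc) p) (ZFSet.prod (w (Fin.last (n+1))) (w (Fin.last n).castSucc)))
    C.hM.toBase (snc (snc v C.P) D) (snc_mem (snc_mem hv C.hP) hD)
  simp only [snc_last, snc_cs] at h
  refine ⟨_, h, fun z hz => (ZFSet.mem_sep.1 hz).1, fun x => ?_⟩
  have T : Tr C.M := C.hM.trans
  have key : ∀ x ∈ C.M, (R C v x ↔ ∃ p ∈ C.G, χ C.M (snc v x) C.P p) := by
    intro x hx
    rw [← h2 C _ (snc_mem hv hx)]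
    simp only [snc_last, snc_cs]
  unfold GM
  constructor
  · rintro ⟨p, hp, hh⟩
    rw [ZFSet.mem_sep, ZFSet.pair_mem_prod] at hh
    obtain ⟨⟨h3, h4⟩, x', hx', p', hp', e, h5⟩ := hh
    obtain ⟨rfl, rfl⟩ := ZFSet.pair_inj.1 e
    exact ⟨h3, (key _ hx').2 ⟨_, hp, h5⟩⟩
  · rintro ⟨hx, hh⟩
    have hxM := T _ hD _ hx
    obtain ⟨p, hp, h5⟩ := (key _ hxM).1 hh
    refine ⟨p, hp, ?_⟩
    rw [ZFSet.mem_sep, ZFSet.pair_mem_prod]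
    exact ⟨⟨hx, C.sub p hp⟩, x, hxM, p, T _ C.hP _ (C.sub p hp), rfl, h5⟩

/-- relation used for collection -/
def cRel {n : ℕ} (χ : ZFSet.{u} → Env.{u} (n + 1 + 1) → ZFSet.{u} → ZFSet.{u} → Prop)
    (M : ZFSet.{u}) (v : Env.{u} n) (P : ZFSet.{u}) (z s : ZFSet.{u}) : Prop :=
  ∃ x ∈ M, ∃ p ∈ M, z = ZFSet.pair x p ∧ (∃ y ∈ s, χ M (snc (snc v x) y) P p) ∧ (∃ a ∈ M, VRel M a s) ∧
    ∀ s' ∈ M, (∃ a ∈ M, VRel M a s') → (∃ y ∈ s', χ M (snc (snc v x) y) P p) → s ⊆ s'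

theorem FDef.coll {n : ℕ} (R : Ctx.{u} → Env.{u} (n + 1 + 1) → Prop) [hR : FDef R] :
    ∃ φ : BF (n + 1 + 2), ∀ C : Ctx.{u}, Sat C.M (replAx φ : BF 0) default → ∀ v : Env.{u} n, (∀ i, v i ∈ C.M) →
      ∀ A ∈ C.M, ∃ S ∈ C.M, ∀ x ∈ A, (∃ y ∈ C.M, R C (snc (snc v x) y)) → ∃ y ∈ S, R C (snc (snc v x) y) := by
  obtain ⟨χ, h1, h2⟩ := hR.out
  have hd : Def (fun M (w : Env.{u} (n + 1 + 2)) => cRel χ M (fun i => w i.castSucc.castSucc.castSucc)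
     (w (Fin.last n).castSucc.castSucc) (w (Fin.last (n + 1)).castSucc) (w (Fin.last (n + 2)))) := by
    unfold cRel; infer_instance
  obtain ⟨φ, hφ⟩ := @Def.repl (n + 1) (fun M w x y => cRel χ M (fun i => w i.castSucc) (w (Fin.last n)) x y) hd
  refine ⟨φ, fun C hC v hv A hA => ?_⟩
  have hM := C.hM.toBase
  have T : Tr C.M := hM.trans
  have h3 := (hφ C.M hM).1 hC (snc v C.P) (snc_mem hv C.hP) (A.prod C.P)
    (DefT.app (fun M (v : Env.{u} 2) => ZFSet.prod (v 0) (v 1)) hM ![A, C.P] (all2 hA C.hP)) (by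
      rintro z - y hy y' hy' ⟨x, _, p, _, rfl, h4, h5, h6⟩ ⟨x', _, p', _, e, h4', h5', h6'⟩
      obtain ⟨rfl, rfl⟩ := ZFSet.pair_inj.1 e
      exact ZFSet.ext fun z => ⟨fun h => h6 _ hy' h5' h4' h, fun h => h6' _ hy h5 h4 h⟩)
  simp only [snc_last, snc_cs] at h3
  obtain ⟨B, hB, hBy⟩ := h3
  refine ⟨_, hM.sUnion B hB, fun x hx => ?_⟩
  rintro ⟨y, hy, hxy⟩
  have hxM := T _ hA _ hx
  rw [h2 C _ (snc_mem (snc_mem hv hxM) hy)] at hxy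
  obtain ⟨p, hp, hχ⟩ := hxy
  have hpP := C.sub p hp
  have hpM := T _ C.hP _ hpP
  -- least level
  let W : Set Ordinal := {o | ∃ a ∈ C.M, ZFSet.rank a = o ∧ ∃ y ∈ Vr C.M a, χ C.M (snc (snc v x) y) C.P p}
  have hW : W.Nonempty := ⟨_, {y}, hM.sing hy, rfl, y, mem_Vr.2 ⟨hy, ZFSet.rank_lt_of_mem (by simp)⟩, hχ⟩
  obtain ⟨a, ha, hra, y', hy', hχ'⟩ := csInf_mem hW
  have hVa := C.hM.vr ha
  have hin : Vr C.M a ∈ B := by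
    rw [hBy _ hVa]
    refine ⟨ZFSet.pair x p, ZFSet.pair_mem_prod.2 ⟨hx, hpP⟩, x, hxM, p, hpM, rfl, ⟨y', hy', hχ'⟩,
      ⟨a, ha, (C.hM.vrel ha).2 rfl⟩, ?_⟩
    rintro s' hs' ⟨b, hb, hbs⟩ h7 z hz
    rw [(C.hM.vrel hb).1 hbs] at h7 ⊢
    rw [mem_Vr] at hz ⊢
    refine ⟨hz.1, lt_of_lt_of_le hz.2 ?_⟩
    rw [hra]
    exact csInf_le' ⟨b, hb, rfl, h7⟩
  have hy'M := (mem_Vr.1 hy').1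
  exact ⟨y', ZFSet.mem_sUnion.2 ⟨_, hin, hy'⟩, (h2 C _ (snc_mem (snc_mem hv hxM) hy'M)).2 ⟨p, hp, hχ'⟩⟩

end

section
/-! ### Names -/

def Ch (C : Ctx.{u}) (x y : ZFSet.{u}) : Prop :=
  GM C x y ∨ ∃ a ∈ C.M, ∃ b ∈ a, y = ZFSet.pair ∅ a ∧ x = ZFSet.pair ∅ b

instance FDef.ch {n : ℕ} (f g : Env.{u} n → ZFSet.{u}) [DefT (fun _ v => f v)] [DefT (fun _ v => g v)] :
    FDef (fun C v => Ch C (f v) (g v)) := by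
  have := FDef.ofDef (n := n) (fun M v => ∃ a ∈ M, ∃ b ∈ a, g v = ZFSet.pair ∅ a ∧ f v = ZFSet.pair ∅ b)
  unfold Ch; infer_instance

theorem rank_fst (x y : ZFSet.{u}) : ZFSet.rank x < ZFSet.rank (ZFSet.pair x y) :=
  (ZFSet.rank_lt_of_mem (by simp : x ∈ ({x} : ZFSet))).trans (ZFSet.rank_lt_of_mem (by simp [ZFSet.pair]))

theorem rank_snd (x y : ZFSet.{u}) : ZFSet.rank y < ZFSet.rank (ZFSet.pair x y) :=
  (ZFSet.rank_lt_of_mem (by simp : y ∈ ({x, y} : ZFSet))).trans (ZFSet.rank_lt_of_mem (by simp [ZFSet.pair]))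

theorem not_gm_const (C : Ctx.{u}) (x a : ZFSet.{u}) : ¬ GM C x (ZFSet.pair ∅ a) := by
  rintro ⟨p, _, h⟩
  have : ∅ ∈ ZFSet.pair x p := by
    rcases ZFSet.mem_pair.1 h with h | h <;> rw [h] <;> simp
  rcases ZFSet.mem_pair.1 this with h | h
  · exact ZFSet.notMem_empty x (h ▸ ZFSet.mem_singleton.2 rfl)
  · exact ZFSet.notMem_empty x (h ▸ ZFSet.mem_pair.2 (Or.inl rfl))

theorem rank_ch {C : Ctx.{u}} {x y : ZFSet.{u}} (h : Ch C x y) : ZFSet.rank x < ZFSet.rank y := by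
  rcases h with ⟨p, _, h⟩ | ⟨a, ha, b, hb, rfl, rfl⟩
  · exact (rank_fst x p).trans (ZFSet.rank_lt_of_mem h)
  · have := ZFSet.rank_lt_of_mem hb
    simp only [ZFSet.pair, ZFSet.rank_insert, ZFSet.rank_singleton, ZFSet.rank_empty]
    have h0 : 0 < ZFSet.rank a := lt_of_le_of_lt bot_le this
    simp only [max_lt_iff, lt_max_iff, Order.succ_lt_succ_iff]
    simp [this, h0]

theorem ch_mem {C : Ctx.{u}} {x y : ZFSet.{u}} (hy : y ∈ C.M) (h : Ch C x y) : x ∈ C.M := by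
  have hM := C.hM.toBase
  rcases h with ⟨p, _, h⟩ | ⟨a, ha, b, hb, rfl, rfl⟩
  · exact (hM.of_pair (hM.trans _ hy _ h)).1
  · exact hM.pair hM.empty (hM.trans _ ha _ hb)

noncomputable def val (C : Ctx.{u}) (y : ZFSet.{u}) : ZFSet.{u} :=
  haveI : Small.{u} {x : ZFSet.{u} | x ∈ C.M} := inferInstanceAs (Small.{u} {x // x ∈ C.M})
  haveI : Small.{u} {x : ZFSet.{u} // x ∈ C.M ∧ ZFSet.rank x < ZFSet.rank y ∧ Ch C x y} :=
    small_subset (t := {x | x ∈ C.M ∧ ZFSet.rank x < ZFSet.rank y ∧ Ch C x y}) (s := {x | x ∈ C.M}) (fun _ h => h.1)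
  ZFSet.range (fun x : {x : ZFSet.{u} // x ∈ C.M ∧ ZFSet.rank x < ZFSet.rank y ∧ Ch C x y} => val C x.1)
termination_by ZFSet.rank y
decreasing_by exact x.2.2.1

theorem mem_val {C : Ctx.{u}} {z y : ZFSet.{u}} (_ : y ∈ C.M) :
    z ∈ val C y ↔ ∃ x ∈ C.M, Ch C x y ∧ val C x = z := by
  rw [val]
  simp only [ZFSet.mem_range, Subtype.exists, exists_prop]
  constructor
  · rintro ⟨x, ⟨h1, h2, h3⟩, h4⟩
    exact ⟨x, h1, h3, h4⟩
  · rintro ⟨x, h1, h3, h4⟩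
    exact ⟨x, ⟨h1, rank_ch h3, h3⟩, h4⟩

theorem rank_val {C : Ctx.{u}} {y : ZFSet.{u}} : y ∈ C.M → ZFSet.rank (val C y) ≤ ZFSet.rank y := by
  induction' h : ZFSet.rank y using WellFoundedLT.induction with o ih generalizing y
  intro hy
  rw [ZFSet.rank_le_iff]
  intro z hz
  obtain ⟨x, hx, hc, rfl⟩ := (mem_val hy).1 hz
  have := rank_ch hc
  rw [h] at this
  exact (ih _ this rfl hx).trans_lt this

theorem val_const {C : Ctx.{u}} {a : ZFSet.{u}} : a ∈ C.M → val C (ZFSet.pair ∅ a) = a := by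
  have hM := C.hM.toBase
  induction a using ZFSet.inductionOn with
  | _ a ih =>
  intro ha
  ext z
  rw [mem_val (hM.pair hM.empty ha)]
  constructor
  · rintro ⟨x, hx, hc | ⟨a', ha', b, hb, e, rfl⟩, rfl⟩
    · exact absurd hc (not_gm_const _ _ _)
    · obtain ⟨_, rfl⟩ := ZFSet.pair_inj.1 e
      rw [ih b hb (hM.trans _ ha _ hb)]
      exact hb
  · intro hz
    have hzM := hM.trans _ ha _ hz
    exact ⟨_, hM.pair hM.empty hzM, Or.inr ⟨a, ha, z, hz, rfl, rfl⟩, ih z hz hzM⟩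

noncomputable def NN (C : Ctx.{u}) : ZFSet.{u} := ZFSet.range (fun x : {x // x ∈ C.M} => val C x.1)

theorem mem_NN {C : Ctx.{u}} {z : ZFSet.{u}} : z ∈ NN C ↔ ∃ x ∈ C.M, val C x = z := by
  simp [NN]

theorem val_mem {C : Ctx.{u}} {x : ZFSet.{u}} (hx : x ∈ C.M) : val C x ∈ NN C := mem_NN.2 ⟨x, hx, rfl⟩

theorem sub_NN (C : Ctx.{u}) {a : ZFSet.{u}} (ha : a ∈ C.M) : a ∈ NN C :=
  mem_NN.2 ⟨_, C.hM.toBase.pair C.hM.empty ha, val_const ha⟩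

theorem trans_NN (C : Ctx.{u}) : Tr (NN C) := by
  intro x hx y hy
  obtain ⟨x, hxM, rfl⟩ := mem_NN.1 hx
  obtain ⟨z, hz, _, rfl⟩ := (mem_val hxM).1 hy
  exact val_mem hz

/-- bisimilarity, definable -/
def Bis (C : Ctx.{u}) (x y : ZFSet.{u}) : Prop :=
  ∃ B ∈ C.M, GM C (ZFSet.pair x y) B ∧ ∀ a ∈ C.M, ∀ b ∈ C.M, GM C (ZFSet.pair a b) B →
    (∀ a' ∈ C.M, Ch C a' a → ∃ b' ∈ C.M, Ch C b' b ∧ GM C (ZFSet.pair a' b') B) ∧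
    (∀ b' ∈ C.M, Ch C b' b → ∃ a' ∈ C.M, Ch C a' a ∧ GM C (ZFSet.pair a' b') B)

instance FDef.bis {n : ℕ} (f g : Env.{u} n → ZFSet.{u}) [DefT (fun _ v => f v)] [DefT (fun _ v => g v)] :
    FDef (fun C v => Bis C (f v) (g v)) := by
  unfold Bis; infer_instance

theorem bis_iff {C : Ctx.{u}} {x y : ZFSet.{u}} (hx : x ∈ C.M) (hy : y ∈ C.M) : Bis C x y ↔ val C x = val C y := by
  have hM := C.hM.toBase
  constructor
  · rintro ⟨B, hB, h1, h2⟩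
    induction' h : ZFSet.rank x using WellFoundedLT.induction with o ih generalizing x y
    obtain ⟨h3, h4⟩ := h2 x hx y hy h1
    ext z
    rw [mem_val hx, mem_val hy]
    constructor
    · rintro ⟨a, ha, hc, rfl⟩
      obtain ⟨b, hb, hc', hB'⟩ := h3 a ha hc
      exact ⟨b, hb, hc', (ih _ (h ▸ rank_ch hc) ha hb hB' rfl).symm⟩
    · rintro ⟨b, hb, hc, rfl⟩
      obtain ⟨a, ha, hc', hB'⟩ := h4 b hb hc
      exact ⟨a, ha, hc', ih _ (h ▸ rank_ch hc') ha hb hB' rfl⟩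
  · intro hv
    induction' h : ZFSet.rank x using WellFoundedLT.induction with o ih generalizing x y
    have hT := C.hM.vr (hM.pair hx hy)
    set T := Vr C.M (ZFSet.pair x y) with hTe
    have hTm : ∀ z, z ∈ T ↔ z ∈ C.M ∧ ZFSet.rank z < ZFSet.rank (ZFSet.pair x y) := fun z => mem_Vr
    have hTc : ∀ a b, b ∈ T → Ch C a b → a ∈ T := by
      intro a b hb hc
      rw [hTm] at hb ⊢
      exact ⟨ch_mem hb.1 hc, (rank_ch hc).trans hb.2⟩
    have hxT : x ∈ T := (hTm x).2 ⟨hx, rank_fst _ _⟩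
    have hyT : y ∈ T := (hTm y).2 ⟨hy, rank_snd _ _⟩
    obtain ⟨B, hB, -, hBG⟩ := FDef.comp (n := 2) (fun C v z => z = ZFSet.pair (v 0) (v 1) ∨
      ∃ a ∈ C.M, ∃ b ∈ C.M, z = ZFSet.pair a b ∧ Bis C a b) C ![x, y] (all2 hx hy) (T.prod T)
      (DefT.app (fun M (v : Env.{u} 1) => ZFSet.prod (v 0) (v 0)) hM ![T] (all1 hT))
    simp only [Matrix.cons_val_zero, Matrix.cons_val_one] at hBG
    have hBG' : ∀ a b, a ∈ C.M → b ∈ C.M → (GM C (ZFSet.pair a b) B ↔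
        (a ∈ T ∧ b ∈ T) ∧ ((a = x ∧ b = y) ∨ Bis C a b)) := by
      intro a b ha hb
      rw [hBG, ZFSet.pair_mem_prod, ZFSet.pair_inj]
      refine and_congr_right fun _ => or_congr Iff.rfl ?_
      constructor
      · rintro ⟨a', _, b', _, e, h⟩
        obtain ⟨rfl, rfl⟩ := ZFSet.pair_inj.1 e
        exact h
      · intro h
        exact ⟨a, ha, b, hb, rfl, h⟩
    refine ⟨B, hB, (hBG' x y hx hy).2 ⟨⟨hxT, hyT⟩, Or.inl ⟨rfl, rfl⟩⟩, ?_⟩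
    intro a ha b hb hab
    rw [hBG' a b ha hb] at hab
    obtain ⟨⟨haT, hbT⟩, ⟨rfl, rfl⟩ | ⟨B', hB', hab', hb2⟩⟩ := hab
    · constructor
      · intro a' ha' hc
        obtain ⟨b', hb', hc', e⟩ := (mem_val hb).1 (hv ▸ (mem_val ha).2 ⟨a', ha', hc, rfl⟩)
        exact ⟨b', hb', hc', (hBG' _ _ ha' hb').2 ⟨⟨hTc _ _ haT hc, hTc _ _ hbT hc'⟩,
          Or.inr (ih _ (h ▸ rank_ch hc) ha' hb' e.symm rfl)⟩⟩
      · intro b' hb' hc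
        obtain ⟨a', ha', hc', e⟩ := (mem_val ha).1 (hv ▸ (mem_val hb).2 ⟨b', hb', hc, rfl⟩)
        exact ⟨a', ha', hc', (hBG' _ _ ha' hb').2 ⟨⟨hTc _ _ haT hc', hTc _ _ hbT hc⟩,
          Or.inr (ih _ (h ▸ rank_ch hc') ha' hb' e rfl)⟩⟩
    · obtain ⟨h3, h4⟩ := hb2 a ha b hb hab'
      constructor
      · intro a' ha' hc
        obtain ⟨b', hb', hc', e⟩ := h3 a' ha' hc
        exact ⟨b', hb', hc', (hBG' _ _ ha' hb').2 ⟨⟨hTc _ _ haT hc, hTc _ _ hbT hc'⟩,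
          Or.inr ⟨B', hB', e, hb2⟩⟩⟩
      · intro b' hb' hc
        obtain ⟨a', ha', hc', e⟩ := h4 b' hb' hc
        exact ⟨a', ha', hc', (hBG' _ _ ha' hb').2 ⟨⟨hTc _ _ haT hc', hTc _ _ hbT hc⟩,
          Or.inr ⟨B', hB', e, hb2⟩⟩⟩

instance FDef.veq {n : ℕ} (f g : Env.{u} n → ZFSet.{u}) [hf : DefT (fun _ v => f v)] [hg : DefT (fun _ v => g v)] :
    FDef (fun C v => val C (f v) = val C (g v)) :=
  (FDef.bis f g).congr fun C v hv => bis_iff (hf.mem C.M C.hM.toBase v hv) (hg.mem C.M C.hM.toBase v hv)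

instance FDef.vmem {n : ℕ} (f g : Env.{u} n → ZFSet.{u}) [hf : DefT (fun _ v => f v)] [hg : DefT (fun _ v => g v)] :
    FDef (fun C v => val C (f v) ∈ val C (g v)) := by
  have : FDef (fun C (v : Env.{u} n) => ∃ x ∈ C.M, Ch C x (g v) ∧ val C x = val C (f v)) := inferInstance
  exact this.congr fun C v hv => (mem_val (hg.mem C.M C.hM.toBase v hv)).symm

theorem FDef.sat : ∀ {n : ℕ} (φ : BF n), FDef (fun C (v : Env.{u} n) => Sat (NN C) φ (fun i => val C (v i)))
  | _, .falsum => (inferInstance : FDef (fun _ _ => False))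
  | _, .equal t s => by
      rcases t with (e | i) | ⟨f, _⟩
      · exact e.elim
      · rcases s with (e | j) | ⟨f, _⟩
        · exact e.elim
        · exact FDef.veq (fun v => v i) (fun v => v j)
        · exact Empty.elim f
      · exact Empty.elim f
  | n, .rel R ts => by
      cases R
      have h : ∀ t : SetLang.Term (Empty ⊕ Fin n), ∃ i, t = .var (.inr i) := by
        rintro ((e | i) | ⟨f, _⟩)
        · exact e.elim
        · exact ⟨i, rfl⟩
        · exact Empty.elim f
      obtain ⟨i, hi⟩ := h (ts 0)
      obtain ⟨j, hj⟩ := h (ts 1)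
      simp only [Sat, relv]
      rw [hi, hj]
      exact FDef.vmem (fun v => v i) (fun v => v j)
  | _, .imp φ ψ => by
      have := FDef.sat φ
      have := FDef.sat ψ
      simp only [Sat]
      infer_instance
  | n, .all φ => by
      have := FDef.sat φ
      have h : FDef (fun C (v : Env.{u} n) => ∀ x ∈ C.M, Sat (NN C) φ (snc (fun i => val C (v i)) (val C x))) := by
        refine @FDef.all n (fun C v x => Sat (NN C) φ (snc (fun i => val C (v i)) (val C x))) ?_
        refine this.congr fun C v hv => ?_
        congr! 1
        funext i
        refine Fin.lastCases ?_ (fun j => ?_) i <;> simp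
      refine h.congr fun C v hv => ?_
      simp only [Sat]
      constructor
      · intro h x hx
        obtain ⟨y, hy, rfl⟩ := mem_NN.1 hx
        exact h y hy
      · intro h x hx
        exact h _ (val_mem hx)

/-- comprehension for names -/
theorem FDef.name {n : ℕ} (R : Ctx.{u} → Env.{u} n → ZFSet.{u} → Prop)
    [hR : FDef (fun C (w : Env.{u} (n + 1)) => R C (fun i => w i.castSucc) (w (Fin.last n)))]
    (C : Ctx.{u}) (v : Env.{u} n) (hv : ∀ i, v i ∈ C.M) (D : ZFSet.{u}) (hD : D ∈ C.M) :
    ∃ d ∈ C.M, d ⊆ D.prod C.P ∧ ∀ z, z ∈ val C d ↔ ∃ x ∈ D, R C v x ∧ val C x = z := by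
  have hM := C.hM.toBase
  obtain ⟨d, hd, hs, h⟩ := FDef.comp R C v hv D hD
  refine ⟨d, hd, hs, fun z => ?_⟩
  have hch : ∀ x, Ch C x d ↔ GM C x d := by
    intro x
    refine ⟨?_, Or.inl⟩
    rintro (h | ⟨a, ha, b, hb, rfl, rfl⟩)
    · exact h
    · have : ({∅} : ZFSet) ∈ D.prod C.P := hs (by simp [ZFSet.pair])
      obtain ⟨q, _, r, _, e⟩ := ZFSet.mem_prod.1 this
      have : ({q} : ZFSet) ∈ ({∅} : ZFSet) := by rw [e]; simp [ZFSet.pair]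
      rw [ZFSet.mem_singleton] at this
      exact absurd (ZFSet.mem_singleton.2 rfl : q ∈ ({q} : ZFSet)) (this ▸ ZFSet.notMem_empty q)
  rw [mem_val hd]
  constructor
  · rintro ⟨x, hx, hc, rfl⟩
    have := (h x).1 ((hch x).1 hc)
    exact ⟨x, this.1, this.2, rfl⟩
  · rintro ⟨x, hx, hr, rfl⟩
    exact ⟨x, hM.trans _ hD _ hx, (hch x).2 ((h x).2 ⟨hx, hr⟩), rfl⟩

end

section
/-! ### The extension satisfies the axioms -/

instance FDef.satS {n m : ℕ} (φ : BF (n + 1)) (ρ : Fin n → Fin m) (i : Fin m) :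
    FDef (fun C (v : Env.{u} m) => Sat (NN C) φ (snc (fun j => val C (v (ρ j))) (val C (v i)))) := by
  have := @FDef.ren _ m _ (Fin.snoc (α := fun _ => Fin m) ρ i) (FDef.sat.{u} φ)
  refine this.congr fun C v hv => ?_
  congr! 1
  funext i
  refine Fin.lastCases ?_ (fun j => ?_) i <;> simp

instance FDef.satSS {n m : ℕ} (φ : BF (n + 2)) (ρ : Fin n → Fin m) (i k : Fin m) :
    FDef (fun C (v : Env.{u} m) => Sat (NN C) φ (snc (snc (fun j => val C (v (ρ j))) (val C (v i))) (val C (v k)))) := by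
  have := @FDef.ren _ m _ (Fin.snoc (α := fun _ => Fin m) (Fin.snoc (α := fun _ => Fin m) ρ i) k) (FDef.sat.{u} φ)
  refine this.congr fun C v hv => ?_
  congr! 1
  funext i
  refine Fin.lastCases ?_ (fun j => Fin.lastCases ?_ (fun j => ?_) j) i <;> simp

theorem names {n : ℕ} {C : Ctx.{u}} {v : Env.{u} n} (hv : ∀ i, v i ∈ NN C) :
    ∃ w : Env.{u} n, (∀ i, w i ∈ C.M) ∧ v = fun i => val C (w i) := by
  choose w h1 h2 using fun i => mem_NN.1 (hv i)
  exact ⟨w, h1, funext fun i => (h2 i).symm⟩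

theorem ch_vr {C : Ctx.{u}} {x y : ZFSet.{u}} (hy : y ∈ C.M) (h : Ch C x y) : x ∈ Vr C.M y :=
  mem_Vr.2 ⟨ch_mem hy h, rank_ch h⟩

theorem base_NN (C : Ctx.{u}) : Base (NN C) := by
  have hM := C.hM.toBase
  have T := trans_NN C
  refine ⟨T, sub_NN C hM.empty, ?_, ?_, ?_, ?_, ?_⟩
  · intro x hx y hy
    obtain ⟨a, ha, rfl⟩ := mem_NN.1 hx
    obtain ⟨b, hb, rfl⟩ := mem_NN.1 hy
    obtain ⟨d, hd, -, h⟩ := FDef.name (n := 0) (fun C v z => True) C default (env0 _) _ (hM.pr a ha b hb)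
    refine mem_NN.2 ⟨d, hd, ?_⟩
    ext z
    simp only [h, ZFSet.mem_pair, true_and, exists_eq_or_imp, exists_eq_left]
    rw [eq_comm, eq_comm (a := val C b)]
  · intro x hx
    obtain ⟨a, ha, rfl⟩ := mem_NN.1 hx
    obtain ⟨d, hd, -, h⟩ := FDef.name (n := 1) (fun C v z => ∃ y ∈ C.M, Ch C y (v 0) ∧ Ch C z y) C ![a] (all1 ha) _ (C.hM.vr ha)
    simp only [Matrix.cons_val_zero] at h
    refine mem_NN.2 ⟨d, hd, ?_⟩
    ext z
    rw [h, ZFSet.mem_sUnion]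
    constructor
    · rintro ⟨z, hz, ⟨y, hy, h1, h2⟩, rfl⟩
      exact ⟨_, (mem_val ha).2 ⟨y, hy, h1, rfl⟩, (mem_val hy).2 ⟨z, ch_mem hy h2, h2, rfl⟩⟩
    · rintro ⟨y, h1, h2⟩
      obtain ⟨y, hy, h3, rfl⟩ := (mem_val ha).1 h1
      obtain ⟨z, hz, h4, rfl⟩ := (mem_val hy).1 h2
      exact ⟨z, mem_Vr.2 ⟨hz, (rank_ch h4).trans (rank_ch h3)⟩, ⟨y, hy, h3, h4⟩, rfl⟩
  · intro x hx
    obtain ⟨a, ha, rfl⟩ := mem_NN.1 hx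
    have hD := DefT.app (fun M (v : Env.{u} 2) => Pw M (ZFSet.prod (v 0) (v 1))) hM ![_, C.P] (all2 (C.hM.vr ha) C.hP)
    simp only [Matrix.cons_val_zero, Matrix.cons_val_one] at hD
    obtain ⟨d, hd, -, h⟩ := FDef.name (n := 1) (fun C v z => ∀ w ∈ C.M, val C w ∈ val C z → val C w ∈ val C (v 0))
      C ![a] (all1 ha) _ hD
    simp only [Matrix.cons_val_zero] at h
    refine mem_NN.2 ⟨d, hd, ?_⟩
    ext z
    rw [h, ZFSet.mem_sep, ZFSet.mem_powerset]
    constructor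
    · rintro ⟨z, hz, h1, rfl⟩
      have hzM := (mem_Pw.1 hz).1
      refine ⟨fun y hy => ?_, val_mem hzM⟩
      obtain ⟨w, hw, _, rfl⟩ := (mem_val hzM).1 hy
      exact h1 w hw hy
    · rintro ⟨h1, h2⟩
      obtain ⟨c, hc, rfl⟩ := mem_NN.1 h2
      obtain ⟨e, he, hs, h3⟩ := FDef.name (n := 2) (fun C v z => Ch C z (v 0) ∧ val C z ∈ val C (v 1)) C ![a, c] (all2 ha hc) _ (C.hM.vr ha)
      simp only [Matrix.cons_val_zero, Matrix.cons_val_one] at h3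
      have hec : val C e = val C c := by
        ext y
        rw [h3]
        constructor
        · rintro ⟨x, hx, ⟨_, h⟩, rfl⟩; exact h
        · intro hy
          obtain ⟨x, hx, hc, rfl⟩ := (mem_val ha).1 (h1 hy)
          exact ⟨x, ch_vr ha hc, ⟨hc, hy⟩, rfl⟩
      exact ⟨e, mem_Pw.2 ⟨he, hs⟩, fun w _ hw => h1 (hec ▸ hw), hec⟩
  · obtain ⟨I, hI, h⟩ := hM.inf
    exact ⟨I, sub_NN C hI, h⟩
  · intro n φ v hv A hA
    obtain ⟨w, hw, rfl⟩ := names hv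
    obtain ⟨a, ha, rfl⟩ := mem_NN.1 hA
    obtain ⟨d, hd, -, h⟩ := FDef.name (n := n + 1) (fun C v z => Ch C z (v (Fin.last n)) ∧
      Sat (NN C) φ (snc (fun i => val C (v i.castSucc)) (val C z))) C (snc w a) (snc_mem hw ha) _ (C.hM.vr ha)
    simp only [snc_last, snc_cs] at h
    refine mem_NN.2 ⟨d, hd, ?_⟩
    ext z
    rw [h, ZFSet.mem_sep]
    constructor
    · rintro ⟨z, hz, ⟨hc, hs⟩, rfl⟩
      exact ⟨(mem_val ha).2 ⟨z, ch_mem ha hc, hc, rfl⟩, hs⟩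
    · rintro ⟨hz, hs⟩
      obtain ⟨z, hzM, hc, rfl⟩ := (mem_val ha).1 hz
      exact ⟨z, ch_vr ha hc, ⟨hc, hs⟩, rfl⟩

theorem FDef.nn {n : ℕ} (Q : ZFSet.{u} → Env.{u} n → Prop) [hQ : Def Q] :
    FDef (fun C (v : Env.{u} n) => Q (NN C) (fun i => val C (v i))) := by
  obtain ⟨φ, hφ⟩ := hQ.out
  exact (FDef.sat φ).congr fun C v hv => hφ (NN C) (base_NN C) _ (fun i => val_mem (hv i))

/-- Replacement in the extension -/
theorem exists_repl {n : ℕ} (φ : BF (n + 2)) : ∃ ψ : BF (n + 1 + 2), ∀ C : Ctx.{u},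
    Sat C.M (replAx ψ : BF 0) default → Sat (NN C) (replAx φ : BF 0) default := by
  have := FDef.sat.{u} φ
  obtain ⟨ψ, hψ⟩ := FDef.coll (n := n) (fun C v => Sat (NN C) φ (fun i => val C (v i)))
  refine ⟨ψ, fun C hC => ?_⟩
  rw [sat_replAx]
  intro v hv A hA hf
  obtain ⟨w, hw, rfl⟩ := names hv
  obtain ⟨a, ha, rfl⟩ := mem_NN.1 hA
  obtain ⟨S, hS, hh⟩ := hψ C hC w hw (Vr C.M a) (C.hM.vr ha)
  have e : ∀ x y, (fun i => val C (snc (snc w x) y i)) = snc (snc (fun i => val C (w i)) (val C x)) (val C y) := by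
    intro x y
    funext i
    refine Fin.lastCases ?_ (fun j => Fin.lastCases ?_ (fun j => ?_) j) i <;> simp
  simp only [e] at hh
  obtain ⟨d, hd, -, h⟩ := FDef.name (n := n + 1) (fun C v z => ∃ x ∈ C.M, Ch C x (v (Fin.last n)) ∧
      Sat (NN C) φ (snc (snc (fun i => val C (v i.castSucc)) (val C x)) (val C z))) C (snc w a) (snc_mem hw ha) _ hS
  simp only [snc_last, snc_cs] at h
  refine ⟨_, val_mem hd, fun y hy => ?_⟩
  rw [h]
  constructor
  · rintro ⟨y, hy, ⟨x, hx, hc, hs⟩, rfl⟩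
    exact ⟨_, val_mem hx, (mem_val ha).2 ⟨x, hx, hc, rfl⟩, hs⟩
  · rintro ⟨x, hx, hxa, hs⟩
    obtain ⟨x, hxM, hc, rfl⟩ := (mem_val ha).1 hxa
    obtain ⟨y, hyM, rfl⟩ := mem_NN.1 hy
    obtain ⟨y', hy', hs'⟩ := hh x (ch_vr ha hc) ⟨y, hyM, hs⟩
    refine ⟨y', hy', ⟨x, hxM, hc, hs'⟩, ?_⟩
    exact hf _ hx _ (val_mem (C.hM.trans _ hS _ hy')) _ hy ⟨hxa, hs', hs⟩

/-- Ordinals -/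
theorem isOrd_iff {x : ZFSet.{u}} : IsOrd x ↔ x.IsOrdinal := by
  unfold IsOrd
  rw [ZFSet.isOrdinal_iff_forall_mem_isTransitive]

theorem ord_NN (C : Ctx.{u}) {α : ZFSet.{u}} (hα : IsOrd α) : α ∈ NN C → α ∈ C.M := by
  have hM := C.hM.toBase
  intro h
  obtain ⟨x, hx, rfl⟩ := mem_NN.1 h
  have hO := DefT.app (fun M (v : Env.{u} 1) => ZFSet.sep (fun z => IsOrd z) (v 0)) hM ![_] (all1 (C.hM.vr hx))
  simp only [Matrix.cons_val_zero] at hO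
  set O := ZFSet.sep (fun z => IsOrd z) (Vr C.M x) with hOe
  have hOm : ∀ z, z ∈ O ↔ (z ∈ C.M ∧ ZFSet.rank z < ZFSet.rank x) ∧ IsOrd z := by
    intro z; rw [hOe, ZFSet.mem_sep, mem_Vr]
  have hOo : O.IsOrdinal := by
    rw [← isOrd_iff]
    refine ⟨fun y hy z hz => ?_, fun y hy => ((hOm y).1 hy).2.1⟩
    rw [hOm] at hy ⊢
    exact ⟨⟨hM.trans _ hy.1.1 _ hz, (ZFSet.rank_lt_of_mem hz).trans hy.1.2⟩, isOrd_iff.2 ((isOrd_iff.1 hy.2).mem hz)⟩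
  rcases hOo.mem_trichotomous (isOrd_iff.1 hα) with h1 | h1 | h1
  · have : O ∈ O := (hOm O).2 ⟨⟨hO, (ZFSet.rank_lt_of_mem h1).trans_le (rank_val hx)⟩, isOrd_iff.2 hOo⟩
    exact absurd this (ZFSet.mem_irrefl _)
  · exact h1 ▸ hO
  · exact hM.trans _ hO _ h1

/-- definable subsets of ground sets -/
theorem FDef.ground {n : ℕ} (R : Ctx.{u} → Env.{u} n → ZFSet.{u} → Prop)
    [hR : FDef (fun C (w : Env.{u} (n + 1)) => R C (fun i => w i.castSucc) (w (Fin.last n)))]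
    (C : Ctx.{u}) (v : Env.{u} n) (hv : ∀ i, v i ∈ C.M) (D : ZFSet.{u}) (hD : D ∈ C.M) :
    ZFSet.sep (fun z => R C v z) D ∈ NN C := by
  have hM := C.hM.toBase
  have hD' := DefT.app (fun M (v : Env.{u} 1) => ZFSet.prod {∅} (v 0)) hM ![D] (all1 hD)
  simp only [Matrix.cons_val_zero] at hD'
  have := @FDef.ren _ (n + 1 + 1) _ (Fin.snoc (α := fun _ => Fin (n + 1 + 1)) (fun i : Fin n => i.castSucc.castSucc) (Fin.last _)) hR
  simp only [Fin.snoc_castSucc, Fin.snoc_last] at this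
  obtain ⟨d, hd, -, h⟩ := FDef.name (fun C v z => ∃ x ∈ C.M, z = ZFSet.pair ∅ x ∧ R C v x) C v hv _ hD'
  refine mem_NN.2 ⟨d, hd, ?_⟩
  ext z
  rw [h, ZFSet.mem_sep]
  constructor
  · rintro ⟨y, hy, ⟨x, hx, rfl, hr⟩, rfl⟩
    rw [val_const hx]
    exact ⟨(ZFSet.pair_mem_prod.1 hy).2, hr⟩
  · rintro ⟨hz, hr⟩
    have hzM := hM.trans _ hD _ hz
    exact ⟨_, ZFSet.pair_mem_prod.2 ⟨by simp, hz⟩, ⟨z, hzM, rfl, hr⟩, val_const hzM⟩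

/-- definable relations between a ground set and a set of the extension -/
theorem FDef.relN {n : ℕ} (R : Ctx.{u} → Env.{u} n → ZFSet.{u} → ZFSet.{u} → Prop)
    [hR : FDef (fun C (w : Env.{u} (n + 2)) => R C (fun i => w i.castSucc.castSucc) (w (Fin.last n).castSucc) (w (Fin.last (n+1))))]
    (C : Ctx.{u}) (v : Env.{u} n) (hv : ∀ i, v i ∈ C.M) (A : ZFSet.{u}) (hA : A ∈ C.M) (b : ZFSet.{u}) (hb : b ∈ C.M) :
    ∃ f ∈ NN C, ∀ z, z ∈ f ↔ ∃ ξ ∈ A, ∃ y ∈ C.M, Ch C y b ∧ R C v ξ y ∧ z = ZFSet.pair ξ (val C y) := by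
  have hM := C.hM.toBase
  have hprod := DefT.app (fun M (v : Env.{u} 2) => ZFSet.prod (v 0) (v 1)) (base_NN C) ![A, val C b]
    (all2 (sub_NN C hA) (val_mem hb))
  simp only [Matrix.cons_val_zero, Matrix.cons_val_one] at hprod
  obtain ⟨e, he, hee⟩ := mem_NN.1 hprod
  have i1 := @FDef.ren _ (n + 1 + 1 + 1 + 1 + 1 + 1) _ (Fin.snoc (α := fun _ => Fin (n + 1 + 1 + 1 + 1 + 1 + 1))
    (Fin.snoc (α := fun _ => Fin (n + 1 + 1 + 1 + 1 + 1 + 1))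
    (fun i : Fin n => i.castSucc.castSucc.castSucc.castSucc.castSucc.castSucc) (Fin.last _).castSucc.castSucc) (Fin.last _).castSucc) hR
  simp only [Fin.snoc_castSucc, Fin.snoc_last] at i1
  have i2 : FDef (fun C (v : Env.{u} (n + 1 + 1 + 1 + 1 + 1 + 1)) => val C (v (Fin.last _).castSucc.castSucc.castSucc) =
      ZFSet.pair (val C (v (Fin.last _))) (val C (v (Fin.last _).castSucc))) :=
    FDef.nn (fun _ (v : Env.{u} (n + 1 + 1 + 1 + 1 + 1 + 1)) => v (Fin.last _).castSucc.castSucc.castSucc = ZFSet.pair (v (Fin.last _)) (v (Fin.last _).castSucc))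
  obtain ⟨d, hd, -, h⟩ := FDef.name (n := n + 1 + 1) (fun C v z => ∃ ξ ∈ C.M, ∃ y ∈ C.M, ∃ k ∈ C.M, k = ZFSet.pair ∅ ξ ∧ 
    ξ ∈ v (Fin.last n).castSucc ∧ Ch C y (v (Fin.last (n+1))) ∧ R C (fun i => v i.castSucc.castSucc) ξ y ∧
    val C z = ZFSet.pair (val C k) (val C y)) C (snc (snc v A) b) (snc_mem (snc_mem hv hA) hb) _ (C.hM.vr he)
  simp only [snc_last, snc_cs] at h
  refine ⟨_, val_mem hd, fun z => ?_⟩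
  rw [h]
  constructor
  · rintro ⟨z, hz, ⟨ξ, hξ, y, hy, k, hk, rfl, h1, h2, h3, h4⟩, rfl⟩
    rw [val_const hξ] at h4
    exact ⟨ξ, h1, y, hy, h2, h3, h4⟩
  · rintro ⟨ξ, h1, y, hy, h2, h3, rfl⟩
    have hξ := hM.trans _ hA _ h1
    have : ZFSet.pair ξ (val C y) ∈ val C e := by
      rw [hee, ZFSet.pair_mem_prod]
      exact ⟨h1, (mem_val hb).2 ⟨y, hy, h2, rfl⟩⟩
    obtain ⟨z, hz, hc, hze⟩ := (mem_val he).1 this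
    exact ⟨z, ch_vr he hc, ⟨ξ, hξ, y, hy, _, hM.pair hM.empty hξ, rfl, h1, h2, h3, by rw [hze, val_const hξ]⟩, hze⟩

theorem ac_NN (C : Ctx.{u}) (h : ∀ a ∈ C.M, ∃ k ∈ C.M, ∃ f ∈ C.M, IsOrd k ∧ Surj C.M k a f) :
    ∀ a ∈ NN C, ∃ k ∈ NN C, ∃ f ∈ NN C, IsOrd k ∧ Surj (NN C) k a f := by
  have hM := C.hM.toBase
  intro A hA
  obtain ⟨a, ha, rfl⟩ := mem_NN.1 hA
  by_cases hne : ∃ c ∈ C.M, Ch C c a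
  swap
  · refine ⟨∅, sub_NN C hM.empty, ∅, sub_NN C hM.empty, ⟨?_, ?_⟩, ⟨?_, ?_⟩, ?_, ?_⟩
    · intro x hx; simp at hx
    · intro x hx; simp at hx
    · intro x hx; simp at hx
    · intro x hx; simp at hx
    · intro x _ y _ z _ h; simp at h
    · intro y hy
      obtain ⟨x, hx, hc, _⟩ := (mem_val ha).1 hy
      exact absurd ⟨x, hx, hc⟩ hne
  obtain ⟨c, hc, hca⟩ := hne
  obtain ⟨k, hk, f, hf, hko, ⟨h1, h2⟩, h3, h4⟩ := h _ (C.hM.vr ha)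
  obtain ⟨g, hg, hgm⟩ := FDef.relN (n := 3) (fun C v ξ y => ∃ x ∈ C.M, ZFSet.pair ξ x ∈ v 0 ∧
    ((Ch C x (v 1) ∧ y = x) ∨ (¬ Ch C x (v 1) ∧ y = v 2))) C ![f, a, c] (all3 hf ha hc) k hk a ha
  simp only [Matrix.cons_val_zero, Matrix.cons_val_one, Matrix.cons_val] at hgm
  refine ⟨k, sub_NN C hk, g, hg, hko, ⟨?_, ?_⟩, ?_, ?_⟩
  · intro z hz
    obtain ⟨ξ, hξ, y, hy, hya, _, rfl⟩ := (hgm z).1 hz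
    exact ⟨ξ, hξ, _, (mem_val ha).2 ⟨y, hy, hya, rfl⟩, rfl⟩
  · intro ξ hξ
    obtain ⟨x, hx, hfx⟩ := h2 ξ hξ
    have hxM := hM.trans _ (C.hM.vr ha) _ hx
    by_cases hxa : Ch C x a
    · exact ⟨_, (mem_val ha).2 ⟨x, hxM, hxa, rfl⟩, (hgm _).2 ⟨ξ, hξ, x, hxM, hxa, ⟨x, hxM, hfx, Or.inl ⟨hxa, rfl⟩⟩, rfl⟩⟩
    · exact ⟨_, (mem_val ha).2 ⟨c, hc, hca, rfl⟩, (hgm _).2 ⟨ξ, hξ, c, hc, hca, ⟨x, hxM, hfx, Or.inr ⟨hxa, rfl⟩⟩, rfl⟩⟩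
  · rintro x _ y _ y' _ ⟨hy, hy'⟩
    obtain ⟨ξ, hξ, w, hw, -, ⟨p, hp, hpf, hpo⟩, e⟩ := (hgm _).1 hy
    obtain ⟨ξ', hξ', w', hw', -, ⟨p', hp', hpf', hpo'⟩, e'⟩ := (hgm _).1 hy'
    obtain ⟨rfl, rfl⟩ := ZFSet.pair_inj.1 e
    obtain ⟨rfl, rfl⟩ := ZFSet.pair_inj.1 e'
    have := h3 x (hM.trans _ hk _ hξ) p hp p' hp' ⟨hpf, hpf'⟩
    subst this
    rcases hpo with ⟨h5, rfl⟩ | ⟨h5, rfl⟩ <;> rcases hpo' with ⟨h6, rfl⟩ | ⟨h6, rfl⟩ <;> first | rfl | contradiction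
  · intro y hy
    obtain ⟨x, hx, hxa, rfl⟩ := (mem_val ha).1 hy
    obtain ⟨ξ, hξ, hf⟩ := h4 x (ch_vr ha hxa)
    exact ⟨ξ, hξ, (hgm _).2 ⟨ξ, hξ, x, hx, hxa, ⟨x, hx, hf, Or.inl ⟨hxa, rfl⟩⟩, rfl⟩⟩

end

section
/-! ### Dependent choice inside `M` -/

def AC (M : ZFSet.{u}) : Prop := ∀ a ∈ M, ∃ k ∈ M, ∃ f ∈ M, IsOrd k ∧ Surj M k a f

theorem num_succ (n : ℕ) : num.{u} (n + 1) = insert (num n) (num n) := rfl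

/-- recursion along a functional relation -/
theorem omega_rec {M : ZFSet.{u}} (hM : Base M) {T E t0 : ZFSet.{u}} (hT : T ∈ M) (hE : E ∈ M) (ht : t0 ∈ T)
    (tot : ∀ x ∈ T, ∃ y ∈ T, ZFSet.pair x y ∈ E)
    (fn : ∀ x ∈ T, ∀ y ∈ T, ∀ y' ∈ T, ZFSet.pair x y ∈ E → ZFSet.pair x y' ∈ E → y = y') :
    ∃ s ∈ M, ∃ S : ℕ → ZFSet.{u}, S 0 = t0 ∧ (∀ n, S n ∈ T) ∧ (∀ n, ZFSet.pair (S n) (S (n + 1)) ∈ E) ∧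
      ∀ z, z ∈ s ↔ ∃ n, z = ZFSet.pair (num n) (S n) := by
  have T' : Tr M := hM.trans
  choose! F hF1 hF2 using tot
  let S : ℕ → ZFSet.{u} := fun n => Nat.rec t0 (fun _ x => F x) n
  have hS : ∀ n, S n ∈ T := by
    intro n
    induction n with
    | zero => exact ht
    | succ n ih => exact hF1 _ ih
  have hSE : ∀ n, ZFSet.pair (S n) (S (n + 1)) ∈ E := fun n => hF2 _ (hS n)
  have hs := DefT.app (fun M (v : Env.{u} 3) => ZFSet.sep (fun z => ∀ w ∈ M, (ZFSet.pair ∅ (v 2) ∈ w ∧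
    ∀ k ∈ om, ∀ y ∈ v 0, ∀ y' ∈ v 0, ZFSet.pair k y ∈ w → ZFSet.pair y y' ∈ v 1 → ZFSet.pair (insert k k) y' ∈ w) → z ∈ w)
    (ZFSet.prod om (v 0))) hM ![T, E, t0] (all3 hT hE (T' _ hT _ ht))
  simp only [Matrix.cons_val_zero, Matrix.cons_val_one, Matrix.cons_val] at hs
  set Cl : ZFSet.{u} → Prop := fun w => (ZFSet.pair ∅ t0 ∈ w ∧
    ∀ k ∈ om, ∀ y ∈ T, ∀ y' ∈ T, ZFSet.pair k y ∈ w → ZFSet.pair y y' ∈ E → ZFSet.pair (insert k k) y' ∈ w)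
  set s := ZFSet.sep (fun z => ∀ w ∈ M, Cl w → z ∈ w) (ZFSet.prod om T)
  have h1 : ∀ n, ZFSet.pair (num n) (S n) ∈ s := by
    intro n
    refine ZFSet.mem_sep.2 ⟨ZFSet.pair_mem_prod.2 ⟨num_mem_om n, hS n⟩, fun w hw hcl => ?_⟩
    induction n with
    | zero => exact hcl.1
    | succ n ih => exact hcl.2 _ (num_mem_om n) _ (hS n) _ (hS (n+1)) ih (hSE n)
  have hscl : Cl s := by
    refine ⟨h1 0, fun k hk y hy y' hy' h2 h3 => ZFSet.mem_sep.2 ⟨?_, fun w hw hcl => ?_⟩⟩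
    · obtain ⟨n, rfl⟩ := mem_om.1 hk
      exact ZFSet.pair_mem_prod.2 ⟨num_mem_om (n+1), hy'⟩
    · exact hcl.2 k hk y hy y' hy' ((ZFSet.mem_sep.1 h2).2 w hw hcl) h3
  have h2 : ∀ n y, ZFSet.pair (num n) y ∈ s → y = S n := by
    intro n
    induction n with
    | zero =>
      intro y hy
      by_contra hne
      have hd := DefT.app (fun M (v : Env.{u} 2) => v 0 \ {v 1}) hM ![s, ZFSet.pair (num 0) y] (all2 hs (T' _ hs _ hy))
      simp only [Matrix.cons_val_zero, Matrix.cons_val_one] at hd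
      have := (ZFSet.mem_sep.1 hy).2 _ hd ⟨?_, ?_⟩
      · simp at this
      · rw [ZFSet.mem_sdiff]
        refine ⟨hscl.1, fun h => hne ?_⟩
        exact (ZFSet.pair_inj.1 (ZFSet.mem_singleton.1 h)).2.symm
      · intro k hk y1 hy1 y2 hy2 h3 h4
        rw [ZFSet.mem_sdiff] at h3 ⊢
        refine ⟨hscl.2 k hk y1 hy1 y2 hy2 h3.1 h4, fun h => ?_⟩
        obtain ⟨n, rfl⟩ := mem_om.1 hk
        have := num_inj (m := n+1) (n := 0) (ZFSet.pair_inj.1 (ZFSet.mem_singleton.1 h)).1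
        omega
    | succ n ih =>
      intro y hy
      by_contra hne
      have hd := DefT.app (fun M (v : Env.{u} 2) => v 0 \ {v 1}) hM ![s, ZFSet.pair (num (n+1)) y] (all2 hs (T' _ hs _ hy))
      simp only [Matrix.cons_val_zero, Matrix.cons_val_one] at hd
      have := (ZFSet.mem_sep.1 hy).2 _ hd ⟨?_, ?_⟩
      · simp at this
      · rw [ZFSet.mem_sdiff]
        refine ⟨hscl.1, fun h => ?_⟩
        have := num_inj (m := 0) (n := n+1) (ZFSet.pair_inj.1 (ZFSet.mem_singleton.1 h)).1
        omega
      · intro k hk y1 hy1 y2 hy2 h3 h4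
        rw [ZFSet.mem_sdiff] at h3 ⊢
        refine ⟨hscl.2 k hk y1 hy1 y2 hy2 h3.1 h4, fun h => hne ?_⟩
        obtain ⟨m, rfl⟩ := mem_om.1 hk
        obtain ⟨e1, e2⟩ := ZFSet.pair_inj.1 (ZFSet.mem_singleton.1 h)
        have := num_inj (m := m+1) (n := n+1) e1
        obtain rfl : m = n := by omega
        subst e2
        have := ih _ h3.1
        subst this
        exact fn _ hy1 _ hy2 _ (hS (m+1)) h4 (hSE m)
  refine ⟨s, hs, S, rfl, hS, hSE, fun z => ⟨fun hz => ?_, ?_⟩⟩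
  · obtain ⟨a, ha, b, hb, rfl⟩ := ZFSet.mem_prod.1 (ZFSet.mem_sep.1 hz).1
    obtain ⟨n, rfl⟩ := mem_om.1 ha
    exact ⟨n, by rw [h2 n b hz]⟩
  · rintro ⟨n, rfl⟩
    exact h1 n

theorem dc {M : ZFSet.{u}} (hM : Base M) (hAC : AC M) {T E t0 : ZFSet.{u}} (hT : T ∈ M) (hE : E ∈ M) (ht : t0 ∈ T)
    (tot : ∀ x ∈ T, ∃ y ∈ T, ZFSet.pair x y ∈ E) :
    ∃ s ∈ M, ∃ S : ℕ → ZFSet.{u}, S 0 = t0 ∧ (∀ n, S n ∈ T) ∧ (∀ n, ZFSet.pair (S n) (S (n + 1)) ∈ E) ∧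
      ∀ z, z ∈ s ↔ ∃ n, z = ZFSet.pair (num n) (S n) := by
  have T' : Tr M := hM.trans
  obtain ⟨k, hk, f, hf, hko, ⟨h1, h2⟩, h3, h4⟩ := hAC T hT
  have hE' := DefT.app (fun M (v : Env.{u} 3) => ZFSet.sep (fun z => ∃ x ∈ M, ∃ y ∈ M, z = ZFSet.pair x y ∧
     ∃ ξ ∈ v 1, ZFSet.pair ξ y ∈ v 2 ∧ ∀ η ∈ v 1, ∀ y' ∈ M, ZFSet.pair η y' ∈ v 2 → ZFSet.pair x y' ∈ v 0 → ¬ η ∈ ξ) (v 0)) hM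
      ![E, k, f] (all3 hE hk hf)
  simp only [Matrix.cons_val_zero, Matrix.cons_val_one, Matrix.cons_val] at hE'
  set E' := ZFSet.sep (fun z => ∃ x ∈ M, ∃ y ∈ M, z = ZFSet.pair x y ∧
     ∃ ξ ∈ k, ZFSet.pair ξ y ∈ f ∧ ∀ η ∈ k, ∀ y' ∈ M, ZFSet.pair η y' ∈ f → ZFSet.pair x y' ∈ E → ¬ η ∈ ξ) E with hEe
  have hmem : ∀ x y, ZFSet.pair x y ∈ E' ↔ ZFSet.pair x y ∈ E ∧ ∃ ξ ∈ k, ZFSet.pair ξ y ∈ f ∧ ∀ η ∈ k, ∀ y' ∈ M, ZFSet.pair η y' ∈ f → ZFSet.pair x y' ∈ E → ¬ η ∈ ξ := by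
    intro x y
    rw [hEe, ZFSet.mem_sep]
    refine and_congr_right fun hxy => ⟨?_, fun h => ?_⟩
    · rintro ⟨x', _, y', _, e, h⟩
      obtain ⟨rfl, rfl⟩ := ZFSet.pair_inj.1 e
      exact h
    · have := hM.of_pair (T' _ hE _ hxy)
      exact ⟨x, this.1, y, this.2, rfl, h⟩
  have H := omega_rec hM hT hE' ht
  refine (fun H1 H2 => (fun q => ?_) (H H1 H2)) ?_ ?_
  · obtain ⟨s, hs, S, a, b, c, d⟩ := q
    exact ⟨s, hs, S, a, b, fun n => ((hmem _ _).1 (c n)).1, d⟩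
  · intro x hx
    obtain ⟨y, hy, hxy⟩ := tot x hx
    obtain ⟨ξ, hξ, hξy⟩ := h4 y hy
    obtain ⟨ξ, ⟨hξ, y, hy, hξy, hxy⟩, hmin⟩ := ZFSet.mem_wf.has_min {ξ | ξ ∈ k ∧ ∃ y ∈ T, ZFSet.pair ξ y ∈ f ∧ ZFSet.pair x y ∈ E}
      ⟨ξ, hξ, y, hy, hξy, hxy⟩
    refine ⟨y, hy, (hmem _ _).2 ⟨hxy, ξ, hξ, hξy, fun η hη y' hy' h5 h6 h7 => ?_⟩⟩
    obtain ⟨a, ha, b, hb, e⟩ := h1 _ h5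
    obtain ⟨rfl, rfl⟩ := ZFSet.pair_inj.1 e
    exact hmin η ⟨hη, y', hb, h5, h6⟩ h7
  · intro x hx y hy y' hy' h5 h6
    rw [hmem] at h5 h6
    obtain ⟨h5, ξ, hξ, h7, h8⟩ := h5
    obtain ⟨h5', ξ', hξ', h7', h8'⟩ := h6
    have hyM := T' _ hT _ hy
    have hyM' := T' _ hT _ hy'
    have a1 := h8 ξ' hξ' y' hyM' h7' h5'
    have a2 := h8' ξ hξ y hyM h7 h5
    have hk' := isOrd_iff.1 hko
    rcases (hk'.mem hξ).mem_trichotomous (hk'.mem hξ') with h | h | h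
    · exact absurd h a2
    · subst h
      exact h3 ξ (T' _ hk _ hξ) y hyM y' hyM' ⟨h7, h7'⟩
    · exact absurd h a1

/-! ### Countability inside `M` -/

/-- `e` enumerates (a superset of) `a` -/
def Enum (M e a : ZFSet.{u}) : Prop :=
  (∀ n ∈ om, ∀ x ∈ M, ∀ y ∈ M, ZFSet.pair n x ∈ e → ZFSet.pair n y ∈ e → x = y) ∧ ∀ z ∈ a, ∃ n ∈ om, ZFSet.pair n z ∈ e

def Ctbl (M a : ZFSet.{u}) : Prop := ∃ e ∈ M, Enum M e a

instance {n : ℕ} (f g : ZFSet.{u} → Env.{u} n → ZFSet.{u}) [DefT f] [DefT g] :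
    Def (fun M v => Enum M (f M v) (g M v)) := by unfold Enum; infer_instance

instance {n : ℕ} (f : ZFSet.{u} → Env.{u} n → ZFSet.{u}) [DefT f] :
    Def (fun M v => Ctbl M (f M v)) := by unfold Ctbl; infer_instance

theorem Ctbl.ins {M a x : ZFSet.{u}} (hM : Base M) (ha : a ∈ M) (hx : x ∈ M) (h : Ctbl M a) : Ctbl M (insert x a) := by
  have T' : Tr M := hM.trans
  obtain ⟨e, he, h1, h2⟩ := h
  have hs := DefT.app (fun M (v : Env.{u} 3) => ZFSet.sep (fun z => ∃ m ∈ M, ∃ y ∈ M, z = ZFSet.pair m y ∧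
    ((m = ∅ ∧ y = v 2) ∨ ∃ k ∈ om, m = insert k k ∧ ZFSet.pair k y ∈ v 0))
    (ZFSet.prod om (insert (v 2) (v 1)))) hM ![e, a, x] (all3 he ha hx)
  simp only [Matrix.cons_val_zero, Matrix.cons_val_one, Matrix.cons_val] at hs
  refine ⟨_, hs, ?_, ?_⟩
  · intro n hn y hy y' hy' h3 h4
    rw [ZFSet.mem_sep] at h3 h4
    obtain ⟨-, m, hm, y1, hy1, e1, h3⟩ := h3
    obtain ⟨-, m', hm', y2, hy2, e2, h4⟩ := h4
    obtain ⟨rfl, rfl⟩ := ZFSet.pair_inj.1 e1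
    obtain ⟨rfl, rfl⟩ := ZFSet.pair_inj.1 e2
    rcases h3 with ⟨rfl, rfl⟩ | ⟨k, hk, rfl, h3⟩
    · rcases h4 with ⟨_, rfl⟩ | ⟨k, hk, hh, h4⟩
      · rfl
      · exact absurd (hh ▸ ZFSet.mem_insert k k) (ZFSet.notMem_empty k)
    · rcases h4 with ⟨hh, rfl⟩ | ⟨k', hk', hh, h4⟩
      · exact absurd (hh ▸ ZFSet.mem_insert k k) (ZFSet.notMem_empty k)
      · obtain ⟨i, rfl⟩ := mem_om.1 hk
        obtain ⟨j, rfl⟩ := mem_om.1 hk'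
        have := num_inj (m := i+1) (n := j+1) hh
        obtain rfl : i = j := by omega
        exact h1 _ hk _ hy _ hy' h3 h4
  · intro z hz
    rcases ZFSet.mem_insert_iff.1 hz with rfl | hz'
    · exact ⟨∅, num_mem_om 0, ZFSet.mem_sep.2 ⟨ZFSet.pair_mem_prod.2 ⟨num_mem_om 0, hz⟩, ∅, hM.empty, z, hx, rfl, Or.inl ⟨rfl, rfl⟩⟩⟩
    · obtain ⟨n, hn, h3⟩ := h2 z hz'
      obtain ⟨i, rfl⟩ := mem_om.1 hn
      exact ⟨_, num_mem_om (i+1), ZFSet.mem_sep.2 ⟨ZFSet.pair_mem_prod.2 ⟨num_mem_om (i+1), hz⟩, _, num_mem hM (i+1), z, T' _ ha _ hz', rfl,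
        Or.inr ⟨_, hn, rfl, h3⟩⟩⟩

/-- image of a countable set under a functional relation -/
theorem Ctbl.image {M a b f : ZFSet.{u}} (hM : Base M) (hb : b ∈ M) (hf : f ∈ M) (h : Ctbl M a)
    (fn : ∀ x ∈ M, ∀ y ∈ M, ∀ y' ∈ M, ZFSet.pair x y ∈ f → ZFSet.pair x y' ∈ f → y = y')
    (on : ∀ y ∈ b, ∃ x ∈ a, ZFSet.pair x y ∈ f) : Ctbl M b := by
  have T' : Tr M := hM.trans
  obtain ⟨e, he, h1, h2⟩ := h
  have hs := DefT.app (fun M (v : Env.{u} 3) => ZFSet.sep (fun z => ∃ m ∈ M, ∃ y ∈ M, z = ZFSet.pair m y ∧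
    ∃ x ∈ M, ZFSet.pair m x ∈ v 0 ∧ ZFSet.pair x y ∈ v 2) (ZFSet.prod om (v 1))) hM ![e, b, f] (all3 he hb hf)
  simp only [Matrix.cons_val_zero, Matrix.cons_val_one, Matrix.cons_val] at hs
  refine ⟨_, hs, ?_, ?_⟩
  · intro n hn y hy y' hy' h3 h4
    rw [ZFSet.mem_sep] at h3 h4
    obtain ⟨-, m, hm, y1, hy1, e1, x, hx, h3, h5⟩ := h3
    obtain ⟨-, m', hm', y2, hy2, e2, x', hx', h4, h6⟩ := h4
    obtain ⟨rfl, rfl⟩ := ZFSet.pair_inj.1 e1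
    obtain ⟨rfl, rfl⟩ := ZFSet.pair_inj.1 e2
    have := h1 _ hn _ hx _ hx' h3 h4
    subst this
    exact fn x hx y hy y' hy' h5 h6
  · intro y hy
    obtain ⟨x, hx, hxy⟩ := on y hy
    obtain ⟨n, hn, h3⟩ := h2 x hx
    have := hM.of_pair (T' _ hf _ hxy)
    exact ⟨n, hn, ZFSet.mem_sep.2 ⟨ZFSet.pair_mem_prod.2 ⟨hn, hy⟩, n, T' _ (om_mem hM) _ hn, y, this.2, rfl, x, this.1, h3, hxy⟩⟩

theorem cantor {M : ZFSet.{u}} (hM : Base M) : ¬ Ctbl M (Pw M om) := by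
  have T' : Tr M := hM.trans
  rintro ⟨e, he, h1, h2⟩
  have hs := DefT.app (fun M (v : Env.{u} 1) => ZFSet.sep (fun n => ∀ x ∈ M, ZFSet.pair n x ∈ v 0 → ¬ n ∈ x) om) hM ![e] (all1 he)
  simp only [Matrix.cons_val_zero] at hs
  obtain ⟨n, hn, h3⟩ := h2 _ (mem_Pw.2 ⟨hs, fun z hz => (ZFSet.mem_sep.1 hz).1⟩)
  by_cases h : n ∈ ZFSet.sep (fun n => ∀ x ∈ M, ZFSet.pair n x ∈ e → ¬ n ∈ x) om
  · exact (ZFSet.mem_sep.1 h).2 _ hs h3 h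
  · refine h (ZFSet.mem_sep.2 ⟨hn, fun x hx hnx => ?_⟩)
    rwa [h1 n hn x hx _ hs hnx h3]

theorem exists_omega1 {M : ZFSet.{u}} (hM : Base M) (hAC : AC M) :
    ∃ k ∈ M, IsOrd k ∧ ¬ Ctbl M k ∧ ∀ x ∈ k, Ctbl M x := by
  have T' : Tr M := hM.trans
  have hR := DefT.app (fun M (v : Env.{u} 0) => Pw M om) hM default (env0 _)
  obtain ⟨k, hk, f, hf, hko, ⟨h1, h2⟩, h3, h4⟩ := hAC _ hR
  have hkn : ¬ Ctbl M k := fun h => cantor hM (h.image hM hR hf (fun x hx y hy y' hy' a b => h3 x hx y hy y' hy' ⟨a, b⟩) h4)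
  obtain ⟨k, ⟨hk, hko, hkn⟩, hmin⟩ := ZFSet.mem_wf.has_min {k | k ∈ M ∧ IsOrd k ∧ ¬ Ctbl M k} ⟨k, hk, hko, hkn⟩
  refine ⟨k, hk, hko, hkn, fun x hx => ?_⟩
  by_contra hc
  exact hmin x ⟨T' _ hk _ hx, isOrd_iff.2 ((isOrd_iff.1 hko).mem hx), hc⟩ hx

/-! ### Enumerating `ω × ω` -/

def walk : ℕ → ℕ × ℕ
  | 0 => (0, 0)
  | n + 1 => match walk n with
    | (0, j) => (j + 1, 0)
    | (i + 1, j) => (i, j + 1)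

theorem walk_surj (i j : ℕ) : ∃ n, walk n = (i, j) := by
  have step : ∀ d, (∃ n, walk n = (d, 0)) → ∀ j i, i + j = d → ∃ n, walk n = (i, j) := by
    intro d h j
    induction j with
    | zero => intro i hi; obtain rfl : i = d := by omega
              exact h
    | succ j ih =>
      intro i hi
      obtain ⟨n, hn⟩ := ih (i + 1) (by omega)
      exact ⟨n + 1, by simp [walk, hn]⟩
  have diag : ∀ d, ∃ n, walk n = (d, 0) := by
    intro d
    induction d with
    | zero => exact ⟨0, rfl⟩
    | succ d ih =>
      obtain ⟨n, hn⟩ := step d ih d 0 (by omega)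
      exact ⟨n + 1, by simp [walk, hn]⟩
  exact step _ (diag (i + j)) j i rfl

theorem exists_walk {M : ZFSet.{u}} (hM : Base M) : ∃ s ∈ M, ∀ z, z ∈ s ↔ ∃ n, z = ZFSet.pair (num n)
    (ZFSet.pair (num (walk n).1) (num (walk n).2)) := by
  have hT := DefT.app (fun M (v : Env.{u} 0) => ZFSet.prod om om) hM default (env0 _)
  have hE := DefT.app (fun M (v : Env.{u} 0) => ZFSet.sep (fun z => ∃ i ∈ om, ∃ j ∈ om,
    (i = ∅ ∧ z = ZFSet.pair (ZFSet.pair i j) (ZFSet.pair (insert j j) ∅)) ∨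
    ∃ i' ∈ om, i = insert i' i' ∧ z = ZFSet.pair (ZFSet.pair i j) (ZFSet.pair i' (insert j j)))
    (ZFSet.prod (ZFSet.prod om om) (ZFSet.prod om om))) hM default (env0 _)
  set E := ZFSet.sep (fun z => ∃ i ∈ om, ∃ j ∈ om,
    (i = ∅ ∧ z = ZFSet.pair (ZFSet.pair i j) (ZFSet.pair (insert j j) ∅)) ∨
    ∃ i' ∈ om, i = insert i' i' ∧ z = ZFSet.pair (ZFSet.pair i j) (ZFSet.pair i' (insert j j)))
    (ZFSet.prod (ZFSet.prod om om) (ZFSet.prod om om)) with hEe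
  have c : ∀ m n, ZFSet.pair (num.{u} m) (num n) ∈ ZFSet.prod om om :=
    fun m n => ZFSet.pair_mem_prod.2 ⟨num_mem_om m, num_mem_om n⟩
  have e0 : ∀ j y, ZFSet.pair (ZFSet.pair (num 0) (num j)) y ∈ E ↔ y = ZFSet.pair (num (j+1)) (num 0) := by
    intro j y
    rw [hEe, ZFSet.mem_sep]
    constructor
    · rintro ⟨-, i, hi, j', hj', ⟨rfl, e⟩ | ⟨i', hi', rfl, e⟩⟩
      · simp only [ZFSet.pair_inj] at e
        obtain ⟨⟨_, rfl⟩, rfl⟩ := e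
        rfl
      · simp only [ZFSet.pair_inj] at e
        have := e.1.1
        exact absurd (this ▸ ZFSet.mem_insert i' i' : i' ∈ num 0) (ZFSet.notMem_empty i')
    · rintro rfl
      exact ⟨ZFSet.pair_mem_prod.2 ⟨c _ _, c _ _⟩, _, num_mem_om 0, _, num_mem_om j, Or.inl ⟨rfl, rfl⟩⟩
  have e1 : ∀ i j y, ZFSet.pair (ZFSet.pair (num (i+1)) (num j)) y ∈ E ↔ y = ZFSet.pair (num i) (num (j+1)) := by
    intro i j y
    rw [hEe, ZFSet.mem_sep]
    constructor
    · rintro ⟨-, i', hi', j', hj', ⟨rfl, e⟩ | ⟨i'', hi'', rfl, e⟩⟩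
      · simp only [ZFSet.pair_inj] at e
        have := e.1.1
        exact absurd (this ▸ ZFSet.mem_insert (num i) (num i) : num i ∈ ∅) (ZFSet.notMem_empty _)
      · simp only [ZFSet.pair_inj] at e
        obtain ⟨⟨e2, rfl⟩, rfl⟩ := e
        obtain ⟨k, rfl⟩ := mem_om.1 hi''
        have := num_inj (m := i+1) (n := k+1) e2
        obtain rfl : i = k := by omega
        rfl
    · rintro rfl
      exact ⟨ZFSet.pair_mem_prod.2 ⟨c _ _, c _ _⟩, _, num_mem_om (i+1), _, num_mem_om j, Or.inr ⟨_, num_mem_om i, rfl, rfl⟩⟩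
  have dest : ∀ x ∈ ZFSet.prod om.{u} om, ∃ i j, x = ZFSet.pair (num i) (num j) := by
    intro x hx
    obtain ⟨a, ha, b, hb, rfl⟩ := ZFSet.mem_prod.1 hx
    obtain ⟨i, rfl⟩ := mem_om.1 ha
    obtain ⟨j, rfl⟩ := mem_om.1 hb
    exact ⟨i, j, rfl⟩
  have H := omega_rec hM hT hE (c 0 0)
  refine (fun H1 H2 => (fun q => ?_) (H H1 H2)) ?_ ?_
  · obtain ⟨s, hs, S, h0, h1, h2, h3⟩ := q
    have : ∀ n, S n = ZFSet.pair (num (walk n).1) (num (walk n).2) := by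
      intro n
      induction n with
      | zero => exact h0
      | succ n ih =>
        have h := h2 n
        rw [ih] at h
        rcases hw : walk n with ⟨i, j⟩
        rw [hw] at h
        rcases i with _ | i
        · rw [(e0 _ _).1 h]; simp [walk, hw]
        · rw [(e1 _ _ _).1 h]; simp [walk, hw]
    refine ⟨s, hs, fun z => ?_⟩
    rw [h3]
    simp only [this]
  · intro x hx
    obtain ⟨i, j, rfl⟩ := dest x hx
    rcases i with _ | i
    · exact ⟨_, c _ _, (e0 _ _).2 rfl⟩
    · exact ⟨_, c _ _, (e1 _ _ _).2 rfl⟩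
  · intro x hx y hy y' hy' h h'
    obtain ⟨i, j, rfl⟩ := dest x hx
    rcases i with _ | i
    · rw [(e0 _ _).1 h, (e0 _ _).1 h']
    · rw [(e1 _ _ _).1 h, (e1 _ _ _).1 h']

end

section
/-! ### The forcing: countable injective partial functions -/

noncomputable def PP (M A B : ZFSet.{u}) : ZFSet.{u} :=
  ZFSet.sep (fun p => (∀ x ∈ M, ∀ y ∈ M, ∀ y' ∈ M, ZFSet.pair x y ∈ p → ZFSet.pair x y' ∈ p → y = y') ∧
    (∀ x ∈ M, ∀ x' ∈ M, ∀ y ∈ M, ZFSet.pair x y ∈ p → ZFSet.pair x' y ∈ p → x = x') ∧ Ctbl M p) (Pw M (ZFSet.prod A B))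

theorem mem_PP {M A B p : ZFSet.{u}} : p ∈ PP M A B ↔ (p ∈ M ∧ p ⊆ ZFSet.prod A B) ∧
    (∀ x ∈ M, ∀ y ∈ M, ∀ y' ∈ M, ZFSet.pair x y ∈ p → ZFSet.pair x y' ∈ p → y = y') ∧
    (∀ x ∈ M, ∀ x' ∈ M, ∀ y ∈ M, ZFSet.pair x y ∈ p → ZFSet.pair x' y ∈ p → x = x') ∧ Ctbl M p := by
  rw [PP, ZFSet.mem_sep, mem_Pw]

instance {n : ℕ} (f g : ZFSet.{u} → Env.{u} n → ZFSet.{u}) [DefT f] [DefT g] :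
    DefT (fun M v => PP M (f M v) (g M v)) := by unfold PP; infer_instance

theorem PP_mem {M A B : ZFSet.{u}} (hM : Base M) (hA : A ∈ M) (hB : B ∈ M) : PP M A B ∈ M := by
  have h := DefT.app (fun M (v : Env.{u} 2) => PP M (v 0) (v 1)) hM ![A, B] (all2 hA hB)
  simpa only [Matrix.cons_val_zero, Matrix.cons_val_one] using h

theorem empty_PP {M A B : ZFSet.{u}} (hM : Base M) : ∅ ∈ PP M A B := by
  refine mem_PP.2 ⟨⟨hM.empty, fun z hz => absurd hz (ZFSet.notMem_empty z)⟩, ?_, ?_, ∅, hM.empty, ?_, ?_⟩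
  · intro x _ y _ y' _ h; exact absurd h (ZFSet.notMem_empty _)
  · intro x _ y _ y' _ h; exact absurd h (ZFSet.notMem_empty _)
  · intro x _ y _ y' _ h; exact absurd h (ZFSet.notMem_empty _)
  · intro x h; exact absurd h (ZFSet.notMem_empty _)

theorem sclosed {M A B s : ZFSet.{u}} (hM : Base M) (hA : A ∈ M) (hB : B ∈ M) (hs : s ∈ M) (N Q E : ℕ → ZFSet.{u})
    (hQ : ∀ n, Q n ∈ PP M A B) (hEn : ∀ n, Enum M (E n) (Q n)) (mono : ∀ n, Q n ⊆ Q (n + 1))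
    (hsm : ∀ z, z ∈ s ↔ ∃ n, z = ZFSet.pair (num n) (ZFSet.pair (N n) (ZFSet.pair (Q n) (E n)))) :
    ∃ U ∈ PP M A B, ∀ n, Q n ⊆ U := by
  have T' : Tr M := hM.trans
  have hU := DefT.app (fun M (v : Env.{u} 3) => ZFSet.sep (fun z => ∃ i ∈ om, ∃ t ∈ M, ∃ q ∈ M, ∃ e ∈ M,
    ZFSet.pair i (ZFSet.pair t (ZFSet.pair q e)) ∈ v 2 ∧ z ∈ q) (ZFSet.prod (v 0) (v 1))) hM ![A, B, s] (all3 hA hB hs)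
  simp only [Matrix.cons_val_zero, Matrix.cons_val_one, Matrix.cons_val] at hU
  set U := ZFSet.sep (fun z => ∃ i ∈ om, ∃ t ∈ M, ∃ q ∈ M, ∃ e ∈ M,
    ZFSet.pair i (ZFSet.pair t (ZFSet.pair q e)) ∈ s ∧ z ∈ q) (ZFSet.prod A B) with hUe
  have hQM : ∀ n, N n ∈ M ∧ Q n ∈ M ∧ E n ∈ M := by
    intro n
    have h1 := hM.of_pair (T' _ hs _ ((hsm _).2 ⟨n, rfl⟩))
    have h2 := hM.of_pair h1.2
    have h3 := hM.of_pair h2.2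
    exact ⟨h2.1, h3.1, h3.2⟩
  have hUm : ∀ z, z ∈ U ↔ ∃ n, z ∈ Q n := by
    intro z
    rw [hUe, ZFSet.mem_sep]
    constructor
    · rintro ⟨-, i, hi, t, _, q, _, e, _, h, hz⟩
      obtain ⟨n, h⟩ := (hsm _).1 h
      simp only [ZFSet.pair_inj] at h
      exact ⟨n, h.2.2.1 ▸ hz⟩
    · rintro ⟨n, hz⟩
      exact ⟨(mem_PP.1 (hQ n)).1.2 hz, _, num_mem_om n, _, (hQM n).1, _, (hQM n).2.1, _, (hQM n).2.2, (hsm _).2 ⟨n, rfl⟩, hz⟩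
  have mono' : ∀ i j, i ≤ j → Q i ⊆ Q j := by
    intro i j hij
    induction hij with
    | refl => exact fun _ h => h
    | step _ ih => exact fun z h => mono _ (ih h)
  refine ⟨U, mem_PP.2 ⟨⟨hU, fun z hz => (ZFSet.mem_sep.1 hz).1⟩, ?_, ?_, ?_⟩, fun n z hz => (hUm z).2 ⟨n, hz⟩⟩
  · intro x hx y hy y' hy' h1 h2
    obtain ⟨i, h1⟩ := (hUm _).1 h1
    obtain ⟨j, h2⟩ := (hUm _).1 h2
    exact (mem_PP.1 (hQ (max i j))).2.1 x hx y hy y' hy' (mono' _ _ (le_max_left i j) h1) (mono' _ _ (le_max_right i j) h2)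
  · intro x hx y hy y' hy' h1 h2
    obtain ⟨i, h1⟩ := (hUm _).1 h1
    obtain ⟨j, h2⟩ := (hUm _).1 h2
    exact (mem_PP.1 (hQ (max i j))).2.2.1 x hx y hy y' hy' (mono' _ _ (le_max_left i j) h1) (mono' _ _ (le_max_right i j) h2)
  obtain ⟨W, hW, hWm⟩ := exists_walk hM
  have hε := DefT.app (fun M (v : Env.{u} 3) => ZFSet.sep (fun w => ∃ m ∈ M, ∃ z ∈ M, w = ZFSet.pair m z ∧
    ∃ i ∈ M, ∃ j ∈ M, ZFSet.pair m (ZFSet.pair i j) ∈ v 2 ∧ ∃ t ∈ M, ∃ q ∈ M, ∃ e ∈ M,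
    ZFSet.pair i (ZFSet.pair t (ZFSet.pair q e)) ∈ v 1 ∧ ZFSet.pair j z ∈ e) (ZFSet.prod om (v 0))) hM ![U, s, W] (all3 hU hs hW)
  simp only [Matrix.cons_val_zero, Matrix.cons_val_one, Matrix.cons_val] at hε
  refine ⟨_, hε, ?_, ?_⟩
  · intro n hn x hx y hy h1 h2
    obtain ⟨-, m, _, z, _, e1, i, _, j, _, h1, t, _, q, _, e, _, h3, h4⟩ := ZFSet.mem_sep.1 h1
    obtain ⟨-, m', _, z', _, e1', i', _, j', _, h1', t', _, q', _, e', _, h3', h4'⟩ := ZFSet.mem_sep.1 h2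
    obtain ⟨rfl, rfl⟩ := ZFSet.pair_inj.1 e1
    obtain ⟨rfl, rfl⟩ := ZFSet.pair_inj.1 e1'
    obtain ⟨a, ha⟩ := (hWm _).1 h1
    obtain ⟨a', ha'⟩ := (hWm _).1 h1'
    simp only [ZFSet.pair_inj] at ha ha'
    have : a = a' := num_inj (ha.1.symm.trans ha'.1)
    subst this
    obtain ⟨b, hb⟩ := (hsm _).1 h3
    obtain ⟨b', hb'⟩ := (hsm _).1 h3'
    simp only [ZFSet.pair_inj] at hb hb'
    have : b = b' := num_inj (hb.1.symm.trans (ha.2.1.trans (ha'.2.1.symm.trans hb'.1)))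
    subst this
    rw [ha.2.2, hb.2.2.2] at h4
    rw [ha'.2.2, hb'.2.2.2] at h4'
    exact (hEn b).1 _ (num_mem_om _) _ hx _ hy h4 h4'
  · intro z hz
    obtain ⟨i, hi⟩ := (hUm z).1 hz
    obtain ⟨j', hj', hj⟩ := (hEn i).2 z hi
    obtain ⟨j, rfl⟩ := mem_om.1 hj'
    obtain ⟨n, hn⟩ := walk_surj i j
    refine ⟨num n, num_mem_om n, ZFSet.mem_sep.2 ⟨ZFSet.pair_mem_prod.2 ⟨num_mem_om n, hz⟩, num n, num_mem hM n, z, T' _ hU _ hz, rfl,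
      num i, num_mem hM i, num j, num_mem hM j, (hWm _).2 ⟨n, by rw [hn]⟩, _, (hQM i).1, _, (hQM i).2.1, _, (hQM i).2.2,
      (hsm _).2 ⟨i, rfl⟩, hj⟩⟩

theorem enum_restr {M A B p : ZFSet.{u}} (hM : Base M) (hA : A ∈ M) (hB : B ∈ M) (hp : p ∈ PP M A B) :
    ∃ e ∈ Pw M (ZFSet.prod om (ZFSet.prod A B)), Enum M e p := by
  obtain ⟨e, he, h1, h2⟩ := (mem_PP.1 hp).2.2.2
  have h := DefT.app (fun M (v : Env.{u} 3) => ZFSet.sep (fun z => z ∈ v 2) (ZFSet.prod om (ZFSet.prod (v 0) (v 1)))) hM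
    ![A, B, e] (all3 hA hB he)
  simp only [Matrix.cons_val_zero, Matrix.cons_val_one, Matrix.cons_val] at h
  refine ⟨_, mem_Pw.2 ⟨h, fun z hz => (ZFSet.mem_sep.1 hz).1⟩, ?_, ?_⟩
  · intro n hn x hx y hy h3 h4
    exact h1 n hn x hx y hy (ZFSet.mem_sep.1 h3).2 (ZFSet.mem_sep.1 h4).2
  · intro z hz
    obtain ⟨n, hn, h3⟩ := h2 z hz
    exact ⟨n, hn, ZFSet.mem_sep.2 ⟨ZFSet.pair_mem_prod.2 ⟨hn, (mem_PP.1 hp).1.2 hz⟩, h3⟩⟩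

class Def5 (X : ZFSet.{u} → ZFSet.{u} → ZFSet.{u} → ZFSet.{u} → ZFSet.{u} → ZFSet.{u} → Prop) : Prop where
  out : ∀ {m : ℕ} (a b c d e : ZFSet.{u} → Env.{u} m → ZFSet.{u}), DefT a → DefT b → DefT c → DefT d → DefT e →
    Def (fun M v => X M (a M v) (b M v) (c M v) (d M v) (e M v))

instance Def5.app (X : ZFSet.{u} → ZFSet.{u} → ZFSet.{u} → ZFSet.{u} → ZFSet.{u} → ZFSet.{u} → Prop) [h : Def5 X]
    {m : ℕ} (a b c d e : ZFSet.{u} → Env.{u} m → ZFSet.{u}) [ha : DefT a] [hb : DefT b] [hc : DefT c] [hd : DefT d] [he : DefT e] :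
    Def (fun M v => X M (a M v) (b M v) (c M v) (d M v) (e M v)) := h.out a b c d e ha hb hc hd he

theorem no_new {M A B T a : ZFSet.{u}} (hM : Base M) (hAC : AC M) (hA : A ∈ M) (hB : B ∈ M) (hT : T ∈ M) (ha : a ∈ M)
    (X : ZFSet.{u} → ZFSet.{u} → ZFSet.{u} → ZFSet.{u} → ZFSet.{u} → ZFSet.{u} → Prop) [Def5 X]
    (mono : ∀ M a n x P p p', p ⊆ p' → X M a n x P p → X M a n x P p') :
    ∀ p ∈ PP M A B, ∃ q ∈ PP M A B, p ⊆ q ∧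
      ((∃ n ∈ om, ∀ x ∈ T, ∀ r ∈ PP M A B, q ⊆ r → ¬ X M a n x (PP M A B) r) ∨
      (∀ n ∈ om, ∃ x ∈ T, X M a n x (PP M A B) q)) := by
  intro p hp
  have T' : Tr M := hM.trans
  have hPM := PP_mem hM hA hB
  by_cases hcase : ∃ q ∈ PP M A B, p ⊆ q ∧ ∃ n ∈ om, ∀ x ∈ T, ∀ r ∈ PP M A B, q ⊆ r → ¬ X M a n x (PP M A B) r
  · obtain ⟨q, hq, hpq, h⟩ := hcase
    exact ⟨q, hq, hpq, Or.inl h⟩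
  push Not at hcase
  have hpM := T' _ hPM _ hp
  have hTT := DefT.app (fun M (v : Env.{u} 3) => ZFSet.sep (fun t => ∃ m ∈ M, ∃ q ∈ M, ∃ e ∈ M,
    t = ZFSet.pair m (ZFSet.pair q e) ∧ v 2 ⊆ q ∧ Enum M e q)
    (ZFSet.prod om (ZFSet.prod (PP M (v 0) (v 1)) (Pw M (ZFSet.prod om (ZFSet.prod (v 0) (v 1))))))) hM ![A, B, p] (all3 hA hB hpM)
  simp only [Matrix.cons_val_zero, Matrix.cons_val_one, Matrix.cons_val] at hTT
  set TT := ZFSet.sep (fun t => ∃ m ∈ M, ∃ q ∈ M, ∃ e ∈ M,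
    t = ZFSet.pair m (ZFSet.pair q e) ∧ p ⊆ q ∧ Enum M e q)
    (ZFSet.prod om (ZFSet.prod (PP M A B) (Pw M (ZFSet.prod om (ZFSet.prod A B))))) with hTTe
  have hTTm : ∀ m q e, ZFSet.pair m (ZFSet.pair q e) ∈ TT ↔ m ∈ om ∧ q ∈ PP M A B ∧ e ∈ Pw M (ZFSet.prod om (ZFSet.prod A B)) ∧
      p ⊆ q ∧ Enum M e q := by
    intro m q e
    rw [hTTe, ZFSet.mem_sep, ZFSet.pair_mem_prod, ZFSet.pair_mem_prod]
    constructor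
    · rintro ⟨⟨h1, h2, h3⟩, m', _, q', _, e', _, h, h4⟩
      simp only [ZFSet.pair_inj] at h
      obtain ⟨rfl, rfl, rfl⟩ := h
      exact ⟨h1, h2, h3, h4⟩
    · rintro ⟨h1, h2, h3, h4⟩
      exact ⟨⟨h1, h2, h3⟩, m, T' _ (om_mem hM) _ h1, q, T' _ hPM _ h2, e, (mem_Pw.1 h3).1, rfl, h4⟩
  have hE := DefT.app (fun M (v : Env.{u} 4) => ZFSet.sep (fun z => ∃ m ∈ M, ∃ q ∈ M, ∃ e ∈ M, ∃ q' ∈ M, ∃ e' ∈ M,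
    z = ZFSet.pair (ZFSet.pair m (ZFSet.pair q e)) (ZFSet.pair (insert m m) (ZFSet.pair q' e')) ∧ q ⊆ q' ∧
     ∃ x ∈ v 1, X M (v 2) m x (v 3) q') (ZFSet.prod (v 0) (v 0))) hM ![TT, T, a, PP M A B] (all4 hTT hT ha hPM)
  simp only [Matrix.cons_val_zero, Matrix.cons_val_one, Matrix.cons_val] at hE
  obtain ⟨e0, he0, hen0⟩ := enum_restr hM hA hB hp
  have ht0 : ZFSet.pair (num 0) (ZFSet.pair p e0) ∈ TT :=
    (hTTm _ _ _).2 ⟨num_mem_om 0, hp, he0, fun _ h => h, hen0⟩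
  have H := dc hM hAC hTT hE ht0
  have tot : ∀ x ∈ TT, ∃ y ∈ TT, ZFSet.pair x y ∈ ZFSet.sep (fun z => ∃ m ∈ M, ∃ q ∈ M, ∃ e ∈ M, ∃ q' ∈ M, ∃ e' ∈ M,
      z = ZFSet.pair (ZFSet.pair m (ZFSet.pair q e)) (ZFSet.pair (insert m m) (ZFSet.pair q' e')) ∧ q ⊆ q' ∧
      ∃ x ∈ T, X M a m x (PP M A B) q') (ZFSet.prod TT TT) := by
    intro t ht
    obtain ⟨-, m, hm, q, hq, e, he, rfl, -⟩ := ZFSet.mem_sep.1 ht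
    obtain ⟨h1, h2, h3, h4, h5⟩ := (hTTm _ _ _).1 ht
    obtain ⟨x, hx, r, hr, hqr, hX⟩ := hcase q h2 h4 m h1
    obtain ⟨e', he', hen'⟩ := enum_restr hM hA hB hr
    have hin : ZFSet.pair (insert m m) (ZFSet.pair r e') ∈ TT := by
      refine (hTTm _ _ _).2 ⟨?_, hr, he', fun z hz => hqr (h4 hz), hen'⟩
      obtain ⟨i, rfl⟩ := mem_om.1 h1
      exact num_mem_om (i+1)
    exact ⟨_, hin, ZFSet.mem_sep.2 ⟨ZFSet.pair_mem_prod.2 ⟨ht, hin⟩, m, hm, q, hq, e, he, r, T' _ hPM _ hr, e', (mem_Pw.1 he').1, rfl,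
      hqr, x, hx, hX⟩⟩
  obtain ⟨s, hs, S, hS0, hST, hSE, hSs⟩ := H tot
  have form : ∀ n, ∃ q e, S n = ZFSet.pair (num n) (ZFSet.pair q e) := by
    intro n
    induction n with
    | zero => exact ⟨p, e0, hS0⟩
    | succ n ih =>
      obtain ⟨q, e, ih⟩ := ih
      obtain ⟨-, m, _, q1, _, e1, _, q2, _, e2, _, h, -⟩ := ZFSet.mem_sep.1 (hSE n)
      rw [ih] at h
      simp only [ZFSet.pair_inj] at h
      refine ⟨q2, e2, ?_⟩
      rw [h.2, ← h.1.1]; rfl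
  choose Q E hQE using form
  have hT2 : ∀ n, Q n ∈ PP M A B ∧ E n ∈ Pw M (ZFSet.prod om (ZFSet.prod A B)) ∧ p ⊆ Q n ∧ Enum M (E n) (Q n) := by
    intro n
    have := hST n
    rw [hQE] at this
    exact ((hTTm _ _ _).1 this).2
  have hE2 : ∀ n, Q n ⊆ Q (n + 1) ∧ ∃ x ∈ T, X M a (num n) x (PP M A B) (Q (n + 1)) := by
    intro n
    obtain ⟨-, m, _, q1, _, e1, _, q2, _, e2, _, h, h1, h2⟩ := ZFSet.mem_sep.1 (hSE n)
    rw [hQE, hQE] at h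
    simp only [ZFSet.pair_inj] at h
    obtain ⟨⟨rfl, rfl, rfl⟩, _, rfl, rfl⟩ := h
    exact ⟨h1, h2⟩
  obtain ⟨U, hU, hQU⟩ := sclosed hM hA hB hs num Q E (fun n => (hT2 n).1) (fun n => (hT2 n).2.2.2) (fun n => (hE2 n).1) (by
    intro z
    rw [hSs]
    simp only [hQE])
  refine ⟨U, hU, fun z hz => hQU 0 ((hT2 0).2.2.1 hz), Or.inr fun n hn => ?_⟩
  obtain ⟨i, rfl⟩ := mem_om.1 hn
  obtain ⟨x, hx, hX⟩ := (hE2 i).2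
  exact ⟨x, hx, mono _ _ _ _ _ _ _ (hQU (i+1)) hX⟩

theorem func_ground (C : Ctx.{u}) (hAC : AC C.M) {A B T a : ZFSet.{u}} (hA : A ∈ C.M) (hB : B ∈ C.M) (hP : C.P = PP C.M A B)
    (hT : T ∈ C.M) (ha : a ∈ C.M) (R : Ctx.{u} → Env.{u} 3 → Prop) [hR : FDef R]
    (tot : ∀ n ∈ om, ∃ x ∈ T, R C ![a, n, x])
    (fn : ∀ n ∈ om, ∀ x ∈ T, ∀ x' ∈ T, R C ![a, n, x] → R C ![a, n, x'] → x = x') :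
    ∃ g ∈ C.M, ∀ n ∈ om, ∀ x ∈ T, ZFSet.pair n x ∈ g ↔ R C ![a, n, x] := by
  have hM := C.hM.toBase
  have T' : Tr C.M := hM.trans
  obtain ⟨χ, h1, h2, h3⟩ := hR.mono
  let X : ZFSet.{u} → ZFSet.{u} → ZFSet.{u} → ZFSet.{u} → ZFSet.{u} → ZFSet.{u} → Prop :=
    fun M a n x P p => χ M ![a, n, x] P p
  have i5 : Def5 X := ⟨fun a b c d e ha hb hc hd he => by
    have := h1.app' ![a, b, c] (fun i => by fin_cases i <;> assumption) d e hd he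
    refine this.congr fun M hM v hv => ?_
    simp only [X]
    congr! 1
    funext i
    fin_cases i <;> rfl⟩
  have nn := no_new hM hAC hA hB hT ha X (fun M a n x P p p' h => h2 M _ P p p' h)
  rw [← hP] at nn
  have key : ∀ n ∈ om, ∀ x ∈ T, (R C ![a, n, x] ↔ ∃ p ∈ C.G, X C.M a n x C.P p) := fun n hn x hx =>
    h3 C _ (all3 ha (T' _ (om_mem hM) _ hn) (T' _ hT _ hx))
  have hD := DefT.app (fun M (v : Env.{u} 3) => ZFSet.sep (fun q =>
    (∃ n ∈ om, ∀ x ∈ v 1, ∀ r ∈ v 2, q ⊆ r → ¬ X M (v 0) n x (v 2) r) ∨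
      (∀ n ∈ om, ∃ x ∈ v 1, X M (v 0) n x (v 2) q)) (v 2)) hM ![a, T, C.P] (all3 ha hT C.hP)
  simp only [Matrix.cons_val_zero, Matrix.cons_val_one, Matrix.cons_val] at hD
  obtain ⟨q, hq, hqG⟩ := C.gen _ hD (fun z hz => (ZFSet.mem_sep.1 hz).1) (fun p hp => by
    obtain ⟨q, hq, hpq, h⟩ := nn p hp
    exact ⟨q, ZFSet.mem_sep.2 ⟨hq, h⟩, hpq⟩)
  obtain ⟨hqP, ⟨n, hn, h4⟩ | h4⟩ := ZFSet.mem_sep.1 hq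
  · obtain ⟨x, hx, hr⟩ := tot n hn
    obtain ⟨p, hp, hX⟩ := (key n hn x hx).1 hr
    obtain ⟨r, hr, hpr, hqr⟩ := C.dir p hp q hqG
    exact absurd (h2 _ _ _ _ _ hpr hX) (h4 x hx r (C.sub _ hr) hqr)
  have hg := DefT.app (fun M (v : Env.{u} 4) => ZFSet.sep (fun z => ∃ n ∈ M, ∃ x ∈ M, z = ZFSet.pair n x ∧
    X M (v 0) n x (v 2) (v 3)) (ZFSet.prod om (v 1))) hM ![a, T, C.P, q] (all4 ha hT C.hP (T' _ C.hP _ hqP))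
  simp only [Matrix.cons_val_zero, Matrix.cons_val_one, Matrix.cons_val] at hg
  have key2 : ∀ n ∈ om, ∀ x ∈ T, R C ![a, n, x] → X C.M a n x C.P q := by
    intro n hn x hx hr
    obtain ⟨x', hx', hX⟩ := h4 n hn
    rw [fn n hn x hx x' hx' hr ((key n hn x' hx').2 ⟨q, hqG, hX⟩)]
    exact hX
  refine ⟨_, hg, fun n hn x hx => ?_⟩
  rw [ZFSet.mem_sep, ZFSet.pair_mem_prod]
  constructor
  · rintro ⟨-, n', _, x', _, e, hX⟩
    obtain ⟨rfl, rfl⟩ := ZFSet.pair_inj.1 e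
    exact (key n hn x hx).2 ⟨q, hqG, hX⟩
  · intro hr
    exact ⟨⟨hn, hx⟩, n, T' _ (om_mem hM) _ hn, x, T' _ hT _ hx, rfl, key2 n hn x hx hr⟩

end

section
/-! ### The extension satisfies `CH` -/

theorem reals_NN (C : Ctx.{u}) (hAC : AC C.M) {A B : ZFSet.{u}} (hA : A ∈ C.M) (hB : B ∈ C.M) (hP : C.P = PP C.M A B) :
    Pw (NN C) om = Pw C.M om := by
  have hM := C.hM.toBase
  have T' : Tr C.M := hM.trans
  ext y
  rw [mem_Pw, mem_Pw]
  refine ⟨fun ⟨hy, hs⟩ => ⟨?_, hs⟩, fun ⟨hy, hs⟩ => ⟨sub_NN C hy, hs⟩⟩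
  obtain ⟨a, ha, rfl⟩ := mem_NN.1 hy
  have i : FDef (fun C (v : Env.{u} 3) => (val C (ZFSet.pair ∅ (v 1)) ∈ val C (v 0) ∧ v 2 = {∅}) ∨
      (¬ val C (ZFSet.pair ∅ (v 1)) ∈ val C (v 0) ∧ v 2 = ∅)) := inferInstance
  have h1 : ∀ n ∈ om, val C (ZFSet.pair ∅ n) = n := fun n hn => val_const (T' _ (om_mem hM) _ hn)
  have hne : ({∅} : ZFSet.{u}) ≠ ∅ := fun h => ZFSet.notMem_empty ∅ (((ZFSet.ext_iff.1 h) ∅).1 (ZFSet.mem_singleton.2 rfl))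
  obtain ⟨g, hg, hgm⟩ := @func_ground C hAC A B {∅, {∅}} a hA hB hP
    (DefT.app (fun M (v : Env.{u} 0) => {∅, {∅}}) hM default (env0 _)) ha _ i (by
      intro n hn
      simp only [Matrix.cons_val_zero, Matrix.cons_val_one, Matrix.cons_val]
      by_cases h : val C (ZFSet.pair ∅ n) ∈ val C a
      · exact ⟨{∅}, by simp, Or.inl ⟨h, rfl⟩⟩
      · exact ⟨∅, by simp, Or.inr ⟨h, rfl⟩⟩) (by
      intro n hn x hx x' hx'
      simp only [Matrix.cons_val_zero, Matrix.cons_val_one, Matrix.cons_val]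
      rintro (⟨h, rfl⟩ | ⟨h, rfl⟩) (⟨h', rfl⟩ | ⟨h', rfl⟩) <;> first | rfl | contradiction)
  simp only [Matrix.cons_val_zero, Matrix.cons_val_one, Matrix.cons_val] at hgm
  have h := DefT.app (fun M (v : Env.{u} 1) => ZFSet.sep (fun n => ZFSet.pair n {∅} ∈ v 0) om) hM ![g] (all1 hg)
  simp only [Matrix.cons_val_zero] at h
  convert h using 1
  ext n
  rw [ZFSet.mem_sep]
  constructor
  · intro hn
    exact ⟨hs hn, (hgm n (hs hn) {∅} (by simp)).2 (Or.inl ⟨by rwa [h1 n (hs hn)], rfl⟩)⟩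
  · rintro ⟨hn, h⟩
    rcases (hgm n hn {∅} (by simp)).1 h with ⟨h, -⟩ | ⟨-, h⟩
    · rwa [h1 n hn] at h
    · exact absurd h hne

theorem no_surj_NN (C : Ctx.{u}) (hAC : AC C.M) {A B k : ZFSet.{u}} (hA : A ∈ C.M) (hB : B ∈ C.M) (hP : C.P = PP C.M A B)
    (hk : k ∈ C.M) (hkn : ¬ Ctbl C.M k) : ¬ ∃ f ∈ NN C, Surj (NN C) om k f := by
  have hM := C.hM.toBase
  have T' : Tr C.M := hM.trans
  rintro ⟨f, hf, ⟨h1, h2⟩, h3, h4⟩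
  obtain ⟨a, ha, rfl⟩ := mem_NN.1 hf
  have i : FDef (fun C (v : Env.{u} 3) => val C (ZFSet.pair ∅ (ZFSet.pair (v 1) (v 2))) ∈ val C (v 0)) := inferInstance
  have e1 : ∀ n ∈ om, ∀ x ∈ k, val C (ZFSet.pair ∅ (ZFSet.pair n x)) = ZFSet.pair n x :=
    fun n hn x hx => val_const (hM.pair (T' _ (om_mem hM) _ hn) (T' _ hk _ hx))
  obtain ⟨g, hg, hgm⟩ := @func_ground C hAC A B k a hA hB hP hk ha _ i (by
      intro n hn
      obtain ⟨y, hy, h⟩ := h2 n hn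
      exact ⟨y, hy, by
        simp only [Matrix.cons_val_zero, Matrix.cons_val_one, Matrix.cons_val]
        rwa [e1 n hn y hy]⟩) (by
      intro n hn x hx x' hx'
      simp only [Matrix.cons_val_zero, Matrix.cons_val_one, Matrix.cons_val]
      rw [e1 n hn x hx, e1 n hn x' hx']
      intro h5 h6
      have s : ∀ z ∈ C.M, z ∈ NN C := fun z hz => sub_NN C hz
      exact h3 n (s _ (T' _ (om_mem hM) _ hn)) x (s _ (T' _ hk _ hx)) x' (s _ (T' _ hk _ hx')) ⟨h5, h6⟩)
  simp only [Matrix.cons_val_zero, Matrix.cons_val_one, Matrix.cons_val] at hgm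
  have h := DefT.app (fun M (v : Env.{u} 2) => ZFSet.sep (fun z => z ∈ v 0) (ZFSet.prod om (v 1))) hM ![g, k] (all2 hg hk)
  simp only [Matrix.cons_val_zero, Matrix.cons_val_one] at h
  refine hkn ⟨_, h, ?_, ?_⟩
  · intro n hn x hx y hy h5 h6
    obtain ⟨h5, h5'⟩ := ZFSet.mem_sep.1 h5
    obtain ⟨h6, h6'⟩ := ZFSet.mem_sep.1 h6
    have hxk := (ZFSet.pair_mem_prod.1 h5).2
    have hyk := (ZFSet.pair_mem_prod.1 h6).2
    rw [hgm n hn x hxk, e1 n hn x hxk] at h5'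
    rw [hgm n hn y hyk, e1 n hn y hyk] at h6'
    have s : ∀ z ∈ C.M, z ∈ NN C := fun z hz => sub_NN C hz
    exact h3 n (s _ (T' _ (om_mem hM) _ hn)) x (s _ hx) y (s _ hy) ⟨h5', h6'⟩
  · intro z hz
    obtain ⟨n, hn, h5⟩ := h4 z hz
    refine ⟨n, hn, ZFSet.mem_sep.2 ⟨ZFSet.pair_mem_prod.2 ⟨hn, hz⟩, (hgm n hn z hz).2 ?_⟩⟩
    rwa [e1 n hn z hz]

theorem surj_of_ctbl {M x : ZFSet.{u}} (hM : Base M) (hx : x ∈ M) (h : Ctbl M x) :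
    x = ∅ ∨ ∃ f ∈ M, (∀ z ∈ f, ∃ n ∈ om, ∃ y ∈ x, z = ZFSet.pair n y) ∧ (∀ n ∈ om, ∃ y ∈ x, ZFSet.pair n y ∈ f) ∧
      (∀ n y y', ZFSet.pair n y ∈ f → ZFSet.pair n y' ∈ f → y = y') ∧ ∀ y ∈ x, ∃ n ∈ om, ZFSet.pair n y ∈ f := by
  have T' : Tr M := hM.trans
  by_cases hne : ∃ c, c ∈ x
  swap
  · left
    ext z
    exact ⟨fun hz => absurd ⟨z, hz⟩ hne, fun hz => absurd hz (ZFSet.notMem_empty z)⟩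
  right
  obtain ⟨c, hc⟩ := hne
  obtain ⟨e, he, h1, h2⟩ := h
  have hf := DefT.app (fun M (v : Env.{u} 3) => ZFSet.sep (fun z => ∃ n ∈ M, ∃ y ∈ M, z = ZFSet.pair n y ∧
    (ZFSet.pair n y ∈ v 1 ∨ ((¬ ∃ y' ∈ v 0, ZFSet.pair n y' ∈ v 1) ∧ y = v 2))) (ZFSet.prod om (v 0))) hM ![x, e, c]
    (all3 hx he (T' _ hx _ hc))
  simp only [Matrix.cons_val_zero, Matrix.cons_val_one, Matrix.cons_val] at hf
  set f := ZFSet.sep (fun z => ∃ n ∈ M, ∃ y ∈ M, z = ZFSet.pair n y ∧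
    (ZFSet.pair n y ∈ e ∨ ((¬ ∃ y' ∈ x, ZFSet.pair n y' ∈ e) ∧ y = c))) (ZFSet.prod om x) with hfe
  have hfm : ∀ n y, ZFSet.pair n y ∈ f ↔ (n ∈ om ∧ y ∈ x) ∧ (ZFSet.pair n y ∈ e ∨ ((¬ ∃ y' ∈ x, ZFSet.pair n y' ∈ e) ∧ y = c)) := by
    intro n y
    rw [hfe, ZFSet.mem_sep, ZFSet.pair_mem_prod]
    refine and_congr_right fun h => ⟨?_, fun h' => ⟨n, T' _ (om_mem hM) _ h.1, y, T' _ hx _ h.2, rfl, h'⟩⟩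
    rintro ⟨n', _, y', _, e, h'⟩
    obtain ⟨rfl, rfl⟩ := ZFSet.pair_inj.1 e
    exact h'
  refine ⟨f, hf, fun z hz => ZFSet.mem_prod.1 (ZFSet.mem_sep.1 hz).1, fun n hn => ?_, ?_, ?_⟩
  · by_cases hy : ∃ y' ∈ x, ZFSet.pair n y' ∈ e
    · obtain ⟨y, hy, h⟩ := hy
      exact ⟨y, hy, (hfm _ _).2 ⟨⟨hn, hy⟩, Or.inl h⟩⟩
    · exact ⟨c, hc, (hfm _ _).2 ⟨⟨hn, hc⟩, Or.inr ⟨hy, rfl⟩⟩⟩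
  · intro n y y' h3 h4
    rw [hfm] at h3 h4
    obtain ⟨⟨hn, hy⟩, h3⟩ := h3
    obtain ⟨⟨-, hy'⟩, h4⟩ := h4
    rcases h3 with h3 | ⟨h3, rfl⟩ <;> rcases h4 with h4 | ⟨h4, rfl⟩
    · exact h1 n hn y (T' _ hx _ hy) y' (T' _ hx _ hy') h3 h4
    · exact absurd ⟨_, hy, h3⟩ h4
    · exact absurd ⟨_, hy', h4⟩ h3
    · rfl
  · intro y hy
    obtain ⟨n, hn, h3⟩ := h2 y hy
    exact ⟨n, hn, (hfm _ _).2 ⟨⟨hn, hy⟩, Or.inl h3⟩⟩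

theorem extend {M A B p x y : ZFSet.{u}} (hM : Base M) (hA : A ∈ M) (hB : B ∈ M) (hp : p ∈ PP M A B) (hx : x ∈ A) (hy : y ∈ B)
    (h1 : ∀ y' ∈ M, ZFSet.pair x y' ∉ p) (h2 : ∀ x' ∈ M, ZFSet.pair x' y ∉ p) : insert (ZFSet.pair x y) p ∈ PP M A B := by
  have T' : Tr M := hM.trans
  have hxy := hM.pair (T' _ hA _ hx) (T' _ hB _ hy)
  obtain ⟨⟨hpM, hps⟩, h3, h4, h5⟩ := mem_PP.1 hp
  have h := DefT.app (fun M (v : Env.{u} 2) => insert (v 0) (v 1)) hM ![_, p] (all2 hxy hpM)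
  simp only [Matrix.cons_val_zero, Matrix.cons_val_one] at h
  refine mem_PP.2 ⟨⟨h, ?_⟩, ?_, ?_, h5.ins hM hpM hxy⟩
  · intro z hz
    rcases ZFSet.mem_insert_iff.1 hz with rfl | hz
    · exact ZFSet.pair_mem_prod.2 ⟨hx, hy⟩
    · exact hps hz
  · intro a ha b hb b' hb' h6 h7
    simp only [ZFSet.mem_insert_iff, ZFSet.pair_inj] at h6 h7
    rcases h6 with ⟨rfl, rfl⟩ | h6 <;> rcases h7 with ⟨e, rfl⟩ | h7
    · rfl
    · exact absurd h7 (h1 _ hb')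
    · subst e; exact absurd h6 (h1 _ hb)
    · exact h3 a ha b hb b' hb' h6 h7
  · intro a ha a' ha' b hb h6 h7
    simp only [ZFSet.mem_insert_iff, ZFSet.pair_inj] at h6 h7
    rcases h6 with ⟨rfl, rfl⟩ | h6 <;> rcases h7 with ⟨rfl, e⟩ | h7
    · rfl
    · exact absurd h7 (h2 _ ha')
    · subst e; exact absurd h6 (h2 _ ha)
    · exact h4 a ha a' ha' b hb h6 h7

theorem fresh_snd {M A B p : ZFSet.{u}} (hM : Base M) (hB : B ∈ M) (hp : p ∈ PP M A B) (hn : ¬ Ctbl M B) :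
    ∃ y ∈ B, ∀ x ∈ M, ZFSet.pair x y ∉ p := by
  by_contra hc
  push Not at hc
  obtain ⟨⟨hpM, hps⟩, h3, h4, h5⟩ := mem_PP.1 hp
  have hf := DefT.app (fun M (v : Env.{u} 2) => ZFSet.sep (fun z => ∃ x ∈ M, ∃ y ∈ M, z = ZFSet.pair (ZFSet.pair x y) y)
    (ZFSet.prod (v 0) (v 1))) hM ![p, B] (all2 hpM hB)
  simp only [Matrix.cons_val_zero, Matrix.cons_val_one] at hf
  refine hn (h5.image hM hB hf ?_ ?_)
  · intro x _ y _ y' _ h6 h7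
    obtain ⟨-, a, _, b, _, e⟩ := ZFSet.mem_sep.1 h6
    obtain ⟨-, a', _, b', _, e'⟩ := ZFSet.mem_sep.1 h7
    simp only [ZFSet.pair_inj] at e e'
    obtain ⟨rfl, rfl⟩ := e
    obtain ⟨e, rfl⟩ := e'
    exact (ZFSet.pair_inj.1 e).2
  · intro y hy
    obtain ⟨x, hx, h⟩ := hc y hy
    exact ⟨_, h, ZFSet.mem_sep.2 ⟨ZFSet.pair_mem_prod.2 ⟨h, hy⟩, x, hx, y, hM.trans _ hB _ hy, rfl⟩⟩

theorem fresh_fst {M A B p : ZFSet.{u}} (hM : Base M) (hA : A ∈ M) (hp : p ∈ PP M A B) (hn : ¬ Ctbl M A) :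
    ∃ x ∈ A, ∀ y ∈ M, ZFSet.pair x y ∉ p := by
  by_contra hc
  push Not at hc
  obtain ⟨⟨hpM, hps⟩, h3, h4, h5⟩ := mem_PP.1 hp
  have hf := DefT.app (fun M (v : Env.{u} 2) => ZFSet.sep (fun z => ∃ x ∈ M, ∃ y ∈ M, z = ZFSet.pair (ZFSet.pair x y) x)
    (ZFSet.prod (v 0) (v 1))) hM ![p, A] (all2 hpM hA)
  simp only [Matrix.cons_val_zero, Matrix.cons_val_one] at hf
  refine hn (h5.image hM hA hf ?_ ?_)
  · intro x _ y _ y' _ h6 h7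
    obtain ⟨-, a, _, b, _, e⟩ := ZFSet.mem_sep.1 h6
    obtain ⟨-, a', _, b', _, e'⟩ := ZFSet.mem_sep.1 h7
    simp only [ZFSet.pair_inj] at e e'
    obtain ⟨rfl, rfl⟩ := e
    obtain ⟨e, rfl⟩ := e'
    exact (ZFSet.pair_inj.1 e).1
  · intro x hx
    obtain ⟨y, hy, h⟩ := hc x hx
    exact ⟨_, h, ZFSet.mem_sep.2 ⟨ZFSet.pair_mem_prod.2 ⟨h, hx⟩, x, hM.trans _ hA _ hx, y, hy, rfl⟩⟩

theorem ch_NN (C : Ctx.{u}) (hAC : AC C.M) {k : ZFSet.{u}} (hk : k ∈ C.M) (hko : IsOrd k) (hkn : ¬ Ctbl C.M k)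
    (hkc : ∀ x ∈ k, Ctbl C.M x) (hP : C.P = PP C.M (Pw C.M om) k) : Sat (NN C) (chSent : BF 0) default := by
  have hM := C.hM.toBase
  have T' : Tr C.M := hM.trans
  have hN := base_NN C
  have TN := trans_NN C
  have hR : Pw C.M om ∈ C.M := DefT.app (fun M (v : Env.{u} 0) => Pw M om) hM default (env0 _)
  have hRn := cantor hM
  have hD := DefT.app (fun M (v : Env.{u} 2) => ZFSet.prod (v 0) (v 1)) hM ![Pw C.M om, k] (all2 hR hk)
  simp only [Matrix.cons_val_zero, Matrix.cons_val_one] at hD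
  have i : FDef (fun C (w : Env.{u} (0 + 1)) => ∃ p ∈ C.G, w (Fin.last 0) ∈ p) :=
    ⟨fun _ w _ p => w (Fin.last 0) ∈ p, ⟨inferInstance⟩, fun _ _ _ => Iff.rfl⟩
  have hb := FDef.ground (n := 0) (fun C _ z => ∃ p ∈ C.G, z ∈ p) C default (env0 _) _ hD
  set b := ZFSet.sep (fun z => ∃ p ∈ C.G, z ∈ p) (ZFSet.prod (Pw C.M om) k) with hbe
  have hbm : ∀ z, z ∈ b ↔ ∃ p ∈ C.G, z ∈ p := by
    intro z
    rw [hbe, ZFSet.mem_sep]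
    refine ⟨fun h => h.2, fun h => ⟨?_, h⟩⟩
    obtain ⟨p, hp, hz⟩ := h
    have := C.sub p hp
    rw [hP] at this
    exact (mem_PP.1 this).1.2 hz
  have hbM : ∀ x y, ZFSet.pair x y ∈ b → x ∈ C.M ∧ y ∈ C.M := fun x y h =>
    hM.of_pair (T' _ hD _ (ZFSet.mem_sep.1 h).1)
  have two : ∀ z z', z ∈ b → z' ∈ b → ∃ p ∈ PP C.M (Pw C.M om) k, z ∈ p ∧ z' ∈ p := by
    intro z z' h h'
    obtain ⟨p, hp, h⟩ := (hbm z).1 h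
    obtain ⟨p', hp', h'⟩ := (hbm z').1 h'
    obtain ⟨r, hr, h1, h2⟩ := C.dir p hp p' hp'
    exact ⟨r, hP ▸ C.sub r hr, h1 h, h2 h'⟩
  refine sat_chSent hN (sub_NN C (om_mem hM)) (sub_NN C hR) (sub_NN C hk) hb om_ord (num_mem_om 0) ?_ ?_
    (reals_NN C hAC hR hk hP).symm hko (no_surj_NN C hAC hR hk hP hk hkn) ?_ ⟨⟨?_, ?_⟩, ?_, ?_⟩ ?_
  · intro x hx
    obtain ⟨n, rfl⟩ := mem_om.1 hx
    exact num_mem_om (n+1)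
  · intro x hx
    obtain ⟨n, rfl⟩ := mem_om.1 hx
    rcases n with _ | n
    · exact Or.inl rfl
    · exact Or.inr ⟨num n, ZFSet.mem_insert _ _, rfl⟩
  · intro x hx
    rcases surj_of_ctbl hM (T' _ hk _ hx) (hkc x hx) with h | ⟨f, hf, h1, h2, h3, h4⟩
    · exact Or.inl h
    · exact Or.inr ⟨f, sub_NN C hf, ⟨h1, h2⟩, fun n _ y _ y' _ h => h3 n y y' h.1 h.2, h4⟩
  · intro z hz
    exact ZFSet.mem_prod.1 (ZFSet.mem_sep.1 hz).1
  · intro x hx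
    have hd := DefT.app (fun M (v : Env.{u} 3) => ZFSet.sep (fun p => ∃ y ∈ v 1, ZFSet.pair (v 2) y ∈ p) (v 0)) hM ![C.P, k, x]
      (all3 C.hP hk (T' _ hR _ hx))
    simp only [Matrix.cons_val_zero, Matrix.cons_val_one, Matrix.cons_val] at hd
    obtain ⟨p, hp, hpG⟩ := C.gen _ hd (fun z hz => (ZFSet.mem_sep.1 hz).1) (by
      intro p hp
      by_cases h : ∃ y ∈ C.M, ZFSet.pair x y ∈ p
      · obtain ⟨y, hy, h⟩ := h
        have hp' := hP ▸ hp
        exact ⟨p, ZFSet.mem_sep.2 ⟨hp, y, (ZFSet.pair_mem_prod.1 ((mem_PP.1 hp').1.2 h)).2, h⟩, fun _ h => h⟩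
      · push Not at h
        have hp' := hP ▸ hp
        obtain ⟨y, hy, hf⟩ := fresh_snd hM hk hp' hkn
        refine ⟨_, ZFSet.mem_sep.2 ⟨hP ▸ extend hM hR hk hp' hx hy h hf, y, hy, ZFSet.mem_insert _ _⟩, fun z hz => ZFSet.mem_insert_of_mem _ hz⟩)
    obtain ⟨-, y, hy, h⟩ := ZFSet.mem_sep.1 hp
    exact ⟨y, hy, (hbm _).2 ⟨p, hpG, h⟩⟩
  · rintro x - y - y' - ⟨h1, h2⟩
    obtain ⟨p, hp, h3, h4⟩ := two _ _ h1 h2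
    exact (mem_PP.1 hp).2.1 x (hbM _ _ h1).1 y (hbM _ _ h1).2 y' (hbM _ _ h2).2 h3 h4
  · intro y hy
    have hd := DefT.app (fun M (v : Env.{u} 3) => ZFSet.sep (fun p => ∃ x ∈ v 1, ZFSet.pair x (v 2) ∈ p) (v 0)) hM ![C.P, Pw C.M om, y]
      (all3 C.hP hR (T' _ hk _ hy))
    simp only [Matrix.cons_val_zero, Matrix.cons_val_one, Matrix.cons_val] at hd
    obtain ⟨p, hp, hpG⟩ := C.gen _ hd (fun z hz => (ZFSet.mem_sep.1 hz).1) (by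
      intro p hp
      by_cases h : ∃ x ∈ C.M, ZFSet.pair x y ∈ p
      · obtain ⟨x, hx, h⟩ := h
        have hp' := hP ▸ hp
        exact ⟨p, ZFSet.mem_sep.2 ⟨hp, x, (ZFSet.pair_mem_prod.1 ((mem_PP.1 hp').1.2 h)).1, h⟩, fun _ h => h⟩
      · push Not at h
        have hp' := hP ▸ hp
        obtain ⟨x, hx, hf⟩ := fresh_fst hM hR hp' hRn
        refine ⟨_, ZFSet.mem_sep.2 ⟨hP ▸ extend hM hR hk hp' hx hy hf h, x, hx, ZFSet.mem_insert _ _⟩, fun z hz => ZFSet.mem_insert_of_mem _ hz⟩)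
    obtain ⟨-, x, hx, h⟩ := ZFSet.mem_sep.1 hp
    exact ⟨x, hx, (hbm _).2 ⟨p, hpG, h⟩⟩
  · rintro x - x' - y - ⟨h1, h2⟩
    obtain ⟨p, hp, h3, h4⟩ := two _ _ h1 h2
    exact (mem_PP.1 hp).2.2.1 x (hbM _ _ h1).1 x' (hbM _ _ h2).1 y (hbM _ _ h1).2 h3 h4

end

/-! ### Generic filters exist -/

theorem exists_ctx {M P : ZFSet.{u}} (hM : BaseV M) (hc : M.toSet.Countable) (hP : P ∈ M) (h0 : ∅ ∈ P) :
    ∃ C : Ctx.{u}, C.M = M ∧ C.P = P := by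
  have hne : M.toSet.Nonempty := ⟨P, hP⟩
  obtain ⟨D, hD⟩ := hc.exists_eq_range hne
  have step : ∀ (n : ℕ) (p : ZFSet.{u}), ∃ q, p ∈ P → q ∈ P ∧ p ⊆ q ∧ ((∃ r ∈ D n, r ∈ P ∧ p ⊆ r) → q ∈ D n) := by
    intro n p
    by_cases h : ∃ r ∈ D n, r ∈ P ∧ p ⊆ r
    · obtain ⟨r, h1, h2, h3⟩ := h
      exact ⟨r, fun _ => ⟨h2, h3, fun _ => h1⟩⟩
    · exact ⟨p, fun hp => ⟨hp, fun _ h => h, fun h' => absurd h' h⟩⟩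
  choose f hf using step
  let s : ℕ → ZFSet.{u} := fun n => Nat.rec ∅ f n
  have hs : ∀ n, s n ∈ P := by
    intro n
    induction n with
    | zero => exact h0
    | succ n ih => exact (hf n _ ih).1
  have hs1 : ∀ n, s n ⊆ s (n + 1) := fun n => (hf n _ (hs n)).2.1
  have mono : ∀ i j, i ≤ j → s i ⊆ s j := by
    intro i j hij
    induction hij with
    | refl => exact fun _ h => h
    | step _ ih => exact fun z h => hs1 _ (ih h)
  refine ⟨⟨M, P, ZFSet.sep (fun p => ∃ n, p ⊆ s n) P, hM, hP, fun p hp => (ZFSet.mem_sep.1 hp).1, ⟨∅, ?_⟩, ?_, ?_, ?_⟩, rfl, rfl⟩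
  · exact ZFSet.mem_sep.2 ⟨h0, 0, fun _ h => h⟩
  · intro q hq p hp hpq
    obtain ⟨_, n, hn⟩ := ZFSet.mem_sep.1 hq
    exact ZFSet.mem_sep.2 ⟨hp, n, fun z hz => hn (hpq hz)⟩
  · intro p hp q hq
    obtain ⟨_, n, hn⟩ := ZFSet.mem_sep.1 hp
    obtain ⟨_, m, hm⟩ := ZFSet.mem_sep.1 hq
    exact ⟨s (max n m), ZFSet.mem_sep.2 ⟨hs _, _, fun _ h => h⟩, fun z hz => mono _ _ (le_max_left n m) (hn hz),
      fun z hz => mono _ _ (le_max_right n m) (hm hz)⟩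
  · intro d hd hdP hdense
    have : d ∈ Set.range D := by
      rw [← hD]; exact hd
    obtain ⟨n, rfl⟩ := this
    obtain ⟨q, hq, hpq⟩ := hdense (s n) (hs n)
    have h := (hf n _ (hs n)).2.2 ⟨q, hq, hdP hq, hpq⟩
    exact ⟨s (n + 1), h, ZFSet.mem_sep.2 ⟨hs (n + 1), n + 1, fun _ h => h⟩⟩

/-! ### Counting leading quantifiers -/

def lead : {n : ℕ} → BF n → ℕ
  | _, .falsum => 0
  | _, .equal _ _ => 0
  | _, .rel _ _ => 0
  | _, .imp _ _ => 0
  | _, .all φ => lead φ + 1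

theorem lead_alls : ∀ {n : ℕ} (φ : BF n), lead (φ.alls : BF 0) = lead φ + n
  | 0, _ => rfl
  | n + 1, φ => by
    refine (lead_alls φ.all).trans ?_
    simp only [lead]
    omega

theorem lead_repl {n : ℕ} (φ : BF (n + 2)) : lead (replAx φ : BF 0) = n + 1 := by
  unfold replAx
  refine (lead_alls _).trans ?_
  simp only [lead]
  omega

theorem exists_Om (φ : BF (0 + 2)) : ∃ Ω : Finset SetLang.Sentence, Ω.card = 22 ∧
    (∀ s ∈ Ω, ∃ p : Σ n : ℕ, BF (n + 2), s = replAx p.2) ∧ replAx φ ∈ Ω := by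
  classical
  let g : ℕ → Σ n : ℕ, BF (n + 2) := fun n => match n with
    | 0 => ⟨0, φ⟩
    | n + 1 => ⟨n + 1, .falsum⟩
  have hg : ∀ n, (g n).1 = n := fun n => by cases n <;> rfl
  let G : ℕ → SetLang.Sentence := fun n => replAx (g n).2
  have hG : Function.Injective G := by
    intro m n h
    have h1 : lead (G m : BF 0) = lead (G n : BF 0) := by rw [h]
    have h2 : lead (G m : BF 0) = (g m).1 + 1 := lead_repl _
    have h3 : lead (G n : BF 0) = (g n).1 + 1 := lead_repl _
    rw [h2, h3, hg, hg] at h1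
    omega
  refine ⟨(Finset.range 22).image G, ?_, ?_, ?_⟩
  · rw [Finset.card_image_of_injective _ hG, Finset.card_range]
  · intro s hs
    obtain ⟨n, -, rfl⟩ := Finset.mem_image.1 hs
    exact ⟨g n, rfl⟩
  · exact Finset.mem_image.2 ⟨0, by simp, rfl⟩

/-- there are twenty-two replacement instances `Ω'` and a map `F` on formulas
such that any ctm of `ZC ∪ {Replacement(F(φ)) : φ ∈ Φ} ∪ Ω'` has a countable transitive
extension with the same ordinals satisfying `ZC ∪ {Replacement(φ) : φ ∈ Φ} ∪ {CH}`. -/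
theorem ctm_of_CH :
    ∃ (Ω : Finset SetLang.Sentence)
      (F : (Σ n : ℕ, BF (n + 2)) → (Σ n : ℕ, BF (n + 2))),
      Ω.card = 22 ∧
      (∀ s ∈ Ω, ∃ p : Σ n : ℕ, BF (n + 2), s = replAx p.2) ∧
      ∀ (Φ : Set (Σ n : ℕ, BF (n + 2))) (M : ZFSet),
        M.toSet.Countable → M.IsTransitive →
        ZModels M (ZC ∪ (fun p => replAx (F p).2) '' Φ ∪ ↑Ω) →
        ∃ N : ZFSet, M ⊆ N ∧ N.toSet.Countable ∧ N.IsTransitive ∧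
          (∀ α : ZFSet, IsOrd α → (α ∈ M ↔ α ∈ N)) ∧
          ZModels N (ZC ∪ (fun p : Σ n : ℕ, BF (n + 2) => replAx p.2) '' Φ ∪ {chSent}) := by
  obtain ⟨φ, hφ⟩ := exists_vrepl
  obtain ⟨Ω, h1, h2, h3⟩ := exists_Om φ
  choose ψ hψ using fun p : (Σ n : ℕ, BF (n + 2)) => exists_repl p.2
  refine ⟨Ω, fun p => ⟨p.1 + 1, ψ p⟩, h1, h2, fun Φ M hc ht hMod => ?_⟩
  rw [ZModels_iff] at hMod
  have hB : Base M := base_of_Z (fun x hx y hy => ht x hx hy) fun φ h => hMod φ (Or.inl (Or.inl (Or.inl h)))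
  have hV : BaseV M := ⟨hB, fun x hx => witP_all hB (hφ M hB (hMod _ (Or.inr h3))) hx⟩
  have hAC : AC M := (sat_acAx hB).1 (hMod _ (Or.inl (Or.inl (Or.inr rfl))))
  obtain ⟨k, hk, hko, hkn, hkc⟩ := exists_omega1 hB hAC
  have hR : Pw M om ∈ M := DefT.app (fun M (v : Env 0) => Pw M om) hB default (env0 _)
  obtain ⟨C, rfl, hP⟩ := exists_ctx hV hc (PP_mem hB hR hk) (empty_PP hB)
  refine ⟨NN C, fun x hx => sub_NN C hx, ?_, fun x hx y hy => trans_NN C x hx y hy, fun α hα => ⟨fun h => sub_NN C h, ord_NN C hα⟩, ?_⟩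
  · refine (hc.image (val C)).mono ?_
    intro z hz
    obtain ⟨x, hx, rfl⟩ := mem_NN.1 (show z ∈ NN C from hz)
    exact ⟨x, hx, rfl⟩
  · rw [ZModels_iff]
    rintro θ (((h | h) | ⟨p, hp, rfl⟩) | h)
    · exact Z_of_base (base_NN C) θ h
    · rw [Set.mem_singleton_iff] at h
      subst h
      exact (sat_acAx (base_NN C)).2 (ac_NN C hAC)
    · exact hψ p C (hMod _ (Or.inl (Or.inr ⟨p, hp, rfl⟩)))
    · rw [Set.mem_singleton_iff] at h
      subst h
      exact ch_NN C hAC hk hko hkn hkc hP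

end CtmForcing
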